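/- arXiv:2101.01879 — 4 statements merged into one kernel-verified Lean document; each statement's English description precedes it below -/
import Mathlib

section
/- Let p be an odd prime, let k and k' be positive even integers neither of which is divisible by p−1, let d ≥ 1 be an integer, and suppose k ≡ k' (mod (p−1)·p^{d−1}). Then the rational number (1−p^{k−1})·(−B_k/k) − (1−p^{k'−1})·(−B_{k'}/k') is either zero or has p-adic valuation at least d; that is, the modified zeta values (1−p^{k−1})ζ(1−k) and (1−p^{k'−1})ζ(1−k') are congruent modulo p^d (Kummer's congruences). -/
open Finset Filter Topology

lemma kc_sum_mult (p m k : ℕ) (hp : 0 < p) :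
    ∑ j ∈ (range (p * m)).filter (fun j => p ∣ j), (j : ℤ) ^ k
      = (p : ℤ) ^ k * ∑ j ∈ range m, (j : ℤ) ^ k := by
  rw [mul_sum]
  symm
  apply Finset.sum_bij (fun i _ => p * i)
  · intro i hi
    simp only [mem_filter, mem_range] at hi ⊢
    exact ⟨Nat.mul_lt_mul_of_pos_left hi hp, dvd_mul_right _ _⟩
  · intro i _ j _ h
    exact Nat.eq_of_mul_eq_mul_left hp h
  · intro b hb
    simp only [mem_filter, mem_range] at hb
    obtain ⟨h1, c, rfl⟩ := hb
    exact ⟨c, by simpa using Nat.lt_of_mul_lt_mul_left h1, rfl⟩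
  · intro i _
    push_cast
    ring

lemma kc_split (p m k : ℕ) (hp : 0 < p) :
    ∑ j ∈ (range (p * m)).filter (fun j => ¬ p ∣ j), (j : ℤ) ^ k
      = ∑ j ∈ range (p * m), (j : ℤ) ^ k - (p : ℤ) ^ k * ∑ j ∈ range m, (j : ℤ) ^ k := by
  rw [← kc_sum_mult p m k hp, ← Finset.sum_filter_add_sum_filter_not (range (p * m)) (fun j => p ∣ j)]
  ring

lemma kc_not_dvd_mod {p N a j : ℕ} (hp : p.Prime) (hpN : p ∣ N) (ha : ¬ p ∣ a) (hj : ¬ p ∣ j) :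
    ¬ p ∣ (a * j) % N := by
  rw [Nat.dvd_mod_iff hpN, hp.dvd_mul]
  tauto

lemma kc_perm (p n a k : ℕ) (hp : p.Prime) (ha : ¬ p ∣ a) :
    ∑ j ∈ (range (p ^ (n + 1))).filter (fun j => ¬ p ∣ j), (((a * j) % p ^ (n + 1) : ℕ) : ℤ) ^ k
      = ∑ j ∈ (range (p ^ (n + 1))).filter (fun j => ¬ p ∣ j), (j : ℤ) ^ k := by
  have hpN : p ∣ p ^ (n + 1) := dvd_pow_self p (by omega)
  have hN : 0 < p ^ (n + 1) := pow_pos hp.pos _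
  have hmaps : ∀ j ∈ (range (p ^ (n + 1))).filter (fun j => ¬ p ∣ j),
      (a * j) % p ^ (n + 1) ∈ (range (p ^ (n + 1))).filter (fun j => ¬ p ∣ j) := by
    intro j hj
    simp only [mem_filter, mem_range] at hj ⊢
    exact ⟨Nat.mod_lt _ hN, kc_not_dvd_mod hp hpN ha hj.2⟩
  have hinj : Set.InjOn (fun j => (a * j) % p ^ (n + 1))
      ((range (p ^ (n + 1))).filter (fun j => ¬ p ∣ j) : Finset ℕ) := by
    intro i hi j hj h
    simp only [coe_filter, mem_range, Set.mem_ofPred_eq] at hi hj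
    have hc : Nat.Coprime (p ^ (n + 1)) a :=
      Nat.Coprime.pow_left _ ((Nat.Prime.coprime_iff_not_dvd hp).2 ha)
    have h2 : i ≡ j [MOD p ^ (n + 1)] := Nat.ModEq.cancel_left_of_coprime hc h
    exact Nat.ModEq.eq_of_lt_of_lt h2 hi.1 hj.1
  refine Finset.sum_nbij (fun j => (a * j) % p ^ (n + 1)) hmaps hinj ?_ (fun _ _ => rfl)
  exact Finset.surjOn_of_injOn_of_card_le _ hmaps hinj le_rfl

/-- the Voronoi type sum -/
def kcM (p n a k : ℕ) : ℤ :=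
  ∑ j ∈ (range (p ^ (n + 1))).filter (fun j => ¬ p ∣ j),
    (((a * j) / p ^ (n + 1) : ℕ) : ℤ) * (((a * j) % p ^ (n + 1) : ℕ) : ℤ) ^ (k - 1)

lemma kc_voronoi (p n a k : ℕ) (hp : p.Prime) (ha : ¬ p ∣ a) :
    ((p : ℤ) ^ (n + 1)) ^ 2 ∣
      ((a : ℤ) ^ k - 1) * ∑ j ∈ (range (p ^ (n + 1))).filter (fun j => ¬ p ∣ j), (j : ℤ) ^ k
        - k * (p : ℤ) ^ (n + 1) * kcM p n a k := by
  have h : ((a : ℤ) ^ k - 1) * ∑ j ∈ (range (p ^ (n + 1))).filter (fun j => ¬ p ∣ j), (j : ℤ) ^ k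
        - k * (p : ℤ) ^ (n + 1) * kcM p n a k
      = ∑ j ∈ (range (p ^ (n + 1))).filter (fun j => ¬ p ∣ j),
        (((a : ℤ) * j) ^ k - (((a * j) % p ^ (n + 1) : ℕ) : ℤ) ^ k
          - k * (p : ℤ) ^ (n + 1) * ((((a * j) / p ^ (n + 1) : ℕ) : ℤ) *
            (((a * j) % p ^ (n + 1) : ℕ) : ℤ) ^ (k - 1))) := by
    rw [Finset.sum_sub_distrib, Finset.sum_sub_distrib, kc_perm p n a k hp ha, kcM, ← mul_sum]
    simp_rw [mul_pow]
    rw [← mul_sum]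
    ring
  rw [h]
  apply Finset.dvd_sum
  intro j _
  have e : (a : ℤ) * j = (((a * j) % p ^ (n + 1) : ℕ) : ℤ)
      + (p : ℤ) ^ (n + 1) * (((a * j) / p ^ (n + 1) : ℕ) : ℤ) := by
    exact_mod_cast (Nat.mod_add_div (a * j) (p ^ (n + 1))).symm
  rw [e]
  obtain ⟨c, hc⟩ := Polynomial.powAddExpansion (((a * j) % p ^ (n + 1) : ℕ) : ℤ)
    ((p : ℤ) ^ (n + 1) * (((a * j) / p ^ (n + 1) : ℕ) : ℤ)) k
  rw [hc]
  exact ⟨c * (((a * j) / p ^ (n + 1) : ℕ) : ℤ) ^ 2, by ring⟩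

lemma kc_pow_congr {p d k k' : ℕ} (hp : p.Prime) (hd : 1 ≤ d)
    (hcong : k ≡ k' [MOD (p - 1) * p ^ (d - 1)]) {r : ℕ} (hr : ¬ p ∣ r) :
    r ^ k ≡ r ^ k' [MOD p ^ d] := by
  have hc : Nat.Coprime r (p ^ d) :=
    Nat.Coprime.pow_right _ ((Nat.Prime.coprime_iff_not_dvd hp).2 hr).symm
  have h1 := Nat.ModEq.pow_totient hc
  rw [Nat.totient_prime_pow hp (by omega), mul_comm] at h1
  wlog hle : k ≤ k' generalizing k k'
  · exact (this hcong.symm (by omega)).symm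
  obtain ⟨c, hc⟩ := (Nat.modEq_iff_dvd' hle).1 hcong
  have : k' = k + (p - 1) * p ^ (d - 1) * c := by omega
  rw [this, pow_add, pow_mul]
  have := (h1.pow c).mul_left (r ^ k)
  simpa using this.symm

lemma kc_M_congr {p d k k' : ℕ} (n a : ℕ) (hp : p.Prime) (ha : ¬ p ∣ a) (hd : 1 ≤ d)
    (hk : 0 < k) (hk' : 0 < k')
    (hcong : k ≡ k' [MOD (p - 1) * p ^ (d - 1)]) :
    ((p ^ d : ℕ) : ℤ) ∣ kcM p n a k - kcM p n a k' := by
  have hc : k - 1 ≡ k' - 1 [MOD (p - 1) * p ^ (d - 1)] := by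
    apply Nat.ModEq.add_right_cancel' 1
    rwa [Nat.sub_add_cancel hk, Nat.sub_add_cancel hk']
  rw [kcM, kcM, ← Finset.sum_sub_distrib]
  apply Finset.dvd_sum
  intro j hj
  rw [← mul_sub]
  apply Dvd.dvd.mul_left
  simp only [mem_filter, mem_range] at hj
  have := kc_pow_congr hp hd hc.symm
    (kc_not_dvd_mod hp (dvd_pow_self p (Nat.succ_ne_zero n)) ha hj.2)
  have := (Nat.modEq_iff_dvd).1 this
  exact_mod_cast this

lemma kc_tendsto_S (p : ℕ) [Fact p.Prime] (k : ℕ) :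
    Tendsto (fun n : ℕ => ((∑ j ∈ range (p ^ n), (j : ℤ) ^ k : ℤ) : ℚ_[p]) / (p : ℚ_[p]) ^ n)
      atTop (𝓝 ((bernoulli k : ℚ) : ℚ_[p])) := by
  have hp0 : (p : ℚ_[p]) ≠ 0 := by exact_mod_cast (Fact.out : p.Prime).ne_zero
  have hform : ∀ n : ℕ, ((∑ j ∈ range (p ^ n), (j : ℤ) ^ k : ℤ) : ℚ_[p]) / (p : ℚ_[p]) ^ n
      = ∑ i ∈ range (k + 1), ((bernoulli i * ((k + 1).choose i) / (k + 1) : ℚ) : ℚ_[p])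
          * ((p : ℚ_[p]) ^ n) ^ (k - i) := by
    intro n
    have h := congrArg (fun x : ℚ => (x : ℚ_[p])) (sum_range_pow (p ^ n) k)
    push_cast at h ⊢
    rw [h, Finset.sum_div]
    apply Finset.sum_congr rfl
    intro i hi
    have : k + 1 - i = (k - i) + 1 := by simp only [mem_range] at hi; omega
    rw [this, pow_succ]
    field_simp
  simp_rw [hform]
  have hlim : Tendsto (fun n : ℕ => (p : ℚ_[p]) ^ n) atTop (𝓝 0) :=
    tendsto_pow_atTop_nhds_zero_of_norm_lt_one Padic.norm_p_lt_one
  have hcont : Continuous (fun x : ℚ_[p] =>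
      ∑ i ∈ range (k + 1), ((bernoulli i * ((k + 1).choose i) / (k + 1) : ℚ) : ℚ_[p])
          * x ^ (k - i)) := by fun_prop
  have := (hcont.tendsto 0).comp hlim
  refine Eq.subst (motive := fun y => Tendsto _ atTop (𝓝 y)) ?_ this
  rw [Finset.sum_range_succ, Finset.sum_eq_zero]
  · have : (k + 1 : ℚ) ≠ 0 := by positivity
    simp [Nat.choose_succ_self_right]
    have : (k + 1 : ℚ_[p]) ≠ 0 := by exact_mod_cast Nat.succ_ne_zero k
    field_simp
  · intro i hi
    have : k - i ≠ 0 := by simp only [mem_range] at hi; omega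
    simp [this]

lemma kc_tendsto_M (p : ℕ) [hpf : Fact p.Prime] (a k : ℕ) (hk : 0 < k) (ha : ¬ p ∣ a) :
    Tendsto (fun n : ℕ => ((kcM p n a k : ℤ) : ℚ_[p])) atTop
      (𝓝 (((a : ℚ_[p]) ^ k - 1) * ((1 - (p : ℚ_[p]) ^ (k - 1)) * ((bernoulli k : ℚ) : ℚ_[p]) / k))) := by
  have hp0 : (p : ℚ_[p]) ≠ 0 := by exact_mod_cast hpf.out.ne_zero
  have hk0 : (k : ℚ_[p]) ≠ 0 := by exact_mod_cast hk.ne'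
  have hS := kc_tendsto_S p k
  have hS1 := (tendsto_add_atTop_iff_nat 1).2 hS
  have hT := hS1.sub (hS.const_mul ((p : ℚ_[p]) ^ (k - 1)))
  choose c hc using fun n => kc_voronoi p n a k hpf.out ha
  have hM : ∀ n, ((kcM p n a k : ℤ) : ℚ_[p]) = ((a : ℚ_[p]) ^ k - 1) *
      (((∑ j ∈ range (p ^ (n + 1)), (j : ℤ) ^ k : ℤ) : ℚ_[p]) / (p : ℚ_[p]) ^ (n + 1)
        - (p : ℚ_[p]) ^ (k - 1) *
          (((∑ j ∈ range (p ^ n), (j : ℤ) ^ k : ℤ) : ℚ_[p]) / (p : ℚ_[p]) ^ n)) / k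
      - (p : ℚ_[p]) ^ (n + 1) * (c n : ℚ_[p]) / k := by
    intro n
    have h := hc n
    have hs := kc_split p (p ^ n) k hpf.out.pos
    rw [← pow_succ'] at hs
    rw [hs] at h
    generalize (∑ j ∈ range (p ^ (n + 1)), (j : ℤ) ^ k) = A at h ⊢
    generalize (∑ j ∈ range (p ^ n), (j : ℤ) ^ k) = B at h ⊢
    have h' := congrArg (fun x : ℤ => (x : ℚ_[p])) h
    push_cast at h'
    obtain ⟨l, rfl⟩ : ∃ l, k = l + 1 := ⟨k - 1, by omega⟩
    simp only [Nat.add_sub_cancel] at *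
    field_simp
    push_cast at h' ⊢
    linear_combination -(p : ℚ_[p]) ^ n * h'
  have herr : Tendsto (fun n : ℕ => (p : ℚ_[p]) ^ (n + 1) * (c n : ℚ_[p]) / k) atTop (𝓝 0) := by
    have hlim : Tendsto (fun n : ℕ => (p : ℚ_[p]) ^ (n + 1)) atTop (𝓝 0) :=
      (tendsto_add_atTop_iff_nat 1).2
        (tendsto_pow_atTop_nhds_zero_of_norm_lt_one Padic.norm_p_lt_one)
    have h0 : Tendsto (fun n : ℕ => (p : ℚ_[p]) ^ (n + 1) * (c n : ℚ_[p])) atTop (𝓝 0) := by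
      apply squeeze_zero_norm (a := fun n : ℕ => ‖(p : ℚ_[p]) ^ (n + 1)‖)
      · intro n
        rw [norm_mul]
        exact mul_le_of_le_one_right (norm_nonneg _) (Padic.norm_int_le_one _)
      · simpa using hlim.norm
    simpa using h0.div_const (k : ℚ_[p])
  simp_rw [hM]
  have := ((hT.const_mul ((a : ℚ_[p]) ^ k - 1)).div_const (k : ℚ_[p])).sub herr
  convert this using 2
  ring

lemma kc_exists_a (p : ℕ) [hpf : Fact p.Prime] : ∃ a : ℕ, ¬ p ∣ a ∧
    ∀ k : ℕ, ¬ (p - 1) ∣ k → ‖((a : ℚ_[p]) ^ k - 1)‖ = 1 := by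
  obtain ⟨g, hg⟩ := IsCyclic.exists_generator (α := (ZMod p)ˣ)
  have hord : orderOf g = p - 1 := by
    rw [orderOf_eq_card_of_forall_mem_zpowers hg, Nat.card_eq_fintype_card, ZMod.card_units]
  have hcast : (((g : ZMod p).val : ℕ) : ZMod p) = g := ZMod.natCast_zmod_val _
  refine ⟨(g : ZMod p).val, ?_, ?_⟩
  · rw [← ZMod.natCast_eq_zero_iff, hcast]
    exact g.ne_zero
  · intro k hk
    have h1 : ((((g : ZMod p).val : ℤ) ^ k - 1 : ℤ) : ℚ_[p])
        = (((g : ZMod p).val : ℕ) : ℚ_[p]) ^ k - 1 := by push_cast; rfl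
    rw [← h1]
    refine le_antisymm (Padic.norm_int_le_one _) (not_lt.1 ?_)
    rw [Padic.norm_intCast_lt_one_iff, ← ZMod.intCast_zmod_eq_zero_iff_dvd]
    intro h
    push_cast at h
    rw [hcast, sub_eq_zero] at h
    apply hk
    rw [← hord]
    apply orderOf_dvd_of_pow_eq_one
    ext
    simpa using h

/-- **Kummer's congruences.** For an odd prime `p`, positive even integers `k, k'`
not divisible by `p - 1` with `k ≡ k' (mod (p-1)·p^(d-1))`, the modified zeta values
`(1 - p^(k-1))·ζ(1-k) = (1 - p^(k-1))·(-B_k/k)` and `(1 - p^(k'-1))·(-B_{k'}/k')`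
are congruent modulo `p^d`. -/
theorem kummer_congruences (p : ℕ) (hp : p.Prime) (hodd : Odd p)
    (k k' : ℕ) (hk : 0 < k) (hk' : 0 < k') (hke : Even k) (hk'e : Even k')
    (hknd : ¬ (p - 1) ∣ k) (hk'nd : ¬ (p - 1) ∣ k')
    (d : ℕ) (hd : 1 ≤ d) (hcong : k ≡ k' [MOD (p - 1) * p ^ (d - 1)]) :
    (1 - (p : ℚ) ^ (k - 1)) * (-(bernoulli k) / k)
        - (1 - (p : ℚ) ^ (k' - 1)) * (-(bernoulli k') / k') = 0 ∨
      (d : ℤ) ≤ padicValRat p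
        ((1 - (p : ℚ) ^ (k - 1)) * (-(bernoulli k) / k)
          - (1 - (p : ℚ) ^ (k' - 1)) * (-(bernoulli k') / k')) := by
  have : Fact p.Prime := ⟨hp⟩
  obtain ⟨a, ha, hunit⟩ := kc_exists_a p
  have hY := kc_tendsto_M p a k hk ha
  have hY' := kc_tendsto_M p a k' hk' ha
  set X : ℚ_[p] := (1 - (p : ℚ_[p]) ^ (k - 1)) * ((bernoulli k : ℚ) : ℚ_[p]) / k with hX
  set X' : ℚ_[p] := (1 - (p : ℚ_[p]) ^ (k' - 1)) * ((bernoulli k' : ℚ) : ℚ_[p]) / k' with hX'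
  have hdiff : ‖((a : ℚ_[p]) ^ k - 1) * X - ((a : ℚ_[p]) ^ k' - 1) * X'‖ ≤ (p : ℝ) ^ (-d : ℤ) := by
    refine le_of_tendsto (hY.sub hY').norm (Eventually.of_forall fun n => ?_)
    have := (Padic.norm_int_le_pow_iff_dvd (p := p) _ d).2 (by
      exact_mod_cast kc_M_congr n a hp ha hd hk hk' hcong)
    simpa using this
  have hint : ‖((a : ℚ_[p]) ^ k' - 1) * X'‖ ≤ 1 :=
    le_of_tendsto hY'.norm (Eventually.of_forall fun n => Padic.norm_int_le_one _)
  have hX'1 : ‖X'‖ ≤ 1 := by rwa [norm_mul, hunit k' hk'nd, one_mul] at hint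
  have hpa : ‖(a : ℚ_[p]) ^ k' - (a : ℚ_[p]) ^ k‖ ≤ (p : ℝ) ^ (-d : ℤ) := by
    have h := (Nat.modEq_iff_dvd).1 (kc_pow_congr hp hd hcong ha)
    have := (Padic.norm_int_le_pow_iff_dvd (p := p) _ d).2 (by exact_mod_cast h)
    simpa using this
  have hXX : ‖X - X'‖ ≤ (p : ℝ) ^ (-d : ℤ) := by
    have e : ((a : ℚ_[p]) ^ k - 1) * (X - X')
        = (((a : ℚ_[p]) ^ k - 1) * X - ((a : ℚ_[p]) ^ k' - 1) * X')
          + ((a : ℚ_[p]) ^ k' - (a : ℚ_[p]) ^ k) * X' := by ring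
    have h1 : ‖((a : ℚ_[p]) ^ k - 1) * (X - X')‖ = ‖X - X'‖ := by
      rw [norm_mul, hunit k hknd, one_mul]
    rw [← h1, e]
    refine (Padic.nonarchimedean _ _).trans (max_le hdiff ?_)
    rw [norm_mul]
    exact (mul_le_of_le_one_right (norm_nonneg _) hX'1).trans hpa
  by_cases hz : (1 - (p : ℚ) ^ (k - 1)) * (-(bernoulli k) / k)
        - (1 - (p : ℚ) ^ (k' - 1)) * (-(bernoulli k') / k') = 0
  · exact Or.inl hz
  right
  have hcast : (((1 - (p : ℚ) ^ (k - 1)) * (-(bernoulli k) / k)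
        - (1 - (p : ℚ) ^ (k' - 1)) * (-(bernoulli k') / k') : ℚ) : ℚ_[p]) = -(X - X') := by
    push_cast
    rw [hX, hX']
    ring
  rw [← norm_neg, ← hcast, Padic.eq_padicNorm, padicNorm.eq_zpow_of_nonzero hz] at hXX
  push_cast at hXX
  have hp1 : (1 : ℝ) < p := by exact_mod_cast hp.one_lt
  have := (zpow_le_zpow_iff_right₀ hp1).1 hXX
  omega
end

section
/- Let p be an odd prime. Then p does not divide the class number of the p-th cyclotomic field ℚ(ζ_p) if and only if p does not divide the numerator of the Bernoulli number B_k for every even integer k with 2 ≤ k ≤ p−3 (Kummer's criterion for regularity). -/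
instance (n : ℕ+) : NumberField (CyclotomicField n ℚ) :=
  inferInstance

namespace Kummer
open Finset

/-- p-integral rationals -/
def pInt (p : ℕ) [hp : Fact p.Prime] : Subring ℚ where
  carrier := {x | ¬ p ∣ x.den}
  mul_mem' {a b} ha hb h := by
    have := h.trans (Rat.mul_den_dvd a b)
    rcases (hp.out.dvd_mul).1 this with h | h
    · exact ha h
    · exact hb h
  one_mem' := by simpa using hp.out.one_lt.ne'
  add_mem' {a b} ha hb h := by
    have := h.trans (Rat.add_den_dvd a b)
    rcases (hp.out.dvd_mul).1 this with h | h
    · exact ha h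
    · exact hb h
  zero_mem' := by simpa using hp.out.one_lt.ne'
  neg_mem' {a} ha := by simpa using ha

lemma mem_pInt {p : ℕ} [hp : Fact p.Prime] {x : ℚ} : x ∈ pInt p ↔ ¬ p ∣ x.den := Iff.rfl

lemma inv_mem_pInt {p : ℕ} [hp : Fact p.Prime] {n : ℕ} (h : ¬ p ∣ n) : (n : ℚ)⁻¹ ∈ pInt p := by
  have hn : n ≠ 0 := by rintro rfl; simp at h
  rw [mem_pInt, Rat.inv_natCast_den_of_pos (Nat.pos_of_ne_zero hn)]
  exact h

lemma natCast_mem_pInt {p : ℕ} [hp : Fact p.Prime] (n : ℕ) : (n : ℚ) ∈ pInt p := natCast_mem _ n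

lemma int_of_pInt {p : ℕ} [hp : Fact p.Prime] {z : ℤ} {s : ℚ} (hs : s ∈ pInt p) {k : ℕ}
    (h : (z : ℚ) = p ^ k * s) : (p : ℤ) ^ k ∣ z := by
  have h1 : (z * s.den : ℤ) = (p : ℤ) ^ k * s.num := by
    have := s.num_div_den
    have hd : (s.den : ℚ) ≠ 0 := by exact_mod_cast s.den_ne_zero
    have : (z * s.den : ℚ) = (p : ℚ) ^ k * s.num := by
      rw [h]
      nth_rewrite 1 [← this]
      field_simp
    exact_mod_cast this
  have h2 : IsCoprime ((p : ℤ) ^ k) (s.den : ℤ) := by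
    apply IsCoprime.pow_left
    rw [Nat.isCoprime_iff_coprime]
    exact (Nat.Prime.coprime_iff_not_dvd hp.out).2 hs
  exact h2.dvd_of_dvd_mul_right ⟨_, h1⟩

lemma bernoulli'_mem {p : ℕ} [hp : Fact p.Prime] (n : ℕ) (hn : n + 1 < p) :
    bernoulli' n ∈ pInt p := by
  induction n using Nat.strong_induction_on with
  | _ n ih =>
    rw [bernoulli'_def]
    refine sub_mem (one_mem _) (sum_mem fun k hk => ?_)
    have hk := mem_range.1 hk
    refine mul_mem ?_ (ih k hk (by omega))
    have : (n : ℚ) - k + 1 = ((n - k + 1 : ℕ) : ℚ) := by push_cast [hk.le]; ring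
    rw [this, div_eq_mul_inv]
    refine mul_mem (natCast_mem _ _) (inv_mem_pInt ?_)
    intro h
    have := Nat.le_of_dvd (by omega) h
    omega

lemma bernoulli_mem {p : ℕ} [hp : Fact p.Prime] (n : ℕ) (hn : n + 1 < p) :
    bernoulli n ∈ pInt p := by
  rw [bernoulli]
  exact mul_mem (pow_mem (neg_mem (one_mem _)) _) (bernoulli'_mem n hn)

lemma sum_pow_congr {p : ℕ} [hp : Fact p.Prime] (n : ℕ) (h1 : 1 ≤ n) (hn : n + 1 < p) :
    (p : ℤ) ^ 2 ∣ (bernoulli n).den * (∑ c ∈ range p, (c : ℤ) ^ n) - p * (bernoulli n).num := by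
  have key : ∃ s ∈ pInt p, (∑ c ∈ range p, (c : ℚ) ^ n) = p * bernoulli n + p ^ 2 * s := by
    rw [sum_range_pow, sum_range_succ]
    refine ⟨∑ i ∈ range n, bernoulli i * ((n+1).choose i) * (p:ℚ) ^ (n - 1 - i) * ((n + 1 : ℕ):ℚ)⁻¹,
      sum_mem fun i hi => ?_, ?_⟩
    · have hi := mem_range.1 hi
      refine mul_mem (mul_mem (mul_mem (bernoulli_mem i (by omega)) (natCast_mem _ _))
        (pow_mem (natCast_mem _ _) _)) (inv_mem_pInt ?_)
      intro h
      have := Nat.le_of_dvd (by omega) h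
      omega
    · rw [add_comm, mul_sum]
      congr 1
      · have : (n : ℚ) + 1 ≠ 0 := by positivity
        simp [Nat.choose_succ_self_right]
        field_simp
      · refine sum_congr rfl fun i hi => ?_
        have hi := mem_range.1 hi
        have : n + 1 - i = 2 + (n - 1 - i) := by omega
        rw [this, pow_add]
        push_cast
        ring
  obtain ⟨s, hs, h⟩ := key
  refine int_of_pInt (s := (bernoulli n).den * s) (mul_mem (natCast_mem _ _) hs) ?_
  push_cast
  rw [h]
  have := (bernoulli n).num_div_den
  have hd : ((bernoulli n).den : ℚ) ≠ 0 := by exact_mod_cast (bernoulli n).den_ne_zero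
  rw [div_eq_iff hd] at this
  rw [this]; ring

lemma sum_mod_perm {p : ℕ} [hp : Fact p.Prime] {M : Type*} [AddCommMonoid M] (f : ℕ → M) (a : ℕ)
    (ha : ¬ p ∣ a) : ∑ c ∈ range p, f (a * c % p) = ∑ c ∈ range p, f c := by
  have hinj : Set.InjOn (fun c => a * c % p) (range p : Finset ℕ) := by
    intro x hx y hy h
    simp at hx hy
    have h : a * x ≡ a * y [MOD p] := h
    have := Nat.ModEq.cancel_left_of_coprime ((Nat.Prime.coprime_iff_not_dvd hp.out).2 ha) h
    exact Nat.ModEq.eq_of_lt_of_lt this hx hy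
  have himg : (range p).image (fun c => a * c % p) = range p := by
    apply eq_of_subset_of_card_le
    · intro x hx
      obtain ⟨c, -, rfl⟩ := mem_image.1 hx
      exact mem_range.2 (Nat.mod_lt _ hp.out.pos)
    · rw [card_image_of_injOn hinj]
  conv_rhs => rw [← himg, sum_image hinj]

lemma pow_congr_sq (p r b : ℤ) (n : ℕ) :
    p ^ 2 ∣ (r + p * b) ^ n - n * p * b * (r + p * b) ^ (n - 1) - r ^ n := by
  have h := Polynomial.binomExpansion (Polynomial.X ^ n : Polynomial ℤ) (r + p * b) (-(p * b))
  obtain ⟨k, hk⟩ := h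
  rw [Polynomial.derivative_X_pow] at hk
  simp at hk
  rw [hk]
  refine ⟨-k * b ^ 2, ?_⟩
  ring

theorem voronoi {p : ℕ} [hp : Fact p.Prime] (n : ℕ) (h1 : 1 ≤ n) (hn : n + 1 < p) (a : ℕ)
    (ha : ¬ p ∣ a) :
    ((a : ZMod p) ^ n - 1) * ((bernoulli n).num : ZMod p) = (bernoulli n).den * n *
      ∑ c ∈ range p, ((a * c / p : ℕ) : ZMod p) * ((a * c : ℕ) : ZMod p) ^ (n - 1) := by
  have e1 := sum_pow_congr n h1 hn
  set D : ℤ := ((bernoulli n).den : ℤ)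
  set N : ℤ := (bernoulli n).num with hN
  set S : ℤ := ∑ c ∈ range p, (c : ℤ) ^ n with hS
  set T : ℤ := ∑ c ∈ range p, ((a * c / p : ℕ) : ℤ) * ((a * c : ℕ) : ℤ) ^ (n - 1) with hT
  have e2 : (p : ℤ) ^ 2 ∣ (a : ℤ) ^ n * S - n * p * T - S := by
    have : (a : ℤ) ^ n * S - n * p * T - S = ∑ c ∈ range p,
        (((a * c % p : ℕ) + p * (a * c / p : ℕ) : ℤ) ^ n - n * p * (a * c / p : ℕ) *
          ((a * c % p : ℕ) + p * (a * c / p : ℕ) : ℤ) ^ (n - 1) - ((a * c % p : ℕ) : ℤ) ^ n) := by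
      rw [sum_sub_distrib, sum_sub_distrib, sum_mod_perm (fun c => (c : ℤ) ^ n) a ha, hS, hT, mul_sum,
        mul_sum]
      congr 2
      · refine sum_congr rfl fun c _ => ?_
        rw [← mul_pow]; congr 1
        exact_mod_cast (Nat.mod_add_div (a * c) p).symm
      · refine sum_congr rfl fun c _ => ?_
        have : ((a * c % p : ℕ) + p * (a * c / p : ℕ) : ℤ) = (a * c : ℕ) := by
          exact_mod_cast (Nat.mod_add_div (a * c) p)
        rw [this]; ring
    rw [this]
    exact dvd_sum fun c _ => pow_congr_sq _ _ _ _
  have e3 : (p : ℤ) ^ 2 ∣ p * (((a : ℤ) ^ n - 1) * N - D * n * T) := by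
    have := dvd_sub (e2.mul_left D) (e1.mul_left ((a : ℤ) ^ n - 1))
    rwa [show D * ((a : ℤ) ^ n * S - n * p * T - S) - ((a : ℤ) ^ n - 1) * (D * S - p * N)
      = p * (((a : ℤ) ^ n - 1) * N - D * n * T) by ring] at this
  have hp0 : (p : ℤ) ≠ 0 := by exact_mod_cast hp.out.ne_zero
  rw [pow_two, mul_dvd_mul_iff_left hp0, ← ZMod.intCast_zmod_eq_zero_iff_dvd] at e3
  rw [← sub_eq_zero]
  have hT' : (T : ZMod p) =
      ∑ c ∈ range p, ((a * c / p : ℕ) : ZMod p) * ((a * c : ℕ) : ZMod p) ^ (n - 1) := by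
    rw [hT, Int.cast_sum]
    exact sum_congr rfl fun c _ => by
      rw [Int.cast_mul, Int.cast_pow, Int.cast_natCast, Int.cast_natCast]
  rw [← hT', ← e3]
  push_cast [D]
  simp

lemma fermat_quot_aux {p : ℕ} [hp : Fact p.Prime] (h2 : 2 < p) (g : ℕ) (hg : ¬ p ∣ g)
    (hq : ¬ (p : ℤ) ^ 2 ∣ (g : ℤ) ^ (p - 1) - 1) :
    ∑ c ∈ range p, ((g * c / p : ℕ) : ZMod p) * ((g * c : ℕ) : ZMod p) ^ (p - 2) ≠ 0 := by
  intro h0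
  apply hq
  set S : ℤ := ∑ c ∈ range p, (c : ℤ) ^ (p - 1) with hS
  set T : ℤ := ∑ c ∈ range p, ((g * c / p : ℕ) : ℤ) * ((g * c : ℕ) : ℤ) ^ (p - 2) with hT
  have e2 : (p : ℤ) ^ 2 ∣ (g : ℤ) ^ (p - 1) * S - (p - 1 : ℕ) * p * T - S := by
    have : (g : ℤ) ^ (p - 1) * S - (p - 1 : ℕ) * p * T - S = ∑ c ∈ range p,
        (((g * c % p : ℕ) + p * (g * c / p : ℕ) : ℤ) ^ (p - 1) - (p - 1 : ℕ) * p * (g * c / p : ℕ) *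
          ((g * c % p : ℕ) + p * (g * c / p : ℕ) : ℤ) ^ (p - 1 - 1)
            - ((g * c % p : ℕ) : ℤ) ^ (p - 1)) := by
      rw [sum_sub_distrib, sum_sub_distrib, sum_mod_perm (fun c => (c : ℤ) ^ (p - 1)) g hg, hS, hT,
        mul_sum, mul_sum]
      congr 2
      · refine sum_congr rfl fun c _ => ?_
        rw [← mul_pow]; congr 1
        exact_mod_cast (Nat.mod_add_div (g * c) p).symm
      · refine sum_congr rfl fun c _ => ?_
        have : ((g * c % p : ℕ) + p * (g * c / p : ℕ) : ℤ) = (g * c : ℕ) := by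
          exact_mod_cast (Nat.mod_add_div (g * c) p)
        rw [this, show p - 1 - 1 = p - 2 by omega]; ring
    rw [this]
    exact dvd_sum fun c _ => pow_congr_sq _ _ _ _
  have hTp : (p : ℤ) ∣ T := by
    rw [← ZMod.intCast_zmod_eq_zero_iff_dvd]
    rw [← h0, hT, Int.cast_sum]
    exact sum_congr rfl fun c _ => by
      rw [Int.cast_mul, Int.cast_pow, Int.cast_natCast, Int.cast_natCast]
  have e3 : (p : ℤ) ^ 2 ∣ ((g : ℤ) ^ (p - 1) - 1) * S := by
    have h3 : (p : ℤ) ^ 2 ∣ (p - 1 : ℕ) * p * T := by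
      obtain ⟨k, hk⟩ := hTp
      exact ⟨(p - 1 : ℕ) * k, by rw [hk]; ring⟩
    have := dvd_add e2 h3
    rwa [show (g : ℤ) ^ (p - 1) * S - (p - 1 : ℕ) * p * T - S + (p - 1 : ℕ) * p * T
      = ((g : ℤ) ^ (p - 1) - 1) * S by ring] at this
  have hSp : ¬ (p : ℤ) ∣ S := by
    rw [← ZMod.intCast_zmod_eq_zero_iff_dvd, hS]
    push_cast
    have : ∀ c ∈ range p, ((c : ZMod p)) ^ (p - 1) = if c = 0 then 0 else 1 := by
      intro c hc
      have hc := mem_range.1 hc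
      split_ifs with h
      · subst h; simp; omega
      · apply ZMod.pow_card_sub_one_eq_one
        rw [Ne, ZMod.natCast_eq_zero_iff]
        intro hd
        have := Nat.le_of_dvd (Nat.pos_of_ne_zero h) hd
        omega
    rw [sum_congr rfl this]
    have h3 : ∑ c ∈ range p, (if c = 0 then (0 : ZMod p) else 1) = -1 := by
      have : ∑ c ∈ range p, (if c = 0 then (0 : ZMod p) else 1)
        = ∑ c ∈ range p, ((1 : ZMod p) - if c = 0 then 1 else 0) :=
        sum_congr rfl fun c _ => by split_ifs <;> simp
      rw [this, sum_sub_distrib]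
      simp [hp.out.pos]
    rw [h3]; simp
  have hcop : IsCoprime ((p : ℤ) ^ 2) S := by
    apply IsCoprime.pow_left
    exact (Prime.coprime_iff_not_dvd (Nat.prime_iff_prime_int.1 hp.out)).2 hSp
  exact hcop.dvd_of_dvd_mul_right e3

end Kummer

namespace Kummer
open Finset Polynomial

/-- residues of powers of g -/
def rr (p g i : ℕ) : ℕ := g ^ i % p

lemma rr_cast {p : ℕ} (g i : ℕ) : ((rr p g i : ℕ) : ZMod p) = (g : ZMod p) ^ i := by
  simp [rr]

lemma rr_succ {p : ℕ} (g i : ℕ) : g * rr p g i = rr p g (i + 1) + p * (g * rr p g i / p) := by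
  have : rr p g (i + 1) = g * rr p g i % p := by
    simp [rr, pow_succ, Nat.mul_mod, mul_comm]
  rw [this]; exact (Nat.mod_add_div _ _).symm

lemma ne_zero_of_order {p : ℕ} [hp : Fact p.Prime] {g : ZMod p} (hg : orderOf g = p - 1)
    (h2 : 2 < p) : g ≠ 0 := by
  rintro rfl
  have := pow_orderOf_eq_one (0 : ZMod p)
  rw [hg, zero_pow (by omega)] at this
  exact zero_ne_one this

lemma sum_rr {p : ℕ} [hp : Fact p.Prime] {M : Type*} [AddCommMonoid M] (F : ℕ → M) (h0 : F 0 = 0)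
    (g : ℕ) (hg : orderOf (g : ZMod p) = p - 1) (h2 : 2 < p) :
    ∑ c ∈ range p, F c = ∑ i ∈ range (p - 1), F (rr p g i) := by
  have hg0 : (g : ZMod p) ≠ 0 := by
    exact ne_zero_of_order hg (by omega)
  have hinj : Set.InjOn (fun i => rr p g i) (range (p - 1) : Finset ℕ) := by
    intro x hx y hy h
    have h' : (g : ZMod p) ^ x = (g : ZMod p) ^ y := by
      rw [← rr_cast, ← rr_cast]; exact congrArg _ h
    have := pow_injOn_Iio_orderOf (x := (g : ZMod p))
    rw [hg] at this
    exact this (by simpa using hx) (by simpa using hy) h'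
  have himg : (range (p - 1)).image (fun i => rr p g i) = (range p).erase 0 := by
    apply eq_of_subset_of_card_le
    · intro x hx
      obtain ⟨c, -, rfl⟩ := mem_image.1 hx
      refine mem_erase.2 ⟨?_, mem_range.2 (Nat.mod_lt _ hp.out.pos)⟩
      intro h
      have := rr_cast (p := p) g c
      rw [h] at this
      simp only [Nat.cast_zero] at this
      exact pow_ne_zero c hg0 this.symm
    · rw [card_image_of_injOn hinj, card_erase_of_mem (by simp [hp.out.pos])]; simp
  rw [← add_sum_erase _ _ (mem_range.2 hp.out.pos), h0, zero_add, ← himg, sum_image hinj]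

/-- Kummer's polynomial evaluated -/
noncomputable def GG (p g : ℕ) (θ : ℂ) : ℂ := ∑ i ∈ range (p - 1), (rr p g i : ℂ) * θ ^ i

/-- The auxiliary polynomial -/
noncomputable def BB (p g : ℕ) : ℤ[X] :=
  ∑ i ∈ range (p - 1), C ((g * rr p g i / p : ℕ) : ℤ) * X ^ (i + 1)

lemma GG_mul {p : ℕ} (h1 : 1 < p) (g : ℕ) (θ : ℂ) (hθ : θ ^ (p - 1) = 1)
    (hg : rr p g (p - 1) = 1) :
    (g * θ - 1) * GG p g θ = p * ((BB p g).map (Int.castRingHom ℂ)).eval θ := by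
  have e1 : GG p g θ = ∑ i ∈ range (p - 1), (rr p g (i + 1) : ℂ) * θ ^ (i + 1) := by
    have h := sum_range_succ (fun i => (rr p g i : ℂ) * θ ^ i) (p - 1)
    have h' := sum_range_succ' (fun i => (rr p g i : ℂ) * θ ^ i) (p - 1)
    rw [h] at h'
    have h0 : rr p g 0 = 1 := by simp [rr, Nat.mod_eq_of_lt h1]
    rw [hθ, hg, h0] at h'
    simpa [GG] using h'
  have e2 : (g * θ) * GG p g θ = ∑ i ∈ range (p - 1), (g * rr p g i : ℕ) * θ ^ (i + 1) := by
    rw [GG, mul_sum]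
    refine sum_congr rfl fun i _ => ?_
    push_cast; ring
  rw [sub_mul, one_mul, e2]
  conv_lhs => rw [e1]
  rw [BB, ← sum_sub_distrib, Polynomial.map_sum, eval_finsetSum, mul_sum]
  refine sum_congr rfl fun i _ => ?_
  have := congrArg (Nat.cast (R := ℂ)) (rr_succ (p := p) g i)
  rw [this]
  rw [Polynomial.map_mul, map_C, Polynomial.map_pow, map_X, eval_mul, eval_C, eval_pow, eval_X]
  simp only [Nat.cast_add, Nat.cast_mul, eq_intCast, Int.cast_natCast]
  ring

lemma prod_roots_lin {m : ℕ} (hm : 0 < m) (g : ℕ) (hg : g ≠ 0) :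
    (((X ^ m + 1 : ℂ[X]).roots.map (fun θ => (g : ℂ) * θ - 1)).prod) = (-1) ^ m * (g ^ m + 1) := by
  have hmon : (X ^ m + 1 : ℂ[X]).Monic := by
    simpa using monic_X_pow_add_C (1 : ℂ) hm.ne'
  have hs : (X ^ m + 1 : ℂ[X]).Splits := IsAlgClosed.splits _
  have hcard : Multiset.card (X ^ m + 1 : ℂ[X]).roots = m := by
    rw [← hs.natDegree_eq_card_roots]
    simpa using natDegree_X_pow_add_C (n := m) (r := (1 : ℂ))
  have h := hs.eq_prod_roots_of_monic hmon
  have h' := congrArg (eval ((g : ℂ)⁻¹)) h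
  rw [eval_multiset_prod, Multiset.map_map] at h'
  simp at h'
  have hg' : (g : ℂ) ≠ 0 := by exact_mod_cast hg
  have e : (fun θ : ℂ => (g : ℂ) * θ - 1) = fun θ => (-(g : ℂ)) * ((g : ℂ)⁻¹ - θ) := by
    funext θ; field_simp; ring
  rw [e, Multiset.prod_map_mul]
  simp only [Multiset.map_const', Multiset.prod_replicate, hcard]
  have h'' : (Multiset.map (fun θ : ℂ => (g : ℂ)⁻¹ - θ) (X ^ m + 1 : ℂ[X]).roots).prod
     = ((g : ℂ) ^ m)⁻¹ + 1 := by rw [h']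
  rw [h'', neg_pow]
  have : (g : ℂ) ^ m ≠ 0 := pow_ne_zero _ hg'
  field_simp
  ring

lemma splits_zmod {p m : ℕ} [hp : Fact p.Prime] (hm : p = 2 * m + 1) :
    (X ^ m + 1 : (ZMod p)[X]).Splits := by
  have h := GaloisField.splits_zmod_X_pow_sub_X p
  have h2 := hp.out.two_le
  refine Splits.of_dvd h (FiniteField.X_pow_card_sub_X_ne_zero _ hp.out.one_lt)
    ⟨(X ^ m - 1) * X, ?_⟩
  have : (X : (ZMod p)[X]) ^ p = X ^ m * X ^ m * X := by
    rw [← pow_add, ← pow_succ]; congr 1; omega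
  rw [this]; ring

theorem P2_main {p m g : ℕ} [hp : Fact p.Prime] (hm : p = 2 * m + 1) (hm0 : 0 < m)
    (hg : orderOf (g : ZMod p) = p - 1) (hq : ¬ p ^ 2 ∣ g ^ m + 1) :
    ∃ N t : ℤ, ¬ (p : ℤ) ∣ t ∧
      ((X ^ m + 1 : ℂ[X]).roots.map (GG p g)).prod * t = (p : ℂ) ^ (m - 1) * N ∧
      ((p : ℤ) ∣ N ↔ ∃ k : ℕ, 2 ≤ k ∧ k ≤ p - 3 ∧ Even k ∧ (p : ℤ) ∣ (_root_.bernoulli k).num) := by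
  have h2 : 2 < p := by omega
  have hg0 : (g : ZMod p) ≠ 0 := by
    exact ne_zero_of_order hg (by omega)
  have hgn : g ≠ 0 := by rintro rfl; simp at hg0
  have hpg : ¬ p ∣ g := by rwa [Ne, ZMod.natCast_eq_zero_iff] at hg0
  have hgm : (g : ZMod p) ^ m = -1 := by
    have h1 : ((g : ZMod p) ^ m) ^ 2 = 1 := by
      rw [← pow_mul, mul_comm, show 2 * m = p - 1 by omega, ← hg, pow_orderOf_eq_one]
    rcases mul_self_eq_one_iff.1 ((pow_two _).symm.trans h1) with h | h
    · have := orderOf_dvd_of_pow_eq_one h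
      rw [hg] at this
      have := Nat.le_of_dvd hm0 this
      omega
    · exact h
  obtain ⟨t, ht⟩ : p ∣ g ^ m + 1 := by
    rw [← ZMod.natCast_eq_zero_iff]; push_cast; rw [hgm]; ring
  have htp : ¬ p ∣ t := by
    rintro ⟨k, rfl⟩
    exact hq ⟨k, by rw [ht]; ring⟩
  set f : ℤ[X] := X ^ m + 1 with hf
  set n := (BB p g).natDegree
  have hfd : ∀ (R : Type) [CommRing R] [Nontrivial R], (X ^ m + 1 : R[X]).natDegree = m := by
    intro R _ _; simpa using natDegree_X_pow_add_C (n := m) (r := (1 : R))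
  have hfl : ∀ (R : Type) [CommRing R] [Nontrivial R], (X ^ m + 1 : R[X]).leadingCoeff = 1 := by
    intro R _ _
    have : (X ^ m + 1 : R[X]).Monic := by simpa using monic_X_pow_add_C (1 : R) hm0.ne'
    exact this
  have hres : ∀ (R : Type) [CommRing R] [IsDomain R], (X ^ m + 1 : R[X]).Splits →
      ((f.resultant (BB p g) m n : ℤ) : R) =
      ((X ^ m + 1 : R[X]).roots.map (fun x => ((BB p g).map (Int.castRingHom R)).eval x)).prod := by
    intro R _ _ hs
    have h1 := resultant_map_map f (BB p g) m n (Int.castRingHom R)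
    have h2 := resultant_eq_prod_eval (X ^ m + 1 : R[X]) ((BB p g).map (Int.castRingHom R)) n
      natDegree_map_le hs
    rw [hfd R, hfl R, one_pow, one_mul] at h2
    rw [← h2]
    have : f.map (Int.castRingHom R) = X ^ m + 1 := by simp [f]
    rw [this] at h1
    rw [h1]; simp
  refine ⟨(-1) ^ m * f.resultant (BB p g) m n, t, ?_, ?_, ?_⟩
  · exact_mod_cast htp
  · have hmul : ((X ^ m + 1 : ℂ[X]).roots.map (fun θ => ((g : ℂ) * θ - 1) * GG p g θ)).prod =
        ((X ^ m + 1 : ℂ[X]).roots.map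
          (fun θ => (p : ℂ) * ((BB p g).map (Int.castRingHom ℂ)).eval θ)).prod := by
      congr 1
      apply Multiset.map_congr rfl
      intro θ hθ
      have hθ' : θ ^ m = -1 := by
        have := (mem_roots'.1 hθ).2
        simp [IsRoot] at this
        exact eq_neg_of_add_eq_zero_left this
      refine GG_mul (by omega) g θ ?_ ?_
      · rw [show p - 1 = m * 2 by omega, pow_mul, hθ']; norm_num
      · have h1 : (g : ZMod p) ^ (p - 1) = 1 := by rw [← hg, pow_orderOf_eq_one]
        have h1 : ((rr p g (p - 1) : ℕ) : ZMod p) = ((1 : ℕ) : ZMod p) := by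
          rw [rr_cast, Nat.cast_one, h1]
        rw [ZMod.natCast_eq_natCast_iff] at h1
        exact Nat.ModEq.eq_of_lt_of_lt h1 (Nat.mod_lt _ hp.out.pos) (by omega)
    rw [Multiset.prod_map_mul, Multiset.prod_map_mul, prod_roots_lin hm0 g hgn,
      ← hres ℂ (IsAlgClosed.splits _)] at hmul
    have hcard : Multiset.card (X ^ m + 1 : ℂ[X]).roots = m := by
      rw [← (IsAlgClosed.splits _).natDegree_eq_card_roots, hfd]
    simp only [Multiset.map_const', Multiset.prod_replicate, hcard] at hmul
    have ht' : ((g : ℂ) ^ m + 1) = p * t := by exact_mod_cast ht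
    rw [ht'] at hmul
    have hpp : (p : ℂ) ≠ 0 := by exact_mod_cast hp.out.ne_zero
    obtain ⟨m', rfl⟩ : ∃ m', m = m' + 1 := ⟨m - 1, by omega⟩
    apply mul_left_cancel₀ hpp
    have hs : ((-1 : ℂ) ^ (m' + 1)) * (-1) ^ (m' + 1) = 1 := by rw [← mul_pow]; simp
    simp only [Int.cast_mul, Int.cast_pow, Int.cast_neg, Int.cast_one, Int.cast_natCast,
      Nat.add_sub_cancel]
    linear_combination ((-1 : ℂ) ^ (m' + 1)) * hmul
      - (↑p * (t : ℂ) * ((X ^ (m' + 1) + 1 : ℂ[X]).roots.map (GG p g)).prod) * hs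
  · rw [show ((p : ℤ) ∣ (-1) ^ m * f.resultant (BB p g) m n) ↔
        ((p : ℤ) ∣ f.resultant (BB p g) m n) from
        (IsUnit.dvd_mul_left (IsUnit.pow _ (by simp)))]
    rw [← ZMod.intCast_zmod_eq_zero_iff_dvd, hres (ZMod p) (splits_zmod hm),
      Multiset.prod_eq_zero_iff, Multiset.mem_map]
    have hroot : ∀ j : ℕ, 1 ≤ j →
        ((BB p g).map (Int.castRingHom (ZMod p))).eval ((g : ZMod p) ^ j) =
        ∑ c ∈ range p, ((g * c / p : ℕ) : ZMod p) * ((g * c : ℕ) : ZMod p) ^ j := by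
      intro j hj
      rw [sum_rr (fun c => ((g * c / p : ℕ) : ZMod p) * ((g * c : ℕ) : ZMod p) ^ j) (by simp) g hg h2]
      rw [BB, Polynomial.map_sum, eval_finsetSum]
      refine sum_congr rfl fun i _ => ?_
      rw [Polynomial.map_mul, map_C, Polynomial.map_pow, map_X, eval_mul, eval_C, eval_pow, eval_X,
        Nat.cast_mul g, rr_cast]
      simp only [eq_intCast, Int.cast_natCast]
      ring
    have hmem : ∀ θ : ZMod p, θ ∈ (X ^ m + 1 : (ZMod p)[X]).roots ↔ θ ^ m = -1 := by
      intro θ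
      rw [mem_roots (by intro h; have := hfl (ZMod p); rw [h] at this; simp at this)]
      simp [IsRoot, eq_neg_iff_add_eq_zero]
    have hne1 : (-1 : ZMod p) ≠ 1 := by
      haveI : Fact (2 < p) := ⟨h2⟩
      exact ZMod.neg_one_ne_one
    constructor
    · rintro ⟨θ, hθ, h0⟩
      rw [hmem] at hθ
      have hθ0 : θ ≠ 0 := by rintro rfl; rw [zero_pow hm0.ne'] at hθ; simpa using hθ.symm
      -- θ is a power of g
      obtain ⟨j, hj, rfl⟩ : ∃ j < p - 1, (g : ZMod p) ^ j = θ := by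
        have hprim : IsPrimitiveRoot (g : ZMod p) (p - 1) := hg ▸ IsPrimitiveRoot.orderOf _
        haveI : NeZero (p - 1) := ⟨by omega⟩
        exact hprim.eq_pow_of_pow_eq_one (ZMod.pow_card_sub_one_eq_one hθ0)
      have hjo : Odd j := by
        rw [← pow_mul, mul_comm, pow_mul, hgm] at hθ
        by_contra hcon
        rw [Nat.not_odd_iff_even] at hcon
        rw [hcon.neg_one_pow] at hθ
        exact hne1 hθ.symm
      have hj1 : 1 ≤ j := hjo.pos
      rw [hroot j hj1] at h0
      by_cases hjp : j = p - 2
      · exfalso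
        rw [hjp] at h0
        refine fermat_quot_aux h2 g hpg ?_ h0
        intro hd
        have e : (g : ℤ) ^ (p - 1) - 1 = (g ^ m - 1) * (g ^ m + 1) := by
          rw [show p - 1 = m + m by omega, pow_add]; ring
        rw [e] at hd
        apply hq
        have hc : IsCoprime ((p : ℤ) ^ 2) ((g : ℤ) ^ m - 1) := by
          apply IsCoprime.pow_left
          refine (Prime.coprime_iff_not_dvd (Nat.prime_iff_prime_int.1 hp.out)).2 ?_
          rw [← ZMod.intCast_zmod_eq_zero_iff_dvd]
          push_cast
          rw [hgm]
          intro h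
          exact hne1 (sub_eq_zero.1 h)
        have := hc.dvd_of_dvd_mul_left hd
        exact_mod_cast this
      · obtain ⟨l, hl⟩ := hjo
        have hle : j + 1 ≤ p - 3 := by omega
        refine ⟨j + 1, by omega, hle, ⟨l + 1, by omega⟩, ?_⟩
        have hv := voronoi (p := p) (j + 1) (by omega) (by omega) g hpg
        rw [Nat.add_sub_cancel, h0, mul_zero, mul_eq_zero] at hv
        rw [← ZMod.intCast_zmod_eq_zero_iff_dvd]
        rcases hv with hv | hv
        · exfalso
          have := orderOf_dvd_of_pow_eq_one (sub_eq_zero.1 hv)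
          rw [hg] at this
          have := Nat.le_of_dvd (by omega) this
          omega
        · exact hv
    · rintro ⟨k, hk2, hkp, hke, hk⟩
      obtain ⟨l, hl⟩ := hke
      refine ⟨(g : ZMod p) ^ (k - 1), ?_, ?_⟩
      · rw [hmem, ← pow_mul, mul_comm, pow_mul, hgm]
        exact Odd.neg_one_pow ⟨l - 1, by omega⟩
      · rw [hroot (k - 1) (by omega)]
        have hv := voronoi (p := p) k (by omega) (by omega) g hpg
        rw [(ZMod.intCast_zmod_eq_zero_iff_dvd _ _).2 hk, mul_zero] at hv
        have hD : ((_root_.bernoulli k).den : ZMod p) ≠ 0 := by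
          rw [Ne, ZMod.natCast_eq_zero_iff]
          exact bernoulli_mem k (by omega)
        have hkk : (k : ZMod p) ≠ 0 := by
          rw [Ne, ZMod.natCast_eq_zero_iff]
          intro h
          have := Nat.le_of_dvd (by omega) h
          omega
        rcases mul_eq_zero.1 hv.symm with h | h
        · exact absurd h (mul_ne_zero hD hkk)
        · exact h

lemma exists_g {p m : ℕ} [hp : Fact p.Prime] (hm : p = 2 * m + 1) (hm0 : 0 < m) :
    ∃ g : ℕ, orderOf (g : ZMod p) = p - 1 ∧ ¬ p ^ 2 ∣ g ^ m + 1 := by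
  obtain ⟨u, hu⟩ := IsCyclic.exists_ofOrder_eq_natCard (α := (ZMod p)ˣ)
  rw [Nat.card_eq_fintype_card, ZMod.card_units] at hu
  rw [← orderOf_units] at hu
  set g := (u : ZMod p).val
  have hgc : ((g : ℕ) : ZMod p) = u := by simp [g]
  by_cases h : p ^ 2 ∣ g ^ m + 1
  · refine ⟨g + p, by simp [hgc, hu], fun h' => ?_⟩
    have hb := pow_congr_sq p g 1 m
    have h1 : (p : ℤ) ^ 2 ∣ (g : ℤ) ^ m + 1 := by exact_mod_cast h
    have h2 : (p : ℤ) ^ 2 ∣ (g + p : ℤ) ^ m + 1 := by exact_mod_cast h'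
    have h3 : (p : ℤ) ^ 2 ∣ p * (m * (g + p : ℤ) ^ (m - 1)) := by
      have := dvd_sub (dvd_sub h2 h1) hb
      have e : (g + p : ℤ) ^ m + 1 - ((g : ℤ) ^ m + 1) - ((g + p * 1 : ℤ) ^ m - m * p * 1 *
        (g + p * 1 : ℤ) ^ (m - 1) - g ^ m) = p * (m * (g + p : ℤ) ^ (m - 1)) := by ring
      rwa [e] at this
    rw [pow_two, mul_dvd_mul_iff_left (by exact_mod_cast hp.out.ne_zero),
      ← ZMod.intCast_zmod_eq_zero_iff_dvd] at h3
    push_cast at h3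
    rw [hgc, CharP.cast_eq_zero (ZMod p) p, add_zero, mul_eq_zero] at h3
    rcases h3 with h3 | h3
    · rw [ZMod.natCast_eq_zero_iff] at h3
      have := Nat.le_of_dvd hm0 h3
      omega
    · exact (u ^ (m - 1)).ne_zero (by push_cast; exact h3)
  · exact ⟨g, by rw [hgc]; exact hu, h⟩

end Kummer

namespace Kummer
open Finset Polynomial

/-- the W polynomial -/
noncomputable def WW (R : Type*) [CommRing R] (p a : ℕ) : R[X] :=
  ∑ c ∈ range p, ((a * c / p : ℕ) : R[X]) * X ^ (a * c)

lemma geom_G {A : Type*} [CommRing A] (y : A) (n : ℕ) :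
    (y - 1) * ∑ c ∈ range n, (c : A) * y ^ c = (n - 1 : A) * y ^ n + 1 - ∑ c ∈ range n, y ^ c := by
  induction n with
  | zero => simp
  | succ n ih => rw [sum_range_succ, sum_range_succ, mul_add, ih]; push_cast; ring

lemma W_aux {A : Type*} [CommRing A] {p : ℕ} [hp : Fact p.Prime] (x : A) (hx : x ^ p = 1)
    (a : ℕ) (ha : ¬ p ∣ a) :
    (p : A) * ((x ^ a - 1) * ∑ c ∈ range p, ((a * c / p : ℕ) : A) * x ^ (a * c)
      - a + ∑ c ∈ range a, x ^ c) = 0 := by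
  have hmod : ∀ n, x ^ n = x ^ (n % p) := fun n => by
    conv_lhs => rw [← Nat.mod_add_div n p, pow_add, pow_mul, hx, one_pow, mul_one]
  have hN : ∑ c ∈ range p, (x ^ a) ^ c = ∑ c ∈ range p, x ^ c := by
    rw [← sum_mod_perm (fun c => x ^ c) a ha]
    exact sum_congr rfl fun c _ => by rw [← pow_mul, hmod]
  have hW : (p : A) * ∑ c ∈ range p, ((a * c / p : ℕ) : A) * x ^ (a * c) =
      a * ∑ c ∈ range p, (c : A) * (x ^ a) ^ c - ∑ c ∈ range p, (c : A) * x ^ c := by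
    rw [← sum_mod_perm (fun c => (c : A) * x ^ c) a ha, mul_sum, mul_sum, ← sum_sub_distrib]
    refine sum_congr rfl fun c _ => ?_
    rw [← pow_mul, ← hmod]
    have := congrArg (Nat.cast (R := A)) (Nat.mod_add_div (a * c) p)
    push_cast at this ⊢
    linear_combination x ^ (a * c) * this
  have h1 := geom_G (x ^ a) p
  have h2 := geom_G x p
  rw [← pow_mul, mul_comm a p, pow_mul, hx, one_pow, hN] at h1
  rw [hx] at h2
  have h3 : (x - 1) * ∑ c ∈ range a, x ^ c = x ^ a - 1 := mul_geom_sum x a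
  have hxN : x * ∑ c ∈ range p, x ^ c = ∑ c ∈ range p, x ^ c := by
    have := mul_geom_sum x p
    rw [hx, sub_self, sub_mul, one_mul] at this
    exact sub_eq_zero.1 this
  have h4 : (∑ c ∈ range a, x ^ c) * ∑ c ∈ range p, x ^ c = a * ∑ c ∈ range p, x ^ c := by
    rw [sum_mul]
    have : ∀ c, x ^ c * ∑ c ∈ range p, x ^ c = ∑ c ∈ range p, x ^ c := by
      intro c
      induction c with
      | zero => simp
      | succ n ih => rw [pow_succ, mul_assoc, hxN, ih]
    simp [this]
  generalize ∑ c ∈ range a, x ^ c = g at *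
  generalize ∑ c ∈ range p, x ^ c = N at *
  generalize ∑ c ∈ range p, (c : A) * x ^ c = G at *
  generalize ∑ c ∈ range p, (c : A) * (x ^ a) ^ c = G' at *
  generalize ∑ c ∈ range p, ((a * c / p : ℕ) : A) * x ^ (a * c) = W at *
  linear_combination (x ^ a - 1) * hW + a * h1 + G * h3 - g * h2 + h4

lemma W_dvd {p : ℕ} [hp : Fact p.Prime] (a : ℕ) (ha : ¬ p ∣ a) :
    (X ^ p - 1 : ℤ[X]) ∣ (X ^ a - 1) * WW ℤ p a - (a : ℤ[X]) + ∑ c ∈ range a, X ^ c := by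
  set F := (X ^ a - 1) * WW ℤ p a - (a : ℤ[X]) + ∑ c ∈ range a, X ^ c with hF
  have hmon : (X ^ p - 1 : ℤ[X]).Monic := by
    simpa using monic_X_pow_sub_C (1 : ℤ) hp.out.ne_zero
  have h := W_aux (A := ℤ[X] ⧸ Ideal.span {(X ^ p - 1 : ℤ[X])}) (p := p)
    (Ideal.Quotient.mk _ X) (by
      rw [← map_pow, ← map_one (Ideal.Quotient.mk _), Ideal.Quotient.mk_eq_mk_iff_sub_mem]
      exact Ideal.mem_span_singleton_self _) a ha
  have h' : Ideal.Quotient.mk (Ideal.span {(X ^ p - 1 : ℤ[X])}) ((p : ℤ[X]) * F) = 0 := by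
    rw [← h, hF, WW]
    simp only [map_mul, map_add, map_sub, map_pow, map_sum, map_natCast, map_one]
  rw [Ideal.Quotient.eq_zero_iff_mem, Ideal.mem_span_singleton] at h'
  rw [← modByMonic_eq_zero_iff_dvd hmon] at h' ⊢
  have e : (p : ℤ[X]) * F = (p : ℤ) • F := by simp [zsmul_eq_mul]
  rw [e, smul_modByMonic] at h'
  exact (smul_eq_zero.1 h').resolve_left (by exact_mod_cast hp.out.ne_zero)

lemma W_dvd' {p : ℕ} [hp : Fact p.Prime] (a : ℕ) (ha : ¬ p ∣ a) :
    (X - 1 : (ZMod p)[X]) ^ (p - 1) ∣ X * derivative (∑ c ∈ range a, X ^ c) -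
      (∑ c ∈ range a, X ^ c) * (WW (ZMod p) p a + ((a : (ZMod p)[X]) - 1)) := by
  have h := Polynomial.map_dvd (Int.castRingHom (ZMod p)) (W_dvd a ha)
  have hW : (WW ℤ p a).map (Int.castRingHom (ZMod p)) = WW (ZMod p) p a := by
    simp [WW, Polynomial.map_sum]
  simp only [Polynomial.map_sub, Polynomial.map_add, Polynomial.map_mul, Polynomial.map_pow,
    map_X, Polynomial.map_one, Polynomial.map_natCast, Polynomial.map_sum, hW] at h
  have hX : (X ^ p - 1 : (ZMod p)[X]) = (X - 1) * (X - 1) ^ (p - 1) := by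
    rw [← pow_succ', Nat.sub_add_cancel hp.out.one_le, sub_pow_char, one_pow]
  rw [hX] at h
  obtain ⟨T, hT⟩ := h
  have h3 : (X - 1 : (ZMod p)[X]) * ∑ c ∈ range a, X ^ c = X ^ a - 1 := mul_geom_sum X a
  have h4 := congrArg derivative h3
  simp only [derivative_mul, derivative_sub, derivative_X, derivative_one, derivative_X_pow] at h4
  refine ⟨-T, ?_⟩
  have h0 : (X - 1 : (ZMod p)[X]) ≠ 0 := by simpa using X_sub_C_ne_zero (1 : ZMod p)
  apply mul_left_cancel₀ h0
  have hxa : (X : (ZMod p)[X]) * (C (a : ZMod p) * X ^ (a - 1)) = (a : (ZMod p)[X]) * X ^ a := by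
    rcases a with _ | a
    · simp
    · rw [Nat.add_sub_cancel, pow_succ]; simp only [map_natCast]; ring
  generalize (∑ c ∈ range a, X ^ c : (ZMod p)[X]) = g at *
  generalize WW (ZMod p) p a = W at *
  linear_combination X * h4 - hT + hxa - (W + a - 1) * h3 - h3

/-- Euler operator -/
noncomputable def DD {R : Type*} [CommRing R] (f : R[X]) : R[X] := X * derivative f

lemma DD_dvd {R : Type*} [CommRing R] (n : ℕ) (f : R[X]) (h : (X - 1) ^ (n + 1) ∣ f) :
    (X - 1) ^ n ∣ DD f := by
  obtain ⟨g, rfl⟩ := h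
  rw [DD, derivative_mul, derivative_pow_succ]
  exact ⟨X * ((n + 1 : R[X]) * g + (X - 1) * derivative g), by
    simp only [derivative_sub, derivative_X, derivative_one, map_add, map_natCast, map_one]
    ring⟩

lemma DD_iter_dvd {R : Type*} [CommRing R] (n j : ℕ) (f : R[X]) (h : (X - 1) ^ (n + j) ∣ f) :
    (X - 1) ^ n ∣ DD^[j] f := by
  induction j generalizing f with
  | zero => simpa using h
  | succ j ih => rw [Function.iterate_succ_apply]; exact ih _ (DD_dvd _ _ (by simpa [add_assoc] using h))

lemma DD_iter_add {R : Type*} [CommRing R] (j : ℕ) (f g : R[X]) :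
    DD^[j] (f + g) = DD^[j] f + DD^[j] g := by
  induction j generalizing f g with
  | zero => rfl
  | succ j ih => simp only [Function.iterate_succ_apply]; rw [← ih]; congr 1; simp [DD, mul_add]

lemma DD_iter_zero {R : Type*} [CommRing R] (j : ℕ) : DD^[j] (0 : R[X]) = 0 := by
  induction j with
  | zero => rfl
  | succ j ih => rw [Function.iterate_succ_apply, DD]; simpa using ih

lemma DD_iter_sum {R ι : Type*} [CommRing R] (j : ℕ) (s : Finset ι) (f : ι → R[X]) :
    DD^[j] (∑ i ∈ s, f i) = ∑ i ∈ s, DD^[j] (f i) := by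
  classical
  induction s using Finset.induction_on with
  | empty => simp [DD_iter_zero]
  | insert a s ha ih => rw [sum_insert ha, sum_insert ha, DD_iter_add, ih]

lemma DD_iter_mono {R : Type*} [CommRing R] (j n : ℕ) (c : R) :
    DD^[j] (C c * X ^ n) = C (c * n ^ j) * X ^ n := by
  induction j generalizing c with
  | zero => simp
  | succ j ih =>
    rw [Function.iterate_succ_apply]
    have : DD (C c * X ^ n) = C (c * n) * X ^ n := by
      rw [DD, derivative_C_mul_X_pow]
      rcases n with _ | n
      · simp
      · rw [Nat.add_sub_cancel, pow_succ]; ring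
    rw [this, ih, pow_succ]; congr 2; ring

end Kummer

namespace Kummer
open Finset Polynomial

/-- logarithmic derivative relation modulo `q` -/
def LD {R : Type*} [CommRing R] (q f L : R[X]) : Prop := q ∣ X * derivative f - f * L

lemma LD.mul {R : Type*} [CommRing R] {q f L f' L' : R[X]} (h : LD q f L) (h' : LD q f' L') :
    LD q (f * f') (L + L') := by
  obtain ⟨a, ha⟩ := h
  obtain ⟨b, hb⟩ := h'
  refine ⟨f' * a + f * b, ?_⟩
  rw [derivative_mul]
  linear_combination f' * ha + f * hb

lemma LD.one {R : Type*} [CommRing R] {q : R[X]} : LD q 1 0 := by simp [LD]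

lemma LD.X {R : Type*} [CommRing R] {q : R[X]} : LD q X 1 := by simp [LD]

lemma LD.pow {R : Type*} [CommRing R] {q f L : R[X]} (h : LD q f L) (n : ℕ) :
    LD q (f ^ n) (n * L) := by
  induction n with
  | zero => simpa using LD.one
  | succ n ih => rw [pow_succ]; convert ih.mul h using 1; push_cast; ring

lemma LD.prod {R ι : Type*} [CommRing R] {q : R[X]} (s : Finset ι) {f L : ι → R[X]}
    (h : ∀ i, LD q (f i) (L i)) : LD q (∏ i ∈ s, f i) (∑ i ∈ s, L i) := by
  classical
  induction s using Finset.induction_on with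
  | empty => simpa using LD.one
  | insert a s ha ih => rw [prod_insert ha, sum_insert ha]; exact (h a).mul ih

lemma poly_core {p : ℕ} [hp : Fact p.Prime] {ι : Type*} [Fintype ι] (a N : ι → ℕ) (j : ℕ)
    (c : ZMod p) (ha : ∀ i, ¬ p ∣ a i)
    (h : (X - 1 : (ZMod p)[X]) ^ (p - 1) ∣ X ^ j * ∏ i, (∑ c ∈ range (a i), X ^ c) ^ N i - C c)
    (k : ℕ) (hk : 2 ≤ k) (hkp : k ≤ p - 2) :
    ∑ i, (N i : ZMod p) * ∑ c ∈ range p, ((a i * c / p : ℕ) : ZMod p) *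
      ((a i * c : ℕ) : ZMod p) ^ (k - 1) = 0 := by
  set Q : (ZMod p)[X] := X ^ j * ∏ i, (∑ c ∈ range (a i), X ^ c) ^ N i with hQ
  set L : (ZMod p)[X] := (j : (ZMod p)[X]) * 1 +
    ∑ i, (N i : (ZMod p)[X]) * (WW (ZMod p) p (a i) + ((a i : (ZMod p)[X]) - 1)) with hL
  have h1 : LD ((X - 1 : (ZMod p)[X]) ^ (p - 1)) Q L :=
    (LD.X.pow j).mul (LD.prod _ fun i => LD.pow (W_dvd' (a i) (ha i)) (N i))
  have hpp : p - 1 = (p - 2) + 1 := by omega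
  have h2 : (X - 1 : (ZMod p)[X]) ^ (p - 2) ∣ X * derivative Q := by
    rw [hpp] at h
    have := DD_dvd _ _ h
    simpa [DD] using this
  have h3 : (X - 1 : (ZMod p)[X]) ^ (p - 2) ∣ Q * L := by
    have h4 := (pow_dvd_pow (X - 1 : (ZMod p)[X]) (show p - 2 ≤ p - 1 by omega)).trans h1
    have := dvd_sub h2 h4
    rwa [sub_sub_cancel] at this
  have hcop : IsCoprime ((X - 1 : (ZMod p)[X]) ^ (p - 2)) Q := by
    apply IsCoprime.pow_left
    have hirr : Irreducible (X - 1 : (ZMod p)[X]) := by simpa using irreducible_X_sub_C (1 : ZMod p)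
    refine (hirr.coprime_iff_not_dvd).2 ?_
    intro hd
    have hd' : (X - C (1 : ZMod p)) ∣ Q := by simpa using hd
    rw [dvd_iff_isRoot, IsRoot, hQ, eval_mul, eval_prod] at hd'
    simp only [eval_pow, eval_X, one_pow, one_mul, eval_finsetSum, sum_const, card_range,
      smul_eq_mul, mul_one, nsmul_eq_mul] at hd'
    rw [prod_eq_zero_iff] at hd'
    obtain ⟨i, -, hi⟩ := hd'
    exact ha i ((ZMod.natCast_eq_zero_iff _ _).1 (eq_zero_of_pow_eq_zero hi))
  have h5 := hcop.dvd_of_dvd_mul_left h3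
  have h6 := DD_iter_dvd (p - 2 - (k - 1)) (k - 1) L (by
    rwa [Nat.sub_add_cancel (by omega)])
  have h7 : eval 1 (DD^[k - 1] L) = 0 := by
    have : (X - C (1 : ZMod p)) ∣ DD^[k - 1] L := by
      refine dvd_trans ?_ h6
      rw [map_one]
      exact dvd_pow_self _ (by omega)
    exact dvd_iff_isRoot.1 this
  have h0 : ∀ c : ZMod p, DD^[k - 1] (C c) = 0 := by
    intro c
    have := DD_iter_mono (k - 1) 0 c
    rw [Nat.cast_zero, zero_pow (by omega : k - 1 ≠ 0)] at this
    simpa using this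
  have hL' : L = C ((j : ZMod p) + ∑ i, (N i : ZMod p) * ((a i : ZMod p) - 1)) +
      ∑ i, ∑ c ∈ range p, C ((N i : ZMod p) * ((a i * c / p : ℕ) : ZMod p)) * X ^ (a i * c) := by
    rw [hL]
    simp only [WW, mul_add, sum_add_distrib, mul_sum, map_add, map_sum, map_mul, map_sub,
      map_natCast, map_one, mul_one, mul_assoc]
    ring
  rw [hL', DD_iter_add, h0, zero_add, DD_iter_sum, eval_finsetSum] at h7
  rw [← h7]
  refine sum_congr rfl fun i _ => ?_
  rw [DD_iter_sum, eval_finsetSum, mul_sum]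
  refine sum_congr rfl fun c _ => ?_
  rw [DD_iter_mono]
  simp only [eval_mul, eval_C, eval_pow, eval_X, one_pow, mul_one]
  ring

lemma poly_core2 {p : ℕ} [hp : Fact p.Prime] {ι : Type*} [Fintype ι] (a N : ι → ℕ) (j : ℕ)
    (c : ZMod p) (ha : ∀ i, ¬ p ∣ a i)
    (h : (X - 1 : (ZMod p)[X]) ^ (p - 1) ∣ X ^ j * ∏ i, (∑ c ∈ range (a i), X ^ c) ^ N i - C c)
    (hB : ∀ k : ℕ, 2 ≤ k → k ≤ p - 3 → Even k → ¬ (p : ℤ) ∣ (_root_.bernoulli k).num)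
    (k : ℕ) (hk : 2 ≤ k) (hkp : k ≤ p - 3) (hke : Even k) :
    ∑ i, (N i : ZMod p) * ((a i : ZMod p) ^ k - 1) = 0 := by
  have h1 := poly_core a N j c ha h k hk (by omega)
  have hb : ((_root_.bernoulli k).num : ZMod p) ≠ 0 := by
    rw [Ne, ZMod.intCast_zmod_eq_zero_iff_dvd]; exact hB k hk hkp hke
  apply (mul_eq_zero.1 _).resolve_right hb
  rw [sum_mul]
  rw [← mul_zero ((_root_.bernoulli k).den * k : ZMod p), ← h1, mul_sum]
  refine sum_congr rfl fun i _ => ?_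
  have := voronoi (p := p) k (by omega) (by omega) (a i) (ha i)
  rw [mul_assoc, this]; ring

end Kummer

namespace Kummer
open Finset Polynomial NumberField

lemma vander {p n g : ℕ} [hp : Fact p.Prime] (hm : p = 2 * (n + 1) + 1)
    (hg : orderOf (g : ZMod p) = p - 1) (N : Fin n → ZMod p)
    (h : ∀ k : ℕ, 2 ≤ k → k ≤ p - 3 → Even k →
      ∑ i : Fin n, N i * (((g ^ (i.val + 1) : ℕ) : ZMod p) ^ k - 1) = 0) : N = 0 := by
  set v : Fin (n + 1) → ZMod p := Fin.cons (-∑ i, N i) N with hv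
  set f : Fin (n + 1) → ZMod p := fun j => ((g : ZMod p) ^ 2) ^ j.val with hf
  have hinj : Function.Injective f := by
    intro x y hxy
    simp only [hf, ← pow_mul] at hxy
    have := pow_injOn_Iio_orderOf (x := (g : ZMod p))
    rw [hg] at this
    have h3 := this (by simp only [Set.mem_Iio]; omega) (by simp only [Set.mem_Iio]; omega) hxy
    ext; omega
  have hz : v = 0 := by
    refine Matrix.eq_zero_of_forall_pow_sum_mul_pow_eq_zero hinj ?_
    intro l
    rw [Fin.sum_univ_succ]
    simp only [hv, Fin.cons_zero, Fin.cons_succ, hf, Fin.val_zero, pow_zero, one_pow, mul_one,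
      Fin.val_succ]
    by_cases hl : l.val = 0
    · simp [hl]
    · have := h (2 * l.val) (by omega) (by omega) (even_two_mul _)
      simp only [mul_sub, mul_one, sum_sub_distrib] at this
      rw [neg_add_eq_sub, ← this]
      congr 1
      refine sum_congr rfl fun i _ => ?_
      push_cast
      ring
  funext i
  have := congrFun hz i.succ
  simpa [hv] using this

lemma zeta_dvd {p : ℕ} [hp : Fact p.Prime] {A : Type*} [Field A] [CharZero A]
    {ζ : A} (hζ : IsPrimitiveRoot ζ p) (P : ℤ[X]) (h : aeval ζ P = 0) :
    (X - 1 : (ZMod p)[X]) ^ (p - 1) ∣ P.map (Int.castRingHom (ZMod p)) := by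
  have h1 : cyclotomic p ℤ ∣ P := by
    rw [cyclotomic_eq_minpoly hζ hp.out.pos]
    exact minpoly.isIntegrallyClosed_dvd (hζ.isIntegral hp.out.pos) h
  have h2 := Polynomial.map_dvd (Int.castRingHom (ZMod p)) h1
  rw [map_cyclotomic] at h2
  have h3 := cyclotomic_mul_prime_pow_eq (ZMod p) (p := p) (m := 1) hp.out.not_dvd_one
    (k := 1) one_pos
  simp only [pow_one, mul_one, cyclotomic_one, Nat.sub_self, pow_zero] at h3
  rwa [h3] at h2

lemma pow_p_congr {p : ℕ} [hp : Fact p.Prime] (H : (ZMod p)[X]) :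
    (X - 1 : (ZMod p)[X]) ^ (p - 1) ∣ H ^ p - C (eval 1 H) := by
  have h1 : (X - 1 : (ZMod p)[X]) ∣ H - C (eval 1 H) := by
    have := X_sub_C_dvd_sub_C_eval (a := 1) (p := H)
    simpa using this
  have h2 := pow_dvd_pow_of_dvd h1 p
  rw [sub_pow_char (p := p) H, ← C_pow, ZMod.pow_card] at h2
  exact (pow_dvd_pow _ (Nat.sub_le p 1)).trans h2

theorem P3_pow {p : ℕ} [hp : Fact p.Prime] {K : Type*} [Field K] [NumberField K]
    [IsCyclotomicExtension {p} ℚ K] {ζ : K} (hζ : IsPrimitiveRoot ζ p) {n g : ℕ}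
    (hm : p = 2 * (n + 1) + 1) (hg : orderOf (g : ZMod p) = p - 1)
    (hB : ∀ k : ℕ, 2 ≤ k → k ≤ p - 3 → Even k → ¬ (p : ℤ) ∣ (_root_.bernoulli k).num)
    (hpg : ¬ p ∣ g)
    (u : Fin n → (𝓞 K)ˣ) (hu : ∀ i, (u i : 𝓞 K) = ∑ c ∈ range (g ^ (i.val + 1)), hζ.toInteger ^ c)
    (η : (𝓞 K)ˣ) (hη : η ^ p ∈ Subgroup.closure (Set.range u) ⊔ Units.torsion K) :
    η ∈ Subgroup.closure (Set.range u) ⊔ Units.torsion K := by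
  have hoddp : ¬ Even p := by rw [hm]; simp [parity_simps]
  obtain ⟨y, hy, t, ht, hyt⟩ := Subgroup.mem_sup.1 hη
  obtain ⟨e, rfl⟩ := (Subgroup.mem_closure_range_iff_of_fintype).1 hy
  have ht2 : (t ^ 2) ^ p = 1 := by
    rw [← pow_mul]
    have h1 := Units.rootsOfUnity_eq_torsion K
    have h2 := IsCyclotomicExtension.Rat.torsionOrder_eq (n := p) (K := K)
    rw [if_neg hoddp] at h2
    rw [← h1, h2] at ht
    exact ht
  have hζO := hζ.toInteger_isPrimitiveRoot
  obtain ⟨j, -, hj⟩ := hζO.eq_pow_of_pow_eq_one (ξ := ((t ^ 2 : (𝓞 K)ˣ) : 𝓞 K))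
    (by rw [← Units.val_pow_eq_pow_val, ht2, Units.val_one])
  set N : Fin n → ℕ := fun i => (2 * e i % p).toNat with hN
  have hN' : ∀ i, (2 * e i : ℤ) = N i + p * (2 * e i / p) := by
    intro i
    have h0 : 0 ≤ 2 * e i % (p : ℤ) := Int.emod_nonneg _ (by exact_mod_cast hp.out.ne_zero)
    rw [hN]
    simp only [Int.toNat_of_nonneg h0]
    exact (Int.emod_add_mul_ediv _ _).symm
  set ξ : (𝓞 K)ˣ := η ^ 2 * ∏ i, u i ^ (-(2 * e i / p) : ℤ) with hξ
  have hξp : ξ ^ p = t ^ 2 * ∏ i, u i ^ N i := by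
    rw [hξ, mul_pow, ← pow_mul, mul_comm 2 p, pow_mul, ← hyt, mul_pow, ← prod_pow, ← prod_pow,
      mul_comm (∏ i, _) (t ^ 2), mul_assoc, ← prod_mul_distrib]
    congr 1
    refine prod_congr rfl fun i _ => ?_
    rw [← zpow_natCast, ← zpow_natCast, ← zpow_natCast, ← zpow_mul, ← zpow_mul, ← zpow_add]
    congr 1
    have := hN' i
    push_cast
    linear_combination this
  obtain ⟨H, hH⟩ := (hζ.integralPowerBasis).exists_eq_aeval' (ξ : 𝓞 K)
  rw [hζ.integralPowerBasis_gen] at hH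
  set P : ℤ[X] := H ^ p - X ^ j * ∏ i : Fin n, (∑ c ∈ range (g ^ (i.val + 1)), X ^ c) ^ N i with hP
  have hP0 : aeval hζ.toInteger P = 0 := by
    rw [hP]
    simp only [map_sub, map_pow, map_mul, map_prod, map_sum, aeval_X, ← hH, hj]
    rw [sub_eq_zero]
    have := congrArg (Units.val) hξp
    simp only [Units.val_pow_eq_pow_val, Units.val_mul, Units.coe_prod, hu] at this
    exact this
  have h1 := zeta_dvd hζ P (by
    have := congrArg (algebraMap (𝓞 K) K) hP0
    rwa [map_zero, ← aeval_algebraMap_apply] at this)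
  have h2 := pow_p_congr (H.map (Int.castRingHom (ZMod p)))
  have h3 := dvd_sub h2 h1
  rw [hP] at h3
  simp only [Polynomial.map_sub, Polynomial.map_pow, Polynomial.map_mul, Polynomial.map_prod,
    Polynomial.map_sum, map_X] at h3
  rw [sub_sub_sub_cancel_left] at h3
  have h4 := poly_core2 (fun i : Fin n => g ^ (i.val + 1)) N j _
    (fun i hi => hpg (hp.out.dvd_of_dvd_pow hi)) h3 hB
  have h5 := vander hm hg (fun i => (N i : ZMod p)) h4
  have h6 : ∀ i, ∃ l : ℤ, e i = p * l := by
    intro i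
    have h7 := congrFun h5 i
    simp only [Pi.zero_apply] at h7
    rw [ZMod.natCast_eq_zero_iff] at h7
    have h8 : (p : ℤ) ∣ 2 * e i := by
      rw [hN' i]; exact dvd_add (by exact_mod_cast h7) (dvd_mul_right _ _)
    have hpr := Nat.prime_iff_prime_int.1 hp.out
    rcases hpr.dvd_or_dvd h8 with h9 | h9
    · exfalso
      have := Int.le_of_dvd (by norm_num) h9
      omega
    · exact h9
  choose l hl using h6
  have h10 : η * (∏ i, u i ^ l i)⁻¹ ∈ Units.torsion K := by
    have h11 : (η * (∏ i, u i ^ l i)⁻¹) ^ p = t := by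
      rw [mul_pow, ← hyt, inv_pow, ← prod_pow]
      rw [mul_assoc, mul_comm t, ← mul_assoc]
      have : ∏ i, u i ^ e i = ∏ i, (u i ^ l i) ^ p := by
        refine prod_congr rfl fun i _ => ?_
        rw [hl i, mul_comm, zpow_mul, zpow_natCast]
      rw [this, mul_inv_cancel, one_mul]
    rw [Units.torsion, CommGroup.mem_torsion] at ht ⊢
    rw [← h11] at ht
    exact (isOfFinOrder_pow.1 ht).resolve_right hp.out.ne_zero
  have := Subgroup.mul_mem_sup
    ((Subgroup.mem_closure_range_iff_of_fintype (f := u)).2 ⟨l, rfl⟩) h10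
  rwa [mul_comm, inv_mul_cancel_right] at this

theorem P3_main {p : ℕ} [hp : Fact p.Prime] {K : Type*} [Field K] [NumberField K]
    [IsCyclotomicExtension {p} ℚ K] {ζ : K} (hζ : IsPrimitiveRoot ζ p) {n g : ℕ}
    (hm : p = 2 * (n + 1) + 1) (hg : orderOf (g : ZMod p) = p - 1)
    (hB : ∀ k : ℕ, 2 ≤ k → k ≤ p - 3 → Even k → ¬ (p : ℤ) ∣ (_root_.bernoulli k).num)
    (hpg : ¬ p ∣ g)
    (u : Fin n → (𝓞 K)ˣ) (hu : ∀ i, (u i : 𝓞 K) = ∑ c ∈ range (g ^ (i.val + 1)), hζ.toInteger ^ c)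
    (h0 : (Subgroup.closure (Set.range u) ⊔ Units.torsion K).index ≠ 0) :
    ¬ p ∣ (Subgroup.closure (Set.range u) ⊔ Units.torsion K).index := by
  intro hd
  set C := Subgroup.closure (Set.range u) ⊔ Units.torsion K with hC
  rw [Subgroup.index] at hd h0
  have : Finite ((𝓞 K)ˣ ⧸ C) := Nat.finite_of_card_ne_zero h0
  obtain ⟨x, hx⟩ := exists_prime_orderOf_dvd_card' p hd
  obtain ⟨η, rfl⟩ := QuotientGroup.mk_surjective x
  have h1 : η ^ p ∈ C := by
    rw [← QuotientGroup.eq_one_iff, QuotientGroup.mk_pow, ← hx, pow_orderOf_eq_one]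
  have h2 : η ∈ C := P3_pow hζ hm hg hB hpg u hu η h1
  rw [(QuotientGroup.eq_one_iff η).2 h2, orderOf_one] at hx
  exact hp.out.one_lt.ne hx

end Kummer

namespace Kummer
open Finset Filter Topology

lemma abel_tsum {z : ℂ} (c : ℕ → ℂ) (hc : Summable fun n => z ^ (n + 1) * c n) :
    (1 - z) * ∑' n, z ^ (n + 1) * c n = z * c 0 + ∑' n, z ^ (n + 2) * (c (n + 1) - c n) := by
  have h1 : Summable fun n => z ^ (n + 2) * c (n + 1) := (summable_nat_add_iff 1).2 hc
  have h2 : Summable fun n => z ^ (n + 2) * c n := by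
    refine (hc.mul_left z).congr fun n => ?_
    ring
  have e1 := hc.tsum_eq_zero_add
  have e2 : z * ∑' n, z ^ (n + 1) * c n = ∑' n, z ^ (n + 2) * c n := by
    rw [← tsum_mul_left]; congr 1; funext n; ring
  have e3 : ∑' n, z ^ (n + 2) * (c (n + 1) - c n) =
      ∑' n, z ^ (n + 2) * c (n + 1) - ∑' n, z ^ (n + 2) * c n := by
    rw [← h1.tsum_sub h2]; congr 1; funext n; ring
  rw [sub_mul, one_mul, e2, e3, e1]
  simp only [zero_add, pow_one]
  ring

/-- c_n(s) -/
noncomputable def cc (s : ℝ) (n : ℕ) : ℂ := (((n : ℝ) + 1) ^ (-s) : ℝ)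

lemma cc_cont (n : ℕ) : Continuous fun s => cc s n := by
  unfold cc
  refine Complex.continuous_ofReal.comp ?_
  exact Real.continuous_const_rpow (by positivity) |>.comp continuous_neg

lemma cc_diff (s : ℝ) (hs1 : 1 ≤ s) (hs2 : s ≤ 2) (n : ℕ) :
    ‖cc s (n + 1) - cc s n‖ ≤ 3 / ((n : ℝ) + 1) ^ 2 := by
  unfold cc
  rw [← Complex.ofReal_sub, Complex.norm_real, Real.norm_eq_abs, abs_sub_comm]
  set k : ℝ := (n : ℝ) + 1 with hk
  have hkp : 1 ≤ k := by rw [hk]; linarith [(Nat.cast_nonneg n : (0 : ℝ) ≤ n)]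
  have hk0 : 0 < k := by linarith
  have e : ((n + 1 : ℕ) : ℝ) + 1 = k + 1 := by push_cast; rw [hk]
  rw [e]
  have h1 : (k + 1) ^ (-s) ≤ k ^ (-s) :=
    Real.rpow_le_rpow_of_nonpos hk0 (by linarith) (by linarith)
  rw [abs_of_nonneg (by linarith)]
  have h2 : k ^ (-s) = (k + 1) ^ (-s) * ((k + 1) / k) ^ s := by
    rw [Real.div_rpow (by linarith) hk0.le, Real.rpow_neg (by linarith : 0 ≤ k + 1),
      Real.rpow_neg hk0.le]
    have : (k + 1) ^ s ≠ 0 := (Real.rpow_pos_of_pos (by linarith) _).ne'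
    field_simp
  have h3 : ((k + 1) / k) ^ s ≤ ((k + 1) / k) ^ (2 : ℝ) :=
    Real.rpow_le_rpow_of_exponent_le (by rw [le_div_iff₀ hk0]; linarith) hs2
  rw [Real.rpow_two] at h3
  have h4 : (k + 1) ^ (-s) ≤ (k + 1)⁻¹ := by
    rw [← Real.rpow_neg_one]
    exact Real.rpow_le_rpow_of_exponent_le (by linarith) (by linarith)
  have h5 : 0 ≤ (k + 1) ^ (-s) := (Real.rpow_pos_of_pos (by linarith) _).le
  have h6 : 1 ≤ ((k + 1) / k) ^ 2 := one_le_pow₀ (by rw [le_div_iff₀ hk0]; linarith)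
  calc k ^ (-s) - (k + 1) ^ (-s) = (k + 1) ^ (-s) * (((k + 1) / k) ^ s - 1) := by rw [h2]; ring
    _ ≤ (k + 1)⁻¹ * (((k + 1) / k) ^ 2 - 1) := by
        refine mul_le_mul h4 (by linarith) ?_ (by positivity)
        have := Real.one_le_rpow (x := (k + 1) / k) (z := s)
          (by rw [le_div_iff₀ hk0]; linarith) (by linarith)
        linarith
    _ ≤ 3 / k ^ 2 := by
        rw [inv_mul_eq_div, div_le_div_iff₀ (by linarith) (by positivity)]
        field_simp
        nlinarith

lemma summable_bound : Summable fun n : ℕ => 3 / ((n : ℝ) + 1) ^ 2 := by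
  have := (summable_nat_add_iff 1).2 (Real.summable_one_div_nat_pow.2 (by norm_num : 1 < 2))
  refine (this.mul_left 3).congr fun n => ?_
  push_cast; ring

theorem tendsto_polylog {z : ℂ} (hz : ‖z‖ = 1) (hz1 : z ≠ 1) :
    Tendsto (fun s : ℝ => ∑' n : ℕ, z ^ (n + 1) * cc s n) (𝓝[>] 1)
      (𝓝 (-Complex.log (1 - z))) := by
  have hz1' : 1 - z ≠ 0 := sub_ne_zero.2 hz1.symm
  set V : ℂ := z * cc 1 0 + ∑' n, z ^ (n + 2) * (cc 1 (n + 1) - cc 1 n) with hV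
  -- first limit
  have hA : Tendsto (fun s : ℝ => (1 - z) * ∑' n : ℕ, z ^ (n + 1) * cc s n) (𝓝[>] 1) (𝓝 V) := by
    have h1 : Tendsto (fun s : ℝ => z * cc s 0 + ∑' n, z ^ (n + 2) * (cc s (n + 1) - cc s n))
        (𝓝[>] 1) (𝓝 V) := by
      refine Tendsto.add ?_ ?_
      · exact ((cc_cont 0).tendsto 1 |>.const_mul z).mono_left nhdsWithin_le_nhds
      · refine tendsto_tsum_of_dominated_convergence summable_bound ?_ ?_
        · intro n
          exact ((((cc_cont (n + 1)).sub (cc_cont n)).tendsto 1).const_mul _).mono_left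
            nhdsWithin_le_nhds
        · have : ∀ᶠ s : ℝ in 𝓝[>] 1, s ∈ Set.Ioc (1 : ℝ) 2 := Ioc_mem_nhdsGT (by norm_num)
          filter_upwards [this] with s hs n
          rw [norm_mul, norm_pow, hz, one_pow, one_mul]
          exact cc_diff s hs.1.le hs.2 n
    refine h1.congr' ?_
    filter_upwards [self_mem_nhdsWithin] with s hs
    refine (abel_tsum _ ?_).symm
    refine Summable.of_norm ?_
    have h2 := (summable_nat_add_iff 1).2 (Real.summable_nat_rpow.2 (neg_lt_neg hs))
    refine h2.congr fun n => ?_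
    rw [norm_mul, norm_pow, hz, one_pow, one_mul, cc, Complex.norm_real, Real.norm_eq_abs,
      abs_of_nonneg (by positivity)]
    push_cast; rfl
  -- second limit
  have hB : Tendsto (fun r : ℝ => (1 - r * z) * (-Complex.log (1 - r * z))) (𝓝[<] 1) (𝓝 V) := by
    have h1 : Tendsto (fun r : ℝ => (r * z) * cc 1 0 +
        ∑' n, (r * z) ^ (n + 2) * (cc 1 (n + 1) - cc 1 n)) (𝓝[<] 1) (𝓝 V) := by
      have hr : ∀ k : ℕ, Tendsto (fun r : ℝ => ((r : ℂ) * z) ^ k) (𝓝[<] 1) (𝓝 (z ^ k)) := by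
        intro k
        have : Continuous fun r : ℝ => ((r : ℂ) * z) ^ k := by fun_prop
        have h := (this.tendsto 1).mono_left (nhdsWithin_le_nhds (s := Set.Iio 1))
        simpa using h
      refine Tendsto.add ?_ ?_
      · have := hr 1
        simp only [pow_one] at this
        exact this.mul_const _
      · refine tendsto_tsum_of_dominated_convergence summable_bound ?_ ?_
        · intro n
          exact (hr (n + 2)).mul_const _
        · have : ∀ᶠ r : ℝ in 𝓝[<] 1, r ∈ Set.Ico (0 : ℝ) 1 := Ico_mem_nhdsLT (by norm_num)
          filter_upwards [this] with r hr n
          rw [norm_mul, norm_pow, norm_mul, hz, mul_one, Complex.norm_real, Real.norm_eq_abs,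
            abs_of_nonneg hr.1]
          refine (mul_le_of_le_one_left (norm_nonneg _) (pow_le_one₀ hr.1 hr.2.le)).trans ?_
          exact cc_diff 1 le_rfl (by norm_num) n
    refine h1.congr' ?_
    have : ∀ᶠ r : ℝ in 𝓝[<] 1, r ∈ Set.Ico (0 : ℝ) 1 := Ico_mem_nhdsLT (by norm_num)
    filter_upwards [this] with r hr
    have hn : ‖(r : ℂ) * z‖ < 1 := by
      rw [norm_mul, hz, mul_one, Complex.norm_real, Real.norm_eq_abs, abs_of_nonneg hr.1]
      exact hr.2
    have hs := Complex.hasSum_taylorSeries_neg_log hn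
    have hs' : HasSum (fun n : ℕ => ((r : ℂ) * z) ^ (n + 1) * cc 1 n)
        (-Complex.log (1 - r * z)) := by
      have := (hasSum_nat_add_iff' 1).2 hs
      simp only [range_one, sum_singleton, pow_zero, Nat.cast_zero, div_zero, sub_zero] at this
      have he : (fun n : ℕ => ((r : ℂ) * z) ^ (n + 1) * cc 1 n) =
          fun n : ℕ => ((r : ℂ) * z) ^ (n + 1) / ((n + 1 : ℕ) : ℂ) := by
        funext n
        rw [cc, Real.rpow_neg_one, div_eq_mul_inv]
        push_cast; rfl
      rw [he]
      exact this
    rw [← hs'.tsum_eq]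
    exact (abel_tsum _ hs'.summable).symm
  have hC : Tendsto (fun r : ℝ => (1 - r * z) * (-Complex.log (1 - r * z))) (𝓝[<] 1)
      (𝓝 ((1 - z) * (-Complex.log (1 - z)))) := by
    have hsl : 1 - z ∈ Complex.slitPlane := by
      rw [Complex.mem_slitPlane_iff]
      left
      have h1 : z.re ≤ 1 := (Complex.re_le_norm z).trans hz.le
      rcases h1.lt_or_eq with h | h
      · simpa using h
      · exfalso
        apply hz1
        have h2 := Complex.sq_norm z
        rw [hz, Complex.normSq_apply, h] at h2
        have : z.im = 0 := by nlinarith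
        exact Complex.ext (by simp [h]) (by simp [this])
    have h1 : Tendsto (fun r : ℝ => 1 - (r : ℂ) * z) (𝓝[<] 1) (𝓝 (1 - z)) := by
      have : Continuous fun r : ℝ => 1 - (r : ℂ) * z := by fun_prop
      have h := (this.tendsto 1).mono_left (nhdsWithin_le_nhds (s := Set.Iio 1))
      simpa using h
    exact h1.mul ((h1.clog hsl).neg)
  have hVe : V = (1 - z) * (-Complex.log (1 - z)) := tendsto_nhds_unique hB hC
  rw [hVe] at hA
  have := hA.const_mul (1 - z)⁻¹
  simpa [inv_mul_cancel_left₀ hz1', ← mul_assoc, inv_mul_cancel₀ hz1'] using this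

end Kummer

namespace Kummer
open Finset Filter Topology

lemma log_one_sub_exp {φ : ℝ} (h0 : 0 < φ) (h1 : φ < 2 * Real.pi) :
    Complex.log (1 - Complex.exp (φ * Complex.I)) =
      (Real.log ‖1 - Complex.exp (φ * Complex.I)‖ : ℝ) + ((φ - Real.pi) / 2 : ℝ) * Complex.I := by
  have hsin : 0 < 2 * Real.sin (φ / 2) := by
    have := Real.sin_pos_of_pos_of_lt_pi (x := φ / 2) (by linarith) (by linarith)
    linarith
  have e : 1 - Complex.exp (φ * Complex.I) =
      ((2 * Real.sin (φ / 2) : ℝ) : ℂ) * Complex.exp (((φ - Real.pi) / 2 : ℝ) * Complex.I) := by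
    have e1 : Complex.exp (((φ - Real.pi) / 2 : ℝ) * Complex.I) =
        Complex.exp ((φ / 2) * Complex.I) * (-Complex.I) := by
      rw [← Complex.exp_neg_pi_div_two_mul_I, ← Complex.exp_add]
      congr 1; push_cast; ring
    have e2 : Complex.exp (φ * Complex.I) = Complex.exp ((φ / 2) * Complex.I) ^ 2 := by
      rw [← Complex.exp_nat_mul]; congr 1; push_cast; ring
    have e3 : ((2 * Real.sin (φ / 2) : ℝ) : ℂ) =
      (Complex.exp (-(φ / 2) * Complex.I) - Complex.exp ((φ / 2) * Complex.I)) * Complex.I := by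
      push_cast
      rw [Complex.two_sin]
    have e4 : Complex.exp (-(φ / 2) * Complex.I) * Complex.exp ((φ / 2) * Complex.I) = 1 := by
      rw [← Complex.exp_add]; simp
    rw [e1, e2, e3]
    generalize Complex.exp ((φ / 2) * Complex.I) = w at *
    generalize Complex.exp (-(φ / 2) * Complex.I) = v at *
    linear_combination -e4 - (w ^ 2 - v * w) * Complex.I_sq
  have hn : ‖1 - Complex.exp (φ * Complex.I)‖ = 2 * Real.sin (φ / 2) := by
    rw [e, norm_mul, Complex.norm_exp_ofReal_mul_I, mul_one, Complex.norm_real, Real.norm_eq_abs,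
      abs_of_pos hsin]
  rw [hn, e, Complex.log_ofReal_mul hsin (Complex.exp_ne_zero _), Complex.log_exp]
  · simp; linarith [Real.pi_pos]
  · simp; linarith [Real.pi_pos]

/-- standard character -/
noncomputable abbrev ψ (p : ℕ) [NeZero p] : AddChar (ZMod p) ℂ := ZMod.stdAddChar

lemma ψ_norm {p : ℕ} [NeZero p] (a : ZMod p) : ‖ψ p a‖ = 1 := by
  rw [ψ, ZMod.stdAddChar_apply]; exact Circle.norm_coe _

lemma ψ_ne_one {p : ℕ} [hp : Fact p.Prime] {a : ZMod p} (ha : a ≠ 0) : ψ p a ≠ 1 := by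
  intro h
  rw [← AddChar.map_zero_eq_one (ψ p)] at h
  exact ha (ZMod.injective_stdAddChar h)

/-- log absolute value -/
noncomputable def ff (p : ℕ) [NeZero p] (a : ZMod p) : ℝ := Real.log ‖1 - ψ p a‖

lemma log_ψ {p : ℕ} [hp : Fact p.Prime] {a : ZMod p} (ha : a ≠ 0) :
    Complex.log (1 - ψ p a) = (ff p a : ℂ) +
      (Real.pi * (a.val / p - 1 / 2) : ℝ) * Complex.I := by
  have hp0 : (0 : ℝ) < p := by exact_mod_cast hp.out.pos
  have hav : 0 < (a.val : ℝ) := by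
    have : a.val ≠ 0 := by rwa [Ne, ZMod.val_eq_zero]
    exact_mod_cast Nat.pos_of_ne_zero this
  have hal : (a.val : ℝ) < p := by exact_mod_cast ZMod.val_lt a
  have e : ψ p a = Complex.exp ((2 * Real.pi * a.val / p : ℝ) * Complex.I) := by
    have := ZMod.stdAddChar_coe (N := p) (a.val : ℤ)
    rw [Int.cast_natCast, ZMod.natCast_zmod_val] at this
    rw [ψ, this]
    congr 1; push_cast; ring
  rw [ff, e, log_one_sub_exp]
  · congr 3
    field_simp
    
  · have := Real.pi_pos
    positivity
  · rw [div_lt_iff₀ hp0]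
    have := Real.pi_pos
    nlinarith

lemma ff_neg {p : ℕ} [hp : Fact p.Prime] (a : ZMod p) : ff p (-a) = ff p a := by
  rw [ff, ff, AddChar.map_neg_eq_conj]
  rw [← Complex.norm_conj (1 - ψ p a)]
  simp

lemma val_neg {p : ℕ} [hp : Fact p.Prime] {a : ZMod p} (ha : a ≠ 0) :
    (((-a).val : ℕ) : ℂ) = p - a.val := by
  have : NeZero a := ⟨ha⟩
  rw [ZMod.val_neg_of_ne_zero, Nat.cast_sub (ZMod.val_lt a).le]

open DirichletCharacter

lemma gauss_expand {p : ℕ} [hp : Fact p.Prime] {χ : DirichletCharacter ℂ p} (hχ : χ ≠ 1)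
    (n : ZMod p) : gaussSum χ⁻¹ (ψ p) * χ n = ∑ a, χ⁻¹ a * ψ p (n * a) := by
  by_cases hn : n = 0
  · subst hn
    have := MulChar.sum_eq_zero_of_ne_one (χ := χ⁻¹) (by simpa using hχ)
    simp [this, MulChar.map_zero]
  · have h := gaussSum_mulShift_eq χ⁻¹ (ψ p) (Units.mk0 n hn)
    simp only [gaussSum, AddChar.mulShift_apply, Units.val_mk0, inv_inv] at h
    rw [h, mul_comm]; rfl

lemma L_one {p : ℕ} [hp : Fact p.Prime] {χ : DirichletCharacter ℂ p} (hχ : χ ≠ 1) :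
    gaussSum χ⁻¹ (ψ p) * LFunction χ 1 = -∑ a, χ⁻¹ a * Complex.log (1 - ψ p a) := by
  have hcont : Tendsto (fun s : ℝ => gaussSum χ⁻¹ (ψ p) * LFunction χ (s : ℂ)) (𝓝[>] 1)
      (𝓝 (gaussSum χ⁻¹ (ψ p) * LFunction χ 1)) := by
    have h1 : Continuous fun s : ℝ => gaussSum χ⁻¹ (ψ p) * LFunction χ (s : ℂ) :=
      continuous_const.mul ((differentiable_LFunction hχ).continuous.comp Complex.continuous_ofReal)
    have := (h1.tendsto 1).mono_left (nhdsWithin_le_nhds (s := Set.Ioi 1))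
    simpa using this
  refine tendsto_nhds_unique hcont ?_
  have h2 : Tendsto (fun s : ℝ => ∑ a : ZMod p, χ⁻¹ a * ∑' n : ℕ, (ψ p a) ^ (n + 1) * cc s n)
      (𝓝[>] 1) (𝓝 (-∑ a, χ⁻¹ a * Complex.log (1 - ψ p a))) := by
    rw [← sum_neg_distrib]
    refine tendsto_finsetSum _ fun a _ => ?_
    by_cases ha : a = 0
    · subst ha; simp [MulChar.map_zero]
    · rw [← mul_neg]
      exact (tendsto_polylog (ψ_norm a) (ψ_ne_one ha)).const_mul _
  refine h2.congr' ?_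
  filter_upwards [self_mem_nhdsWithin] with s hs
  have hs' : 1 < (s : ℂ).re := by simpa using hs
  have hsum0 : Summable fun n : ℕ => ‖cc s n‖ := by
    have h2 := (summable_nat_add_iff 1).2 (Real.summable_nat_rpow.2 (neg_lt_neg hs))
    refine h2.congr fun n => ?_
    rw [cc, Complex.norm_real, Real.norm_eq_abs, abs_of_nonneg (by positivity)]
    push_cast; rfl
  have hsum : ∀ a : ZMod p, Summable fun n : ℕ => (ψ p a) ^ (n + 1) * cc s n := fun a => by
    refine Summable.of_norm (hsum0.congr fun n => ?_)
    rw [norm_mul, norm_pow, ψ_norm, one_pow, one_mul]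
  have hL : LFunction χ s = ∑' n : ℕ, χ ((n + 1 : ℕ) : ZMod p) * cc s n := by
    rw [LFunction_eq_LSeries χ hs', LSeries]
    have hS : Summable (LSeries.term (fun n => χ (n : ZMod p)) s) :=
      ZMod.LSeriesSummable_of_one_lt_re χ hs'
    rw [hS.tsum_eq_zero_add, LSeries.term_zero, zero_add]
    congr 1; funext n
    rw [LSeries.term_of_ne_zero (by omega), div_eq_mul_inv, ← Complex.cpow_neg, cc,
      Complex.ofReal_cpow (by positivity)]
    push_cast; rfl
  rw [hL, ← tsum_mul_left]
  simp_rw [← tsum_mul_left]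
  rw [← Summable.tsum_finsetSum (fun a _ => (hsum a).mul_left _)]
  congr 1; funext n
  rw [← mul_assoc, gauss_expand hχ, sum_mul]
  refine sum_congr rfl fun a _ => ?_
  rw [← AddChar.map_nsmul_eq_pow, nsmul_eq_mul, mul_assoc]

lemma gauss_norm {p : ℕ} [hp : Fact p.Prime] {χ : DirichletCharacter ℂ p} (hχ : χ ≠ 1) :
    ‖gaussSum χ⁻¹ (ψ p)‖ = Real.sqrt p := by
  have h := gaussSum_mul_gaussSum_eq_card (χ := χ⁻¹) (by simpa using hχ)
    (ZMod.isPrimitive_stdAddChar p)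
  rw [← star_gaussSum_eq, ZMod.card] at h
  have h2 : ((‖gaussSum χ⁻¹ (ψ p)‖ ^ 2 : ℝ) : ℂ) = (p : ℂ) := by
    rw [← h]
    exact_mod_cast (Complex.mul_conj' _).symm
  have h3 : ‖gaussSum χ⁻¹ (ψ p)‖ ^ 2 = (p : ℝ) := by exact_mod_cast h2
  rw [← h3, Real.sqrt_sq (norm_nonneg _)]

lemma L_odd {p : ℕ} [hp : Fact p.Prime] {χ : DirichletCharacter ℂ p} (hχ : χ ≠ 1)
    (ho : χ⁻¹ (-1) = -1) :
    Real.sqrt p * ‖LFunction χ 1‖ = Real.pi / p * ‖∑ a : ZMod p, χ⁻¹ a * (a.val : ℂ)‖ := by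
  have hp0 : (p : ℂ) ≠ 0 := by exact_mod_cast hp.out.ne_zero
  rw [← gauss_norm hχ, ← norm_mul, L_one hχ]
  have h1 : ∑ a : ZMod p, χ⁻¹ a * (ff p a : ℂ) = 0 := by
    have : ∑ a : ZMod p, χ⁻¹ a * (ff p a : ℂ) = ∑ a : ZMod p, -(χ⁻¹ a * (ff p a : ℂ)) := by
      refine (Equiv.sum_comp (Equiv.neg (ZMod p)) _).symm.trans (sum_congr rfl fun a _ => ?_)
      simp only [Equiv.neg_apply, ff_neg]
      rw [← neg_one_mul a, map_mul, ho]; ring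
    rw [sum_neg_distrib] at this
    exact self_eq_neg.1 this
  have h2 : ∑ a : ZMod p, χ⁻¹ a = 0 := MulChar.sum_eq_zero_of_ne_one (by simpa using hχ)
  have h3 : ∑ a, χ⁻¹ a * Complex.log (1 - ψ p a) =
      ((Real.pi / p : ℝ) * Complex.I) * ∑ a : ZMod p, χ⁻¹ a * (a.val : ℂ) := by
    have : ∀ a : ZMod p, χ⁻¹ a * Complex.log (1 - ψ p a) = χ⁻¹ a * (ff p a : ℂ) +
        ((Real.pi / p : ℝ) * Complex.I) * (χ⁻¹ a * (a.val : ℂ)) -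
        (Real.pi / 2 * Complex.I) * χ⁻¹ a := by
      intro a
      by_cases ha : a = 0
      · subst ha; simp [MulChar.map_zero]
      · rw [log_ψ ha]; push_cast; field_simp; ring
    simp only [this, sum_sub_distrib, sum_add_distrib, h1, ← mul_sum, h2]
    ring
  rw [h3, norm_neg, norm_mul, norm_mul, Complex.norm_I, mul_one, Complex.norm_real,
    Real.norm_eq_abs, abs_of_nonneg (by have := Real.pi_pos; positivity)]

lemma L_even {p : ℕ} [hp : Fact p.Prime] {χ : DirichletCharacter ℂ p} (hχ : χ ≠ 1)
    (ho : χ⁻¹ (-1) = 1) :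
    Real.sqrt p * ‖LFunction χ 1‖ = ‖∑ a : ZMod p, χ⁻¹ a * (ff p a : ℂ)‖ := by
  have hp0 : (p : ℂ) ≠ 0 := by exact_mod_cast hp.out.ne_zero
  rw [← gauss_norm hχ, ← norm_mul, L_one hχ, norm_neg]
  congr 1
  set R : ZMod p → ℂ := fun a => χ⁻¹ a * ((a.val : ℂ) / p - 1 / 2) with hR
  have h1 : ∑ a : ZMod p, R a = 0 := by
    have : ∑ a : ZMod p, R a = ∑ a : ZMod p, -(R a) := by
      refine (Equiv.sum_comp (Equiv.neg (ZMod p)) _).symm.trans (sum_congr rfl fun a _ => ?_)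
      simp only [Equiv.neg_apply, hR]
      by_cases ha : a = 0
      · subst ha; simp [MulChar.map_zero]
      · rw [val_neg ha, ← neg_one_mul a, map_mul, ho]; field_simp; ring
    rw [sum_neg_distrib] at this
    exact self_eq_neg.1 this
  have : ∀ a : ZMod p, χ⁻¹ a * Complex.log (1 - ψ p a) = χ⁻¹ a * (ff p a : ℂ) +
        (Real.pi * Complex.I) * R a := by
    intro a
    by_cases ha : a = 0
    · subst ha; simp [MulChar.map_zero, hR]
    · rw [log_ψ ha, hR]; push_cast; ring
  simp only [this, sum_add_distrib, ← mul_sum, h1]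
  ring

lemma sum_zmod {p : ℕ} [hp : Fact p.Prime] {M : Type*} [AddCommMonoid M] (F : ZMod p → M)
    (h0 : F 0 = 0) (g : ℕ) (hg : orderOf (g : ZMod p) = p - 1) (h2 : 2 < p) :
    ∑ a, F a = ∑ i ∈ range (p - 1), F ((g : ZMod p) ^ i) := by
  have h1 : ∑ a, F a = ∑ c ∈ range p, F (c : ZMod p) := by
    refine sum_nbij' (fun a => a.val) (fun c => (c : ZMod p)) ?_ ?_ ?_ ?_ ?_
    · intro a _; exact mem_range.2 (ZMod.val_lt a)
    · intro a _; exact mem_univ _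
    · intro a _; simp
    · intro a ha; exact ZMod.val_cast_of_lt (mem_range.1 ha)
    · intro a _; simp
  rw [h1, sum_rr (fun c => F (c : ZMod p)) (by simpa using h0) g hg h2]
  refine sum_congr rfl fun i _ => ?_
  rw [rr_cast]

/-- the sum over half the group -/
noncomputable def SS (p g m : ℕ) [NeZero p] (θ : ℂ) : ℂ :=
  ∑ i ∈ range m, (ff p ((g : ZMod p) ^ i) : ℂ) * θ ^ i

lemma g_pow_m {p m g : ℕ} [hp : Fact p.Prime] (hm : p = 2 * m + 1) (hm0 : 0 < m)
    (hg : orderOf (g : ZMod p) = p - 1) : (g : ZMod p) ^ m = -1 := by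
  have h1 : ((g : ZMod p) ^ m) ^ 2 = 1 := by
    rw [← pow_mul, mul_comm, show 2 * m = p - 1 by omega, ← hg, pow_orderOf_eq_one]
  rcases mul_self_eq_one_iff.1 ((pow_two _).symm.trans h1) with h | h
  · have := orderOf_dvd_of_pow_eq_one h
    rw [hg] at this
    have := Nat.le_of_dvd hm0 this
    omega
  · exact h

theorem P4_odd {p m g : ℕ} [hp : Fact p.Prime] (hm : p = 2 * m + 1) (hm0 : 0 < m)
    (hg : orderOf (g : ZMod p) = p - 1) {χ : DirichletCharacter ℂ p} (hχ : χ ≠ 1)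
    (ho : χ⁻¹ (g : ZMod p) ^ m = -1) :
    ‖LFunction χ 1‖ = Real.pi / (p * Real.sqrt p) * ‖GG p g (χ⁻¹ (g : ZMod p))‖ := by
  rw [← map_pow, g_pow_m hm hm0 hg] at ho
  have h := L_odd hχ ho
  have hs : 0 < Real.sqrt p := Real.sqrt_pos.2 (by exact_mod_cast hp.out.pos)
  rw [sum_zmod (fun a : ZMod p => χ⁻¹ a * (a.val : ℂ)) (by simp) g hg (by omega)] at h
  have : ∑ i ∈ range (p - 1), χ⁻¹ ((g : ZMod p) ^ i) * (((g : ZMod p) ^ i).val : ℂ) =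
      GG p g (χ⁻¹ (g : ZMod p)) := by
    rw [GG]
    refine sum_congr rfl fun i _ => ?_
    have e : ((g : ZMod p) ^ i).val = rr p g i := by
      rw [← rr_cast]; exact ZMod.val_cast_of_lt (Nat.mod_lt _ hp.out.pos)
    rw [e, map_pow, mul_comm]
  rw [this] at h
  have hp0 : (0 : ℝ) < p := by exact_mod_cast hp.out.pos
  field_simp at h ⊢
  linarith

theorem P4_even {p m g : ℕ} [hp : Fact p.Prime] (hm : p = 2 * m + 1) (hm0 : 0 < m)
    (hg : orderOf (g : ZMod p) = p - 1) {χ : DirichletCharacter ℂ p} (hχ : χ ≠ 1)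
    (ho : χ⁻¹ (g : ZMod p) ^ m = 1) :
    ‖LFunction χ 1‖ = 2 / Real.sqrt p * ‖SS p g m (χ⁻¹ (g : ZMod p))‖ := by
  have ho' := ho
  rw [← map_pow, g_pow_m hm hm0 hg] at ho'
  have h := L_even hχ ho'
  have hs : 0 < Real.sqrt p := Real.sqrt_pos.2 (by exact_mod_cast hp.out.pos)
  rw [sum_zmod (fun a : ZMod p => χ⁻¹ a * (ff p a : ℂ)) (by simp [MulChar.map_zero]) g hg
    (by omega)] at h
  have : ∑ i ∈ range (p - 1), χ⁻¹ ((g : ZMod p) ^ i) * (ff p ((g : ZMod p) ^ i) : ℂ) =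
      2 * SS p g m (χ⁻¹ (g : ZMod p)) := by
    rw [show p - 1 = m + m by omega, sum_range_add, SS, two_mul]
    congr 1
    · refine sum_congr rfl fun i _ => ?_
      rw [map_pow, mul_comm]
    · refine sum_congr rfl fun i _ => ?_
      rw [pow_add, g_pow_m hm hm0 hg, neg_one_mul, ff_neg, ← neg_one_mul, map_mul, ho', one_mul,
        map_pow, mul_comm]
  rw [this, norm_mul] at h
  simp only [Complex.norm_ofNat] at h
  field_simp at h ⊢
  linarith

end Kummer

namespace Kummer
open Finset Filter Topology NumberField

section
variable (K : Type*) [Field K] [NumberField K]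

open Ideal in
lemma zeta_summable {s : ℝ} (hs : 1 < s) :
    LSeriesSummable (fun n ↦ ((Nat.card {I : Ideal (𝓞 K) // absNorm I = n} : ℝ) : ℂ)) s := by
  refine LSeriesSummable_of_sum_norm_bigO_and_nonneg (r := 1) ?_ (fun _ => Nat.cast_nonneg _)
    zero_le_one (by simpa using hs)
  refine Asymptotics.isBigO_atTop_natCast_rpow_of_tendsto_div_rpow (a := dedekindZeta_residue K) ?_
  simp only [Real.rpow_one]
  refine ((Ideal.tendsto_norm_le_div_atTop₀ K).comp tendsto_natCast_atTop_atTop).congr fun n ↦ ?_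
  simp only [Function.comp_apply, Nat.cast_le, ← Nat.cast_sum]
  congr
  rw [← add_left_inj 1, ← card_norm_le_eq_card_norm_le_add_one,
    show Finset.Icc 1 n = Finset.Ioc 0 n from Finset.Icc_succ_left_eq_Ioc _ _,
    show 1 = Nat.card {I : Ideal (𝓞 K) // absNorm I = 0} by simp [Ideal.absNorm_eq_zero_iff],
    Finset.sum_Ioc_add_eq_sum_Icc (n.zero_le),
    ← Finset.card_preimage_eq_sum_card_image_eq (fun k _ ↦ finite_setOfPred_absNorm_eq k)]
  simp [Set.coe_eq_subtype]

/-- norm to the minus s -/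
noncomputable def fI (s : ℝ) (I : Ideal (𝓞 K)) : ℝ := (Ideal.absNorm I : ℝ) ^ (-s)

variable {K}

lemma fI_nonneg (s : ℝ) (I : Ideal (𝓞 K)) : 0 ≤ fI K s I := by unfold fI; positivity

lemma fI_mul (s : ℝ) (I J : Ideal (𝓞 K)) : fI K s (I * J) = fI K s I * fI K s J := by
  unfold fI
  rw [map_mul, Nat.cast_mul, Real.mul_rpow (by positivity) (by positivity)]

lemma fI_one (s : ℝ) : fI K s 1 = 1 := by simp [fI]

lemma fI_bot {s : ℝ} (hs : 1 < s) : fI K s ⊥ = 0 := by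
  unfold fI
  rw [Ideal.absNorm_bot, Nat.cast_zero, Real.zero_rpow (by linarith)]

lemma fI_hasSum {s : ℝ} (hs : 1 < s) :
    ∃ Z : ℝ, HasSum (fI K s) Z ∧ dedekindZeta K s = Z := by
  have hS := zeta_summable K hs
  have e : ∀ n : ℕ, LSeries.term
      (fun n ↦ ((Nat.card {I : Ideal (𝓞 K) // Ideal.absNorm I = n} : ℝ) : ℂ)) s n =
      ((Nat.card {I : Ideal (𝓞 K) // Ideal.absNorm I = n} * (n : ℝ) ^ (-s) : ℝ) : ℂ) := by
    intro n
    rcases eq_or_ne n 0 with rfl | hn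
    · rw [LSeries.term_zero, Nat.cast_zero, Real.zero_rpow (by linarith)]; simp
    · rw [LSeries.term_of_ne_zero hn, Real.rpow_neg (by positivity), Complex.ofReal_mul,
        Complex.ofReal_inv, Complex.ofReal_cpow (by positivity), div_eq_mul_inv]
      simp
  rw [LSeriesSummable, funext e] at hS
  have hS' := Complex.summable_ofReal.1 hS
  have fib : ∀ n : ℕ, HasSum (fun I : {I : Ideal (𝓞 K) // Ideal.absNorm I = n} => fI K s I.1)
      (Nat.card {I : Ideal (𝓞 K) // Ideal.absNorm I = n} * (n : ℝ) ^ (-s)) := by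
    intro n
    have : Finite {I : Ideal (𝓞 K) // Ideal.absNorm I = n} := Ideal.finite_setOfPred_absNorm_eq n
    have := Fintype.ofFinite {I : Ideal (𝓞 K) // Ideal.absNorm I = n}
    have h := hasSum_fintype (fun I : {I : Ideal (𝓞 K) // Ideal.absNorm I = n} => fI K s I.1)
    have h2 : ∑ I : {I : Ideal (𝓞 K) // Ideal.absNorm I = n}, fI K s I.1 =
      (Nat.card {I : Ideal (𝓞 K) // Ideal.absNorm I = n} * (n : ℝ) ^ (-s)) := by
      rw [Finset.sum_congr rfl (g := fun _ => (n : ℝ) ^ (-s)) (fun I _ => by rw [fI, I.2])]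
      simp [Nat.card_eq_fintype_card]
    rwa [h2] at h
  have hsig : Summable (fun x : (Σ n : ℕ, {I : Ideal (𝓞 K) // Ideal.absNorm I = n}) =>
      fI K s x.2.1) := by
    rw [summable_sigma_of_nonneg (fun x => fI_nonneg _ _)]
    refine ⟨fun n => (fib n).summable, ?_⟩
    convert hS' using 2 with n
    exact (fib n).tsum_eq
  have hf : Summable (fI K s) :=
    ((Equiv.sigmaFiberEquiv (fun I : Ideal (𝓞 K) => Ideal.absNorm I)).summable_iff).1 hsig
  refine ⟨_, hf.hasSum, ?_⟩
  have h1 := ((Equiv.sigmaFiberEquiv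
    (fun I : Ideal (𝓞 K) => Ideal.absNorm I)).hasSum_iff.2 hf.hasSum).sigma fib
  rw [dedekindZeta, LSeries]
  rw [← h1.tsum_eq, Complex.ofReal_tsum]
  refine tsum_congr fun n => ?_
  rw [← e n]
  simp

open Classical in
/-- truncated -/
noncomputable def gT (s : ℝ) (T : Finset (Ideal (𝓞 K))) (I : Ideal (𝓞 K)) : ℝ :=
  if ∀ P ∈ T, ¬ P ∣ I then fI K s I else 0

lemma gT_nonneg (s : ℝ) (T) (I : Ideal (𝓞 K)) : 0 ≤ gT s T I := by
  unfold gT; split_ifs; exacts [fI_nonneg _ _, le_rfl]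

lemma gT_le (s : ℝ) (T) (I : Ideal (𝓞 K)) : gT s T I ≤ fI K s I := by
  unfold gT; split_ifs; exacts [le_rfl, fI_nonneg _ _]

lemma gT_summable {s : ℝ} (hs : 1 < s) (T) : Summable (gT (K := K) s T) := by
  obtain ⟨Z, hZ, -⟩ := fI_hasSum (K := K) hs
  exact hZ.summable.of_nonneg_of_le (gT_nonneg s T) (gT_le s T)

lemma gT_step {s : ℝ} (hs : 1 < s) {P : Ideal (𝓞 K)} {T : Finset (Ideal (𝓞 K))}
    (hT : ∀ Q ∈ insert P T, Prime Q) (hP : P ∉ T) :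
    ∑' I, gT s (insert P T) I = (1 - fI K s P) * ∑' I, gT s T I := by
  classical
  have hPp := hT P (mem_insert_self _ _)
  have h1 := (gT_summable (K := K) hs T).tsum_sub (gT_summable (K := K) hs (insert P T))
  have hinj : Function.Injective (fun J : Ideal (𝓞 K) => P * J) := fun a b h =>
    mul_left_cancel₀ hPp.ne_zero h
  have h2 := hinj.tsum_eq (f := fun I => gT s T I - gT s (insert P T) I) (by
    intro I hI
    rw [Function.mem_support] at hI
    by_contra hne
    have : ¬ P ∣ I := fun ⟨J, hJ⟩ => hne ⟨J, hJ.symm⟩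
    apply hI
    unfold gT
    have : (∀ Q ∈ insert P T, ¬ Q ∣ I) ↔ (∀ Q ∈ T, ¬ Q ∣ I) := by simp [this]
    simp only [this, sub_self])
  have h3 : ∀ J, gT s T (P * J) - gT s (insert P T) (P * J) = fI K s P * gT s T J := by
    intro J
    have e1 : gT s (insert P T) (P * J) = 0 := by
      unfold gT
      rw [if_neg]
      intro h
      exact h P (mem_insert_self _ _) (dvd_mul_right _ _)
    have e2 : (∀ Q ∈ T, ¬ Q ∣ P * J) ↔ (∀ Q ∈ T, ¬ Q ∣ J) := by
      refine forall₂_congr fun Q hQ => not_congr ⟨fun h => ?_, fun h => h.mul_left _⟩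
      have hQp := hT Q (mem_insert_of_mem hQ)
      rcases hQp.dvd_or_dvd h with h | h
      · have := (hQp.irreducible.dvd_irreducible_iff_associated hPp.irreducible).1 h
        rw [associated_iff_eq] at this
        exact absurd (this ▸ hQ) hP
      · exact h
    rw [e1, sub_zero]
    unfold gT
    simp only [e2, fI_mul]
    split_ifs <;> simp
  simp only [h3] at h2
  rw [← h2, tsum_mul_left] at h1
  linarith

lemma gT_prod {s : ℝ} (hs : 1 < s) (T : Finset (Ideal (𝓞 K))) (hT : ∀ Q ∈ T, Prime Q) :
    ∑' I, gT s T I = (∏ P ∈ T, (1 - fI K s P)) * ∑' I, fI K s I := by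
  classical
  induction T using Finset.induction with
  | empty => simp [gT]
  | insert P T hP ih =>
    rw [gT_step hs hT hP, ih (fun Q hQ => hT Q (mem_insert_of_mem hQ)), prod_insert hP, mul_assoc]

lemma gT_tendsto {s : ℝ} (hs : 1 < s) (T : ℕ → Finset (Ideal (𝓞 K)))
    (hT : ∀ n, ∀ Q ∈ T n, Prime Q) (hT2 : ∀ Q : Ideal (𝓞 K), Prime Q → ∀ᶠ n in atTop, Q ∈ T n) :
    Tendsto (fun n => (∏ P ∈ T n, (1 - fI K s P)) * ∑' I, fI K s I) atTop (𝓝 1) := by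
  classical
  have h1 : Tendsto (fun n => ∑' I, gT s (T n) I) atTop
      (𝓝 (∑' I : Ideal (𝓞 K), if I = 1 then (1 : ℝ) else 0)) := by
    obtain ⟨Z, hZ, -⟩ := fI_hasSum (K := K) hs
    refine tendsto_tsum_of_dominated_convergence hZ.summable (fun I => ?_)
      (Eventually.of_forall fun n I => ?_)
    · by_cases hI : I = 1
      · rw [if_pos hI]
        refine tendsto_const_nhds.congr fun n => ?_
        rw [hI, gT, if_pos, fI_one]
        intro P hP h1
        exact (hT n P hP).not_isUnit (isUnit_of_dvd_one h1)
      · rw [if_neg hI]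
        by_cases hI0 : I = ⊥
        · refine tendsto_const_nhds.congr fun n => ?_
          rw [hI0]
          exact le_antisymm (gT_nonneg _ _ _) ((gT_le _ _ _).trans (fI_bot hs).le)
        · obtain ⟨Q, hQ, hQI⟩ := WfDvdMonoid.exists_irreducible_factor
            (a := I) (by rwa [Ideal.isUnit_iff, ← Ideal.one_eq_top]) hI0
          refine tendsto_const_nhds.congr' ?_
          filter_upwards [hT2 Q hQ.prime] with n hn
          rw [gT, if_neg]
          push Not
          exact ⟨Q, hn, hQI⟩
    · rw [Real.norm_eq_abs, abs_of_nonneg (gT_nonneg _ _ _)]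
      exact gT_le _ _ _
  rw [tsum_ite_eq] at h1
  exact h1.congr fun n => gT_prod hs _ (hT n)

end

end Kummer

namespace Kummer
open Finset Filter Topology NumberField Polynomial

lemma isPrim {p g : ℕ} (hg : orderOf (g : ZMod p) = p - 1) : IsPrimitiveRoot (g : ZMod p) (p - 1) := by
  rw [← hg]; exact IsPrimitiveRoot.orderOf _

lemma char_inj {p g : ℕ} [hp : Fact p.Prime] (hg : orderOf (g : ZMod p) = p - 1)
    {χ χ' : DirichletCharacter ℂ p} (h : χ (g : ZMod p) = χ' (g : ZMod p)) : χ = χ' := by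
  have : NeZero (p - 1) := ⟨by have := hp.out.two_le; omega⟩
  ext a
  obtain ⟨i, -, hi⟩ := (isPrim hg).eq_pow_of_pow_eq_one (ξ := (a : ZMod p))
    (ZMod.pow_card_sub_one_eq_one a.ne_zero)
  rw [← hi, map_pow, map_pow, h]

lemma char_pow {p g : ℕ} [hp : Fact p.Prime] (hg : orderOf (g : ZMod p) = p - 1)
    (χ : DirichletCharacter ℂ p) : χ (g : ZMod p) ^ (p - 1) = 1 := by
  rw [← map_pow, ← hg, pow_orderOf_eq_one, map_one]

lemma prod_char {M : Type*} [CommMonoid M] {p g : ℕ} [hp : Fact p.Prime]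
    (hg : orderOf (g : ZMod p) = p - 1) (F : ℂ → M) :
    ∏ χ : DirichletCharacter ℂ p, F (χ (g : ZMod p)) =
      ∏ θ ∈ nthRootsFinset (p - 1) (1 : ℂ), F θ := by
  classical
  have h0 : 0 < p - 1 := by have := hp.out.two_le; omega
  have himg : (univ : Finset (DirichletCharacter ℂ p)).image (fun χ => χ (g : ZMod p)) =
      nthRootsFinset (p - 1) (1 : ℂ) := by
    apply eq_of_subset_of_card_le
    · intro θ hθ
      obtain ⟨χ, -, rfl⟩ := mem_image.1 hθ
      rw [mem_nthRootsFinset h0]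
      exact char_pow hg χ
    · rw [card_image_of_injective _ (fun a b h => char_inj hg h), card_univ,
        ← Nat.card_eq_fintype_card, DirichletCharacter.card_eq_totient_of_hasEnoughRootsOfUnity,
        Nat.totient_prime hp.out, (Complex.isPrimitiveRoot_exp _ h0.ne').card_nthRootsFinset]
  rw [← himg, prod_image (fun a _ b _ h => char_inj hg h)]

lemma prod_nthRoots {M : Type*} [CommMonoid M] {n : ℕ} (hn : 0 < n) {ω : ℂ}
    (hω : IsPrimitiveRoot ω n) (F : ℂ → M) :
    ∏ θ ∈ nthRootsFinset n (1 : ℂ), F θ = ∏ i ∈ range n, F (ω ^ i) := by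
  classical
  have himg : (range n).image (fun i => ω ^ i) = nthRootsFinset n (1 : ℂ) := by
    apply eq_of_subset_of_card_le
    · intro θ hθ
      obtain ⟨i, -, rfl⟩ := mem_image.1 hθ
      rw [mem_nthRootsFinset hn, ← pow_mul, mul_comm, pow_mul, hω.pow_eq_one, one_pow]
    · rw [card_image_of_injOn hω.injOn_pow, hω.card_nthRootsFinset, card_range]
  rw [← himg, prod_image hω.injOn_pow]

lemma prod_range_periodic {M : Type*} [CommMonoid M] (F : ℕ → M) (f c : ℕ)
    (hF : ∀ i, F (i + f) = F i) : ∏ i ∈ range (f * c), F i = (∏ i ∈ range f, F i) ^ c := by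
  have hF' : ∀ c i, F (f * c + i) = F i := by
    intro c
    induction c with
    | zero => simp
    | succ c ih => intro i; rw [show f * (c + 1) + i = f * c + i + f by ring, hF, ih]
  induction c with
  | zero => simp
  | succ c ih =>
    rw [Nat.mul_succ, prod_range_add, ih, pow_succ]
    simp only [hF']

lemma prod_char_local {p g : ℕ} [hp : Fact p.Prime] (hg : orderOf (g : ZMod p) = p - 1)
    {q : ZMod p} (hq : q ≠ 0) (x : ℂ) :
    orderOf q ∣ p - 1 ∧
    ∏ χ : DirichletCharacter ℂ p, (1 - χ q * x) = (1 - x ^ orderOf q) ^ ((p - 1) / orderOf q) := by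
  have h0 : 0 < p - 1 := by have := hp.out.two_le; omega
  have : NeZero (p - 1) := ⟨h0.ne'⟩
  obtain ⟨a, -, ha⟩ := (isPrim hg).eq_pow_of_pow_eq_one (ξ := q)
    (ZMod.pow_card_sub_one_eq_one hq)
  have hdvd : orderOf q ∣ p - 1 := orderOf_dvd_of_pow_eq_one (ZMod.pow_card_sub_one_eq_one hq)
  refine ⟨hdvd, ?_⟩
  obtain ⟨ω, hω⟩ : ∃ ω : ℂ, IsPrimitiveRoot ω (p - 1) := ⟨_, Complex.isPrimitiveRoot_exp _ h0.ne'⟩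
  have h1 := prod_char hg (fun θ => 1 - θ ^ a * x)
  simp only [← map_pow, ha] at h1
  rw [h1, prod_nthRoots h0 hω]
  have hord : orderOf (ω ^ a) = orderOf q := by
    rw [← ha, IsOfFinOrder.orderOf_pow, IsOfFinOrder.orderOf_pow, hg, ← hω.eq_orderOf]
    · exact orderOf_pos_iff.1 (hg ▸ h0)
    · exact orderOf_pos_iff.1 (hω.eq_orderOf ▸ h0)
  have hη : IsPrimitiveRoot (ω ^ a) (orderOf q) := hord ▸ IsPrimitiveRoot.orderOf _
  have hf0 : 0 < orderOf q := Nat.pos_of_dvd_of_pos hdvd h0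
  obtain ⟨c, hc⟩ := hdvd
  rw [hc, Nat.mul_div_cancel_left _ hf0]
  have e : ∀ i, 1 - (ω ^ i) ^ a * x = 1 - (ω ^ a) ^ i * x := fun i => by
    rw [← pow_mul, ← pow_mul, mul_comm i]
  simp only [e]
  rw [prod_range_periodic _ _ _ (fun i => by rw [pow_add, hη.pow_eq_one, mul_one])]
  rw [← prod_nthRoots hf0 hη (fun θ => 1 - θ * x),
    ← hη.pow_sub_pow_eq_prod_sub_mul 1 x hf0, one_pow]

section
variable {p : ℕ} [hp : Fact p.Prime] (K : Type*) [Field K] [NumberField K]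
  [hK : IsCyclotomicExtension {p} ℚ K]

/-- primes over q -/
noncomputable abbrev TT (q : ℕ) : Finset (Ideal (𝓞 K)) :=
  IsDedekindDomain.primesOverFinset (Ideal.span {(q : ℤ)}) (𝓞 K)

variable {K}
lemma mem_TT {q : ℕ} (hq : q.Prime) {P : Ideal (𝓞 K)} :
    P ∈ TT K q ↔ P.IsPrime ∧ P.LiesOver (Ideal.span {(q : ℤ)}) := by
  have : Fact q.Prime := ⟨hq⟩
  have : (Ideal.span {(q : ℤ)}).IsMaximal := Int.ideal_span_isMaximal_of_prime q
  rw [IsDedekindDomain.mem_primesOverFinset_iff (by simpa using hq.ne_zero)]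
  rfl

variable (K) in
lemma card_TT {q : ℕ} (hq : q.Prime) :
    (TT K q).card = ((Ideal.span {(q : ℤ)}).primesOver (𝓞 K)).ncard := by
  have : Fact q.Prime := ⟨hq⟩
  have : (Ideal.span {(q : ℤ)}).IsMaximal := Int.ideal_span_isMaximal_of_prime q
  rw [← IsDedekindDomain.coe_primesOverFinset (by simpa using hq.ne_zero), Set.ncard_coe_finset]

variable (p K) in
lemma local_p (s : ℝ) : ∏ P ∈ TT K p, (1 - fI K s P) = 1 - (p : ℝ) ^ (-s) := by
  have hc := card_TT K hp.out
  rw [IsCyclotomicExtension.Rat.ncard_primesOver_of_prime p K] at hc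
  rw [prod_congr rfl (g := fun _ => 1 - (p : ℝ) ^ (-s))]
  · rw [prod_const, hc, pow_one]
  · intro P hP
    obtain ⟨h1, h2⟩ := (mem_TT hp.out).1 hP
    have : (Ideal.span {(p : ℤ)}).IsMaximal := Int.ideal_span_isMaximal_of_prime p
    have : P.IsMaximal := Ideal.IsMaximal.of_liesOver_isMaximal P (Ideal.span {(p : ℤ)})
    rw [fI, Ideal.absNorm_eq_pow_inertiaDeg' P hp.out, Ideal.inertiaDeg'_eq_inertiaDeg,
      IsCyclotomicExtension.Rat.inertiaDeg_eq_of_prime p K P, pow_one]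

variable (p K) in
lemma local_q {q : ℕ} (hq : q.Prime) (hqp : q ≠ p) (s : ℝ) : ∏ P ∈ TT K q, (1 - fI K s P) =
    (1 - ((q : ℝ) ^ (-s)) ^ orderOf (q : ZMod p)) ^ ((p - 1) / orderOf (q : ZMod p)) := by
  have : Fact q.Prime := ⟨hq⟩
  have hd : ¬ q ∣ p := fun h => hqp ((Nat.prime_dvd_prime_iff_eq hq hp.out).1 h)
  have hc := card_TT K hq
  have : IsGalois ℚ K := IsCyclotomicExtension.isGalois {p} ℚ K
  have : (Ideal.span {(q : ℤ)}).IsMaximal := Int.ideal_span_isMaximal_of_prime q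
  have h3 := Ideal.ncard_primesOver_mul_ramificationIdxIn_mul_inertiaDegIn
    (Ideal.span {(q : ℤ)}) (𝓞 K) Gal(K/ℚ)
  rw [← hc, IsCyclotomicExtension.Rat.ramificationIdxIn_eq_of_not_dvd q K hd,
    IsCyclotomicExtension.Rat.inertiaDegIn_eq_of_not_dvd q K hd, one_mul,
    IsGalois.card_aut_eq_finrank, IsCyclotomicExtension.finrank (n := p) K
      (Polynomial.cyclotomic.irreducible_rat hp.out.pos), Nat.totient_prime hp.out] at h3
  have h0 : 0 < p - 1 := by have := hp.out.two_le; omega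
  have hcard : (TT K q).card = (p - 1) / orderOf (q : ZMod p) := by
    rw [← h3, Nat.mul_div_cancel _ (Nat.pos_of_ne_zero (by rintro h; rw [h] at h3; omega))]
  rw [prod_congr rfl (g := fun _ => 1 - ((q : ℝ) ^ (-s)) ^ orderOf (q : ZMod p))]
  · rw [prod_const, hcard]
  · intro P hP
    obtain ⟨h1, h2⟩ := (mem_TT hq).1 hP
    have : P.IsMaximal := Ideal.IsMaximal.of_liesOver_isMaximal P (Ideal.span {(q : ℤ)})
    rw [fI, Ideal.absNorm_eq_pow_inertiaDeg' P hq, Ideal.inertiaDeg'_eq_inertiaDeg,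
      IsCyclotomicExtension.Rat.inertiaDeg_eq_of_not_dvd q K P hd, Nat.cast_pow,
      ← Real.rpow_natCast, ← Real.rpow_natCast, ← Real.rpow_mul (by positivity),
      ← Real.rpow_mul (by positivity), mul_comm]

end

end Kummer

namespace Kummer
open Finset Filter Topology NumberField Polynomial

section
variable {p : ℕ} [hp : Fact p.Prime] {K : Type*} [Field K] [NumberField K]

lemma TT_prime {q : ℕ} (hq : q.Prime) {P : Ideal (𝓞 K)} (hP : P ∈ TT K q) : Prime P := by
  obtain ⟨h1, h2⟩ := (mem_TT hq).1 hP
  have h0 : (Ideal.span {(q : ℤ)}) ≠ ⊥ := by simpa using hq.ne_zero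
  exact Ideal.prime_of_isPrime (Ideal.ne_bot_of_liesOver_of_ne_bot h0 P) h1

lemma exists_TT {P : Ideal (𝓞 K)} (hP : Prime P) : ∃ q : ℕ, q.Prime ∧ P ∈ TT K q := by
  have h1 : P.IsPrime := Ideal.isPrime_of_prime hP
  have h2 : P.IsMaximal := h1.isMaximal hP.ne_zero
  obtain ⟨q, n, -, hqP, hq, -⟩ := Ideal.exists_prime_and_absNorm_eq_pow P
  refine ⟨q, hq, (mem_TT hq).2 ⟨h1, ⟨?_⟩⟩⟩
  have : Fact q.Prime := ⟨hq⟩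
  have : (Ideal.span {(q : ℤ)}).IsMaximal := Int.ideal_span_isMaximal_of_prime q
  refine this.eq_of_le (Ideal.IsPrime.under ℤ P).ne_top ?_
  rw [Ideal.span_singleton_le_iff_mem, Ideal.mem_comap]
  simpa using hqP

lemma TT_disj {q q' : ℕ} (hq : q.Prime) (hq' : q'.Prime) (h : q ≠ q') :
    Disjoint (TT K q) (TT K q') := by
  rw [Finset.disjoint_left]
  intro P hP hP'
  obtain ⟨-, ⟨h2⟩⟩ := (mem_TT hq).1 hP
  obtain ⟨-, ⟨h2'⟩⟩ := (mem_TT hq').1 hP'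
  rw [← h2', Ideal.span_singleton_eq_span_singleton] at h2
  apply h
  have := Int.associated_iff_natAbs.1 h2
  simpa using this

variable (p K) [hK : IsCyclotomicExtension {p} ℚ K]

lemma zeta_eq {g : ℕ} (hg : orderOf (g : ZMod p) = p - 1) {s : ℝ} (hs : 1 < s) :
    dedekindZeta K s * (1 - (p : ℂ) ^ (-s : ℂ)) =
      ∏ χ : DirichletCharacter ℂ p, DirichletCharacter.LFunction χ s := by
  classical
  obtain ⟨Z, hZ, hZ'⟩ := fI_hasSum (K := K) hs
  have hs' : 1 < (s : ℂ).re := by simpa using hs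
  have h1 := gT_tendsto (K := K) hs (fun n => (Nat.primesBelow n).biUnion (TT K))
    (by
      intro n Q hQ
      obtain ⟨q, hq, hQ⟩ := mem_biUnion.1 hQ
      exact TT_prime (Nat.prime_of_mem_primesBelow hq) hQ)
    (by
      intro Q hQ
      obtain ⟨q, hq, hQq⟩ := exists_TT hQ
      filter_upwards [eventually_gt_atTop q] with n hn
      exact mem_biUnion.2 ⟨q, Nat.mem_primesBelow.2 ⟨hn, hq⟩, hQq⟩)
  rw [hZ.tsum_eq] at h1
  have hbi : ∀ n, ∏ P ∈ (Nat.primesBelow n).biUnion (TT K), (1 - fI K s P) =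
      ∏ q ∈ Nat.primesBelow n, ∏ P ∈ TT K q, (1 - fI K s P) := fun n =>
    prod_biUnion fun q hq q' hq' h => TT_disj (Nat.prime_of_mem_primesBelow hq)
      (Nat.prime_of_mem_primesBelow hq') h
  simp only [hbi] at h1
  -- local identity
  have hloc : ∀ q : ℕ, q.Prime → ((∏ P ∈ TT K q, (1 - fI K s P) : ℝ) : ℂ) *
      ∏ χ : DirichletCharacter ℂ p, (1 - χ q * (q : ℂ) ^ (-s : ℂ))⁻¹ =
        if q = p then (1 - (p : ℂ) ^ (-s : ℂ)) else 1 := by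
    intro q hq
    have hcast : ((q : ℂ) ^ (-s : ℂ)) = (((q : ℝ) ^ (-s) : ℝ) : ℂ) := by
      rw [Complex.ofReal_cpow (by positivity)]; simp
    split_ifs with hqp
    · subst hqp
      rw [local_p q K, hcast]
      have : ∀ χ : DirichletCharacter ℂ q, χ (q : ZMod q) = 0 := fun χ => by
        rw [ZMod.natCast_self]; exact MulChar.map_zero χ
      simp only [this, zero_mul, sub_zero, inv_one, prod_const_one, mul_one]
      push_cast
      rfl
    · rw [local_q p K hq hqp]
      have hq0 : (q : ZMod p) ≠ 0 := by
        rw [Ne, ZMod.natCast_eq_zero_iff]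
        exact fun h => hqp ((Nat.prime_dvd_prime_iff_eq hp.out hq).1 h).symm
      obtain ⟨hd, he⟩ := prod_char_local hg hq0 ((q : ℂ) ^ (-s : ℂ))
      rw [prod_inv_distrib, he, hcast]
      push_cast
      apply mul_inv_cancel₀
      apply pow_ne_zero
      rw [sub_ne_zero]
      have hlt : ((q : ℝ) ^ (-s)) < 1 := Real.rpow_lt_one_of_one_lt_of_neg
        (by exact_mod_cast hq.one_lt) (by linarith)
      have : ((q : ℝ) ^ (-s)) ^ orderOf (q : ZMod p) < 1 := by
        refine pow_lt_one₀ (by positivity) hlt ?_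
        rintro h0
        rw [h0, zero_dvd_iff] at hd
        have := hp.out.two_le
        omega
      intro h
      have : ((q : ℝ) ^ (-s)) ^ orderOf (q : ZMod p) = 1 := by exact_mod_cast h.symm
      linarith
  have h2 := tendsto_finsetProd (univ : Finset (DirichletCharacter ℂ p))
    (fun χ _ => DirichletCharacter.LSeries_eulerProduct χ hs')
  have h3 := ((Complex.continuous_ofReal.tendsto _).comp h1).mul h2
  have h4 : Tendsto (fun n : ℕ => (1 - (p : ℂ) ^ (-s : ℂ)) * (Z : ℂ)) atTop
      (𝓝 (((1 : ℝ) : ℂ) * ∏ χ : DirichletCharacter ℂ p, LSeries (fun n => χ n) s)) := by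
    refine h3.congr' ?_
    filter_upwards [eventually_gt_atTop p] with n hn
    simp only [Function.comp_apply]
    rw [Finset.prod_comm, Complex.ofReal_mul, mul_right_comm, Complex.ofReal_prod, ← prod_mul_distrib,
      prod_congr rfl (fun q hq => hloc q (Nat.prime_of_mem_primesBelow hq)), prod_ite_eq',
      if_pos (Nat.mem_primesBelow.2 ⟨hn, hp.out⟩)]
  have h5 := tendsto_nhds_unique tendsto_const_nhds h4
  rw [hZ', mul_comm, h5, Complex.ofReal_one, one_mul]
  exact prod_congr rfl fun χ _ => (DirichletCharacter.LFunction_eq_LSeries χ hs').symm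

theorem residue_eq {g : ℕ} (hg : orderOf (g : ZMod p) = p - 1) :
    (dedekindZeta_residue K : ℂ) =
      ∏ χ ∈ (univ : Finset (DirichletCharacter ℂ p)).erase 1, DirichletCharacter.LFunction χ 1 := by
  classical
  have hp1 : (1 : ℝ) < p := by exact_mod_cast hp.out.one_lt
  have hc : Tendsto (fun s : ℝ => (s : ℂ)) (𝓝[>] 1) (𝓝 1) := by
    have : Tendsto (fun s : ℝ => (s : ℂ)) (𝓝 1) (𝓝 ((1 : ℝ) : ℂ)) :=
      Complex.continuous_ofReal.tendsto _
    simpa using this.mono_left nhdsWithin_le_nhds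
  have hc' : Tendsto (fun s : ℝ => (s : ℂ)) (𝓝[>] 1) (𝓝[≠] 1) := by
    refine tendsto_nhdsWithin_iff.2 ⟨hc, ?_⟩
    filter_upwards [self_mem_nhdsWithin] with s hs
    rw [Set.mem_compl_iff, Set.mem_singleton_iff]
    intro h
    rw [Set.mem_Ioi] at hs
    exact hs.ne' (by exact_mod_cast h)
  have h1 := tendsto_sub_one_mul_dedekindZeta_nhdsGT K
  have hpz : (p : ℂ) ≠ 0 := by exact_mod_cast hp.out.ne_zero
  have h2 : Tendsto (fun s : ℝ => 1 - (p : ℂ) ^ (-s : ℂ)) (𝓝[>] 1) (𝓝 (1 - (p : ℂ)⁻¹)) := by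
    have : Continuous (fun s : ℂ => 1 - (p : ℂ) ^ (-s)) := by
      refine continuous_const.sub (Continuous.const_cpow continuous_neg (Or.inl hpz))
    have := (this.tendsto 1).comp hc
    simpa [Complex.cpow_neg_one, Function.comp_def] using this
  have h3 := h1.mul h2
  have h4 : Tendsto (fun s : ℝ => ((s : ℂ) - 1) * DirichletCharacter.LFunctionTrivChar p s) (𝓝[>] 1)
      (𝓝 (1 - (p : ℂ)⁻¹)) := by
    have := (DirichletCharacter.LFunctionTrivChar_residue_one (N := p)).comp hc'
    rw [hp.out.primeFactors, prod_singleton] at this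
    exact this
  have h5 := tendsto_finsetProd ((univ : Finset (DirichletCharacter ℂ p)).erase 1)
    (fun χ hχ => ((DirichletCharacter.differentiable_LFunction
      (mem_erase.1 hχ).1).continuous.tendsto 1).comp hc)
  have h6 := h4.mul h5
  have h7 := tendsto_nhds_unique (h3.congr' (f₂ := fun s : ℝ =>
    (s - 1) * DirichletCharacter.LFunctionTrivChar p s *
      ∏ χ ∈ (univ : Finset (DirichletCharacter ℂ p)).erase 1,
        DirichletCharacter.LFunction χ s) (by
    filter_upwards [self_mem_nhdsWithin] with s hs
    rw [mul_assoc, zeta_eq p K hg hs, mul_assoc, ← mul_prod_erase _ _ (mem_univ 1)])) h6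
  rw [mul_comm] at h7
  refine mul_left_cancel₀ ?_ h7
  rw [sub_ne_zero]
  intro h
  have : (p : ℂ) = 1 := by
    rw [← inv_inv (p : ℂ), ← h, inv_one]
  have : p = 1 := by exact_mod_cast this
  exact hp.out.ne_one this

end

end Kummer

namespace Kummer
open Finset

lemma sum_shift {M : Type*} [AddCommGroup M] (F : ℕ → M) (m : ℕ) (hF : ∀ i, F (i + m) = F i) (k : ℕ) :
    ∑ j ∈ range m, F (j + k) = ∑ j ∈ range m, F j := by
  induction k with
  | zero => simp
  | succ k ih =>
    have h1 := sum_range_succ (fun j => F (j + k)) m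
    have h2 := sum_range_succ' (fun j => F (j + k)) m
    rw [h1, ih, zero_add, add_comm m k, hF, add_left_inj] at h2
    rw [h2]
    refine sum_congr rfl fun j _ => ?_
    congr 1; ring

lemma det_row_zero {n : ℕ} (A B : Matrix (Fin (n + 1)) (Fin (n + 1)) ℂ) (h0 : A 0 0 = B 0 0)
    (hA : ∀ i : Fin n, A i.succ 0 = 0) (h : ∀ (i : Fin n) (j : Fin (n + 1)), A i.succ j = B i.succ j) :
    A.det = B.det := by
  rw [Matrix.det_succ_column_zero, Matrix.det_succ_column_zero, Fin.sum_univ_succ, Fin.sum_univ_succ]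
  have hB : ∀ i : Fin n, B i.succ 0 = 0 := fun i => by rw [← h, hA]
  simp only [hA, hB, h0]
  simp only [mul_zero, zero_mul, sum_const_zero, add_zero]
  congr 2
  ext i j
  simp [h]

lemma det_circ (n : ℕ) (f : ℕ → ℝ) (hf : ∀ i, f (i + (n + 1)) = f i) {ω : ℂ}
    (hω : IsPrimitiveRoot ω (n + 1)) :
    |(Matrix.of fun i j : Fin (n + 1) => if i = 0 then (2 : ℝ) else
      2 * (f (j.val + i.val) - f j.val)).det| =
      2 * (n + 1) * ∏ l : Fin n, (2 * ‖∑ j ∈ range (n + 1), (f j : ℂ) * (ω ^ (l.val + 1)) ^ j‖) := by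
  set B : Matrix (Fin (n + 1)) (Fin (n + 1)) ℝ := Matrix.of fun i j : Fin (n + 1) =>
    if i = 0 then (2 : ℝ) else 2 * (f (j.val + i.val) - f j.val) with hB
  let X : Matrix (Fin (n + 1)) (Fin (n + 1)) ℂ := Matrix.vandermonde (fun i => ω ^ i.val)
  let X' : Matrix (Fin (n + 1)) (Fin (n + 1)) ℂ := X.map (starRingEnd ℂ)
  let S : ℕ → ℂ := fun l => ∑ j ∈ range (n + 1), (f j : ℂ) * (ω ^ l) ^ j
  let d : Fin (n + 1) → ℂ := Fin.cons (2 * (n + 1)) (fun l => 2 * S (l.val + 1))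
  let X'' : Matrix (Fin (n + 1)) (Fin (n + 1)) ℂ := Matrix.of fun i j =>
    if i = 0 then 1 else X' i j - 1
  have hω1 : ‖ω‖ = 1 := hω.norm'_eq_one (by omega)
  have hω0 : ω ≠ 0 := hω.ne_zero (by omega)
  have hconj : (starRingEnd ℂ) ω = ω⁻¹ := by
    rw [Complex.inv_def, Complex.normSq_eq_norm_sq, hω1]; simp
  have hX' : ∀ i j, X' i j = (ω⁻¹) ^ (i.val * j.val) := by
    intro i j
    simp [X', X, Matrix.vandermonde_apply, hconj, pow_mul]
  have hXdet : X.det ≠ 0 := by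
    rw [Matrix.det_vandermonde_ne_zero_iff]
    intro i j hij
    exact Fin.ext (hω.pow_inj i.2 j.2 hij)
  have hX'det : ‖X'.det‖ = ‖X.det‖ := by
    have : X'.det = (starRingEnd ℂ) X.det := ((starRingEnd ℂ).map_det X).symm
    rw [this, Complex.norm_conj]
  have hX'' : X''.det = X'.det := by
    refine Matrix.det_eq_of_forall_row_eq_smul_add_const
      (fun i => if i = 0 then 0 else -1) 0 (by simp) ?_
    intro i j
    have h0 : X' 0 j = 1 := by rw [hX']; simp
    by_cases hi : i = 0
    · subst hi; simp [X'', h0]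
    · simp [X'', hi, h0]; ring
  have hprod : ((B.map (algebraMap ℝ ℂ)) * X).det = (X'' * Matrix.diagonal d).det := by
    have hsum : ∀ l : Fin (n + 1), ∑ j : Fin (n + 1), ω ^ (j.val * l.val) =
        if l = 0 then ((n : ℂ) + 1) else 0 := by
      intro l
      rw [Fin.sum_univ_eq_sum_range (fun j => ω ^ (j * l.val))]
      split_ifs with h
      · subst h; simp
      · have h1 : ω ^ l.val ≠ 1 := by
          apply hω.pow_ne_one_of_pos_of_lt _ l.2
          exact fun h' => h (Fin.ext h')
        have h2 := geom_sum_mul (ω ^ l.val) (n + 1)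
        rw [← pow_mul, mul_comm l.val, pow_mul, hω.pow_eq_one, one_pow, sub_self] at h2
        rcases mul_eq_zero.1 h2 with h2 | h2
        · rw [← h2]; refine sum_congr rfl fun j _ => ?_
          rw [← pow_mul, mul_comm]
        · exact absurd (sub_eq_zero.1 h2) h1
    have hrow0 : ∀ l, ((B.map (algebraMap ℝ ℂ)) * X) 0 l = if l = 0 then 2 * ((n : ℂ) + 1) else 0 := by
      intro l
      rw [Matrix.mul_apply]
      have := hsum l
      simp only [hB, X, Matrix.map_apply, Matrix.of_apply, if_true, Matrix.vandermonde_apply,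
        ← pow_mul]
      rw [← mul_sum, this]
      split_ifs <;> simp
    have hrow : ∀ (i : Fin n) l, ((B.map (algebraMap ℝ ℂ)) * X) i.succ l =
        2 * (((ω⁻¹) ^ ((i.val + 1) * l.val) - 1) * S l.val) := by
      intro i l
      rw [Matrix.mul_apply]
      simp only [hB, X, Matrix.map_apply, Matrix.of_apply, Fin.succ_ne_zero, if_false,
        Matrix.vandermonde_apply, ← pow_mul, Fin.val_succ]
      rw [Fin.sum_univ_eq_sum_range (fun j => (algebraMap ℝ ℂ)
        (2 * (f (j + (i.val + 1)) - f j)) * ω ^ (j * l.val))]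
      have e1 := sum_shift (fun j => (f j : ℂ) * ω ^ (j * l.val)) (n + 1) (by
        intro j
        rw [hf, add_mul, pow_add, pow_mul ω (n + 1), hω.pow_eq_one, one_pow, mul_one]) (i.val + 1)
      have e2 : S l.val = ∑ j ∈ range (n + 1), (f j : ℂ) * ω ^ (j * l.val) := by
        refine sum_congr rfl fun j _ => ?_
        rw [← pow_mul, mul_comm l.val]
      have e3 : (ω⁻¹) ^ ((i.val + 1) * l.val) * S l.val =
          ∑ j ∈ range (n + 1), (f (j + (i.val + 1)) : ℂ) * ω ^ (j * l.val) := by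
        rw [e2, ← e1, mul_sum]
        refine sum_congr rfl fun j _ => ?_
        rw [add_mul j (i.val + 1) l.val, pow_add, inv_pow]
        have : ω ^ ((i.val + 1) * l.val) ≠ 0 := pow_ne_zero _ hω0
        generalize ω ^ ((i.val + 1) * l.val) = z at this ⊢
        field_simp
      rw [sub_mul, e3, one_mul, e2, ← sum_sub_distrib, mul_sum]
      refine sum_congr rfl fun j _ => ?_
      simp
      ring
    apply det_row_zero
    · rw [hrow0]; simp [X'', d]
    · intro i; rw [hrow]; simp
    · intro i j
      rw [hrow, Matrix.mul_diagonal]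
      simp only [X'', Matrix.of_apply, Fin.succ_ne_zero, if_false, hX', Fin.val_succ]
      refine Fin.cases ?_ (fun j => ?_) j
      · simp
      · simp [d]; ring
  rw [Matrix.det_mul, Matrix.det_mul, Matrix.det_diagonal, hX''] at hprod
  have hn := congrArg norm hprod
  rw [norm_mul, norm_mul, hX'det, mul_comm] at hn
  have hn' := mul_left_cancel₀ (norm_ne_zero_iff.2 hXdet) hn
  have hdet : (B.map (algebraMap ℝ ℂ)).det = (B.det : ℂ) := ((algebraMap ℝ ℂ).map_det B).symm
  rw [hdet, Complex.norm_real, Real.norm_eq_abs] at hn'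
  rw [hn', norm_prod, Fin.prod_univ_succ]
  congr 1
  · simp only [d, Fin.cons_zero, norm_mul, Complex.norm_ofNat]
    rw [show ((n : ℂ) + 1) = ((n + 1 : ℕ) : ℂ) by push_cast; rfl, Complex.norm_natCast]
    push_cast; rfl
  · refine prod_congr rfl fun l _ => ?_
    simp [d, S]

end Kummer

namespace Kummer
open Finset NumberField NumberField.Units

variable {p : ℕ} [hp : Fact p.Prime] {K : Type*} [Field K] [NumberField K]
  [hK : IsCyclotomicExtension {p} ℚ K] {ζ : K}

lemma g_pow_ne_zero {g : ℕ} (hg : orderOf (g : ZMod p) = p - 1) (i : ℕ) : (g : ZMod p) ^ i ≠ 0 := by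
  have : IsUnit (g : ZMod p) := (isPrim hg).isUnit (by have := hp.out.two_le; omega)
  exact pow_ne_zero _ this.ne_zero

lemma ψ_prim {a : ZMod p} (ha : a ≠ 0) : IsPrimitiveRoot (ψ p a) p := by
  have : orderOf (ψ p a) = p := by
    apply orderOf_eq_prime _ (ψ_ne_one ha)
    rw [← AddChar.map_nsmul_eq_pow]; simp
  have h := IsPrimitiveRoot.orderOf (ψ p a)
  rwa [this] at h

lemma exists_emb (hζ : IsPrimitiveRoot ζ p) {a : ZMod p} (ha : a ≠ 0) :
    ∃ φ : K →+* ℂ, φ ζ = ψ p a := by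
  let E := hζ.embeddingsEquivPrimitiveRoots ℂ (Polynomial.cyclotomic.irreducible_rat hp.out.pos)
  let r : primitiveRoots p ℂ := ⟨ψ p a, (mem_primitiveRoots hp.out.pos).2 (ψ_prim ha)⟩
  refine ⟨(E.symm r : K →+* ℂ), ?_⟩
  have := hζ.embeddingsEquivPrimitiveRoots_apply_coe ℂ
    (Polynomial.cyclotomic.irreducible_rat hp.out.pos) (E.symm r)
  have h2 : E (E.symm r) = r := E.apply_symm_apply r
  change (E (E.symm r) : ℂ) = _ at this
  rw [h2] at this
  exact this.symm

lemma exists_units (hζ : IsPrimitiveRoot ζ p) {g : ℕ} (hpg : ¬ p ∣ g) (n : ℕ) :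
    ∃ u : Fin n → (𝓞 K)ˣ, ∀ i, (u i : 𝓞 K) = ∑ c ∈ range (g ^ (i.val + 1)), hζ.toInteger ^ c := by
  have : ∀ i : Fin n, IsUnit (∑ c ∈ range (g ^ (i.val + 1)), hζ.toInteger ^ c) := by
    intro i
    apply hζ.toInteger_isPrimitiveRoot.geom_sum_isUnit hp.out.two_le
    apply Nat.Coprime.pow_left
    exact ((Nat.Prime.coprime_iff_not_dvd hp.out).2 hpg).symm
  exact ⟨fun i => (this i).unit, fun i => rfl⟩

variable (p K) in
lemma finrank_K : Module.finrank ℚ K = p - 1 := by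
  rw [IsCyclotomicExtension.finrank (n := p) K (Polynomial.cyclotomic.irreducible_rat hp.out.pos),
    Nat.totient_prime hp.out]

variable (p K) in
lemma card_places (h2 : 2 < p) : Fintype.card (InfinitePlace K) = (p - 1) / 2 := by
  rw [InfinitePlace.card_eq_nrRealPlaces_add_nrComplexPlaces,
    IsCyclotomicExtension.Rat.nrRealPlaces_eq_zero (n := p) K h2,
    IsCyclotomicExtension.Rat.nrComplexPlaces_eq_totient_div_two p K, zero_add,
    Nat.totient_prime hp.out]

theorem P6_main (hζ : IsPrimitiveRoot ζ p) {g : ℕ} (hm : p = 2 * (rank K + 1) + 1)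
    (hg : orderOf (g : ZMod p) = p - 1) {ω : ℂ} (hω : IsPrimitiveRoot ω (rank K + 1))
    (u : Fin (rank K) → (𝓞 K)ˣ)
    (hu : ∀ i, (u i : 𝓞 K) = ∑ c ∈ range (g ^ (i.val + 1)), hζ.toInteger ^ c) :
    regOfFamily u = ∏ l : Fin (rank K), (2 * ‖SS p g (rank K + 1) (ω ^ (l.val + 1))‖) := by
  classical
  have h2p : 2 < p := by omega
  have hgm := g_pow_m hm (by omega) hg
  choose φ hφ using fun i : ℕ => exists_emb hζ (g_pow_ne_zero hg i)
  let W : Fin (rank K + 1) → InfinitePlace K := fun i => InfinitePlace.mk (φ i.val)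
  have hWinj : Function.Injective W := by
    intro i j hij
    have h := InfinitePlace.mk_eq_iff.1 hij
    have key : ∀ i j : Fin (rank K + 1), (g : ZMod p) ^ i.val = g ^ j.val → i = j := by
      intro i j h
      exact Fin.ext ((isPrim hg).pow_inj (by omega) (by omega) h)
    rcases h with h | h
    · apply key
      have := congrArg (fun f : K →+* ℂ => f ζ) h
      simp only [hφ] at this
      exact ZMod.injective_stdAddChar this
    · exfalso
      have := congrArg (fun f : K →+* ℂ => f ζ) h
      simp only [ComplexEmbedding.conjugate_coe_eq, hφ] at this
      rw [← AddChar.map_neg_eq_conj] at this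
      have h3 : -(g : ZMod p) ^ i.val = g ^ j.val := ZMod.injective_stdAddChar this
      rw [neg_eq_neg_one_mul, ← hgm, ← pow_add] at h3
      have h4 : (g : ZMod p) ^ i.val = g ^ (rank K + 1 + j.val) := by
        rw [pow_add, hgm, ← h3, pow_add, hgm]; ring
      by_cases hij : i.val ≤ j.val
      · have := (isPrim hg).pow_inj (by omega) (by omega) h4
        omega
      · have := (isPrim hg).pow_inj (by omega) (by omega) h3
        omega
  have hWbij : Function.Bijective W := by
    rw [Fintype.bijective_iff_injective_and_card]
    refine ⟨hWinj, ?_⟩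
    rw [card_places p K h2p, Fintype.card_fin]; omega
  let w : Fin (rank K + 1) ≃ InfinitePlace K := Equiv.ofBijective W hWbij
  let e : {x // x ≠ w 0} ≃ Fin (rank K) :=
    (w.symm.subtypeEquiv (fun x => by
      rw [ne_eq, ne_eq, Equiv.symm_apply_eq])).trans (finSuccAboveEquiv 0).symm
  have he : ∀ (k : Fin (rank K)) h, e ⟨w k.succ, h⟩ = k := by
    intro k h
    simp only [e, Equiv.trans_apply, Equiv.symm_apply_eq]
    apply Subtype.ext
    simp [finSuccAboveEquiv_apply]
  have hlog : ∀ (j : Fin (rank K + 1)) (k : Fin (rank K)),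
      Real.log (w j (u k : K)) = ff p (g ^ (j.val + (k.val + 1))) - ff p (g ^ j.val) := by
    intro j k
    have h1 : w j (u k : K) = ‖φ j.val (u k : K)‖ := rfl
    have h3 : φ j.val (u k : K) = ∑ c ∈ range (g ^ (k.val + 1)), ψ p (g ^ j.val) ^ c := by
      rw [hu, map_sum, map_sum]
      refine sum_congr rfl fun c _ => ?_
      rw [← hφ]
      rw [map_pow, map_pow]
      rfl
    have h4 := geom_sum_mul_neg (ψ p (g ^ j.val)) (g ^ (k.val + 1))
    rw [← h3, ← AddChar.map_nsmul_eq_pow, nsmul_eq_mul] at h4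
    have h5 : ((g ^ (k.val + 1) : ℕ) : ZMod p) * g ^ j.val = g ^ (j.val + (k.val + 1)) := by
      push_cast; ring
    rw [h5] at h4
    have n1 : ‖1 - ψ p (g ^ j.val)‖ ≠ 0 :=
      norm_ne_zero_iff.2 (sub_ne_zero.2 (ψ_ne_one (g_pow_ne_zero hg _)).symm)
    have n2 : ‖1 - ψ p (g ^ (j.val + (k.val + 1)))‖ ≠ 0 :=
      norm_ne_zero_iff.2 (sub_ne_zero.2 (ψ_ne_one (g_pow_ne_zero hg _)).symm)
    have h6 : ‖φ j.val (u k : K)‖ =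
        ‖1 - ψ p (g ^ (j.val + (k.val + 1)))‖ / ‖1 - ψ p (g ^ j.val)‖ := by
      rw [← h4, norm_mul]; field_simp
    rw [h1, h6, Real.log_div n2 n1]; rfl
  have hmain := finrank_mul_regOfFamily_eq_det u (w 0) e
  have hdc := det_circ (rank K) (fun i => ff p (g ^ i)) (by
    intro i
    simp only [pow_add _ i, hgm, mul_neg, mul_one, ff_neg]) hω
  rw [← Matrix.det_submatrix_equiv_self w] at hmain
  have hmat : ((Matrix.of (fun i x : InfinitePlace K ↦
        if h : i = w 0 then (x.mult : ℝ) else x.mult * (x (u (e ⟨i, h⟩))).log)).submatrix w w) =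
      (Matrix.of fun i j : Fin (rank K + 1) => if i = 0 then (2 : ℝ) else
      2 * (ff p (g ^ (j.val + i.val)) - ff p (g ^ j.val))) := by
    have := IsCyclotomicExtension.Rat.isTotallyComplex (n := p) K h2p
    ext i j
    rw [Matrix.submatrix_apply, Matrix.of_apply, Matrix.of_apply, IsTotallyComplex.mult_eq]
    refine Fin.cases ?_ (fun k => ?_) i
    · simp
    · have h0 : w k.succ ≠ w 0 := fun h => Fin.succ_ne_zero k (w.injective h)
      rw [dif_neg h0, if_neg (Fin.succ_ne_zero k), he, hlog]
      simp
  rw [hmat, hdc, finrank_K p K] at hmain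
  have hc : ((p - 1 : ℕ) : ℝ) = 2 * ((rank K : ℝ) + 1) := by
    rw [show p - 1 = 2 * (rank K + 1) by omega]; push_cast; rfl
  rw [hc] at hmain
  exact mul_left_cancel₀ (by positivity) hmain

end Kummer

namespace Kummer
open Finset NumberField NumberField.Units Polynomial

variable {p : ℕ} [hp : Fact p.Prime] {K : Type*} [Field K] [NumberField K]
  [hK : IsCyclotomicExtension {p} ℚ K]

variable (p) in
lemma prod_L {n g : ℕ} (hm : p = 2 * (n + 1) + 1)
    (hg : orderOf (g : ZMod p) = p - 1) {ω : ℂ} (hω : IsPrimitiveRoot ω (n + 1)) :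
    ∏ χ ∈ (univ : Finset (DirichletCharacter ℂ p)).erase 1, ‖DirichletCharacter.LFunction χ 1‖ =
      (∏ l : Fin n, (2 / Real.sqrt p * ‖SS p g (n + 1) (ω ^ (l.val + 1))‖)) *
      ((Real.pi / (p * Real.sqrt p)) ^ (n + 1) *
        ‖((X ^ (n + 1) + 1 : ℂ[X]).roots.map (GG p g)).prod‖) := by
  classical
  let F : ℂ → ℝ := fun θ => if θ = 1 then 1 else if θ ^ (n + 1) = 1 then
    2 / Real.sqrt p * ‖SS p g (n + 1) θ‖ else Real.pi / (p * Real.sqrt p) * ‖GG p g θ‖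
  have hp1 : p - 1 = (n + 1) * 2 := by omega
  have hF : ∀ χ : DirichletCharacter ℂ p, F (χ⁻¹ g) =
      if χ = 1 then 1 else ‖DirichletCharacter.LFunction χ 1‖ := by
    intro χ
    have hunit : IsUnit (g : ZMod p) := (isPrim hg).isUnit (by omega)
    split_ifs with h
    · subst h
      have : (1 : DirichletCharacter ℂ p)⁻¹ (g : ZMod p) = 1 := by
        rw [inv_one, MulChar.one_apply hunit]
      simp only [F, this, if_true]
    · have h1 : χ⁻¹ (g : ZMod p) ≠ 1 := by
        intro h1
        apply h
        rw [← inv_eq_one]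
        apply char_inj hg
        rw [h1, MulChar.one_apply hunit]
      simp only [F, h1, if_false]
      split_ifs with h2
      · exact (P4_even hm (by omega) hg h h2).symm
      · refine (P4_odd hm (by omega) hg h ?_).symm
        have h3 := char_pow hg χ⁻¹
        rw [hp1, pow_mul, pow_two] at h3
        exact (mul_self_eq_one_iff.1 h3).resolve_left h2
  have e1 : ∏ χ ∈ (univ : Finset (DirichletCharacter ℂ p)).erase 1,
      ‖DirichletCharacter.LFunction χ 1‖ = ∏ χ : DirichletCharacter ℂ p, F (χ⁻¹ g) := by
    rw [← mul_prod_erase univ _ (mem_univ (1 : DirichletCharacter ℂ p)), hF, if_pos rfl, one_mul]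
    refine prod_congr rfl fun χ hχ => ?_
    rw [hF, if_neg (ne_of_mem_erase hχ)]
  have e2 : ∏ χ : DirichletCharacter ℂ p, F (χ⁻¹ g) = ∏ χ : DirichletCharacter ℂ p, F (χ g) :=
    Equiv.prod_comp (Equiv.inv (DirichletCharacter ℂ p)) (fun χ => F (χ g))
  rw [e1, e2, prod_char hg F, ← prod_filter_mul_prod_filter_not _ (fun θ => θ ^ (n + 1) = 1)]
  congr 1
  · have : (nthRootsFinset (p - 1) (1 : ℂ)).filter (fun θ => θ ^ (n + 1) = 1) =
        nthRootsFinset (n + 1) (1 : ℂ) := by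
      ext θ
      rw [mem_filter, mem_nthRootsFinset (by omega), mem_nthRootsFinset (by omega), hp1]
      constructor
      · exact fun h => h.2
      · intro h; exact ⟨by rw [pow_mul, h, one_pow], h⟩
    rw [this, prod_nthRoots (by omega) hω, prod_range_succ']
    have h1 : F (ω ^ 0) = 1 := by simp [F]
    rw [h1, mul_one, ← Fin.prod_univ_eq_prod_range (fun i => F (ω ^ (i + 1)))]
    refine prod_congr rfl fun l _ => ?_
    have h2 : ω ^ (l.val + 1) ≠ 1 :=
      hω.pow_ne_one_of_pos_of_lt (by omega) (by have := l.2; omega)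
    have h3 : (ω ^ (l.val + 1)) ^ (n + 1) = 1 := by
      rw [← pow_mul, mul_comm, pow_mul, hω.pow_eq_one, one_pow]
    simp only [F, h2, h3, if_false, if_true]
  · have hX : (X ^ (n + 1) + 1 : ℂ[X]) = X ^ (n + 1) - C (-1) := by simp
    have hnd : (X ^ (n + 1) + 1 : ℂ[X]).roots.Nodup := by
      apply Polynomial.nodup_roots
      rw [hX]
      exact separable_X_pow_sub_C (-1) (by exact_mod_cast (Nat.succ_ne_zero n)) (by simp)
    have hne : (X ^ (n + 1) + 1 : ℂ[X]) ≠ 0 := by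
      rw [hX]; exact X_pow_sub_C_ne_zero (by omega) _
    have hcard : (X ^ (n + 1) + 1 : ℂ[X]).roots.card = n + 1 := by
      rw [IsAlgClosed.card_roots_eq_natDegree, hX, natDegree_X_pow_sub_C]
    have : (nthRootsFinset (p - 1) (1 : ℂ)).filter (fun θ => ¬ θ ^ (n + 1) = 1) =
        ⟨(X ^ (n + 1) + 1 : ℂ[X]).roots, hnd⟩ := by
      ext θ
      rw [mem_filter, mem_nthRootsFinset (by omega), mem_mk, mem_roots hne, hp1]
      simp only [IsRoot.def, eval_add, eval_pow, eval_X, eval_one]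
      rw [pow_mul, pow_two]
      constructor
      · intro h
        rw [(mul_self_eq_one_iff.1 h.1).resolve_left h.2]; ring
      · intro h
        have h' : θ ^ (n + 1) = -1 := eq_neg_of_add_eq_zero_left h
        rw [h']
        norm_num
    rw [this]
    have h1 : ∏ x ∈ (⟨(X ^ (n + 1) + 1 : ℂ[X]).roots, hnd⟩ : Finset ℂ), F x =
        ∏ x ∈ (⟨(X ^ (n + 1) + 1 : ℂ[X]).roots, hnd⟩ : Finset ℂ),
          (Real.pi / (p * Real.sqrt p) * ‖GG p g x‖) := by
      refine prod_congr rfl fun θ hθ => ?_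
      rw [← this, mem_filter] at hθ
      have h2 : θ ≠ 1 := by
        rintro rfl; exact hθ.2 (one_pow _)
      simp only [F, h2, hθ.2, if_false]
    rw [h1, prod_mul_distrib, prod_const, card_mk, hcard, ← norm_prod]
    rfl

lemma final_alg {n : ℕ} {s R h S G q : ℝ} (hs : 0 < s) (hR : 0 < R) (hq : 0 < q)
    (hres : 2 ^ 0 * (2 * q) ^ (n + 1) * R * h / (2 * s ^ 2 * s ^ (2 * n + 1)) =
      (2 / s) ^ n * S * ((q / (s ^ 2 * s)) ^ (n + 1) * G)) :
    h * (2 * s ^ 2) ^ n = 2 ^ n * S / R * G := by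
  have h1 : s ^ (2 * n + 1) = (s ^ n) ^ 2 * s := by rw [pow_succ, mul_comm 2 n, pow_mul]
  have h2 : (s ^ 2 * s) ^ (n + 1) = (s ^ n) ^ 3 * s ^ 3 := by ring
  have h3 : (2 * s ^ 2) ^ n = 2 ^ n * (s ^ n) ^ 2 := by rw [mul_pow]; ring
  rw [h1, div_pow, div_pow, h2, mul_pow, pow_succ 2 n, pow_succ q n] at hres
  rw [h3]
  have a1 : 0 < s ^ n := by positivity
  have a2 : (0 : ℝ) < 2 ^ n := by positivity
  have a3 : 0 < q ^ n := by positivity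
  generalize s ^ n = σ at *
  generalize (2 : ℝ) ^ n = A at *
  generalize q ^ n = Q at *
  field_simp at hres ⊢
  linarith

variable (p) in
theorem index_formula {ζ : K} (hζ : IsPrimitiveRoot ζ p) {g : ℕ} (hm : p = 2 * (rank K + 1) + 1)
    (hg : orderOf (g : ZMod p) = p - 1) (u : Fin (rank K) → (𝓞 K)ˣ)
    (hu : ∀ i, (u i : 𝓞 K) = ∑ c ∈ range (g ^ (i.val + 1)), hζ.toInteger ^ c) :
    (classNumber K : ℝ) * (2 * p) ^ (rank K) =
      (Subgroup.closure (Set.range u) ⊔ torsion K).index *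
        ‖((X ^ (rank K + 1) + 1 : ℂ[X]).roots.map (GG p g)).prod‖ := by
  have h2p : 2 < p := by omega
  have hω := Complex.isPrimitiveRoot_exp (rank K + 1) (by omega)
  set ω := Complex.exp (2 * Real.pi * Complex.I / ((rank K + 1 : ℕ) : ℂ))
  have hres := congrArg norm (residue_eq p K hg)
  rw [norm_prod, prod_L p hm hg hω, Complex.norm_real, Real.norm_eq_abs,
    abs_of_pos (dedekindZeta_residue_pos K), dedekindZeta_residue_def,
    IsCyclotomicExtension.Rat.nrRealPlaces_eq_zero (n := p) K h2p,
    IsCyclotomicExtension.Rat.nrComplexPlaces_eq_totient_div_two p K,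
    IsCyclotomicExtension.Rat.torsionOrder_eq (n := p) (K := K), Nat.totient_prime hp.out,
    IsCyclotomicExtension.Rat.discr_prime p K, prod_mul_distrib] at hres
  have hreg := P6_main hζ hm hg hω u hu
  rw [prod_mul_distrib] at hreg
  have hidx := regOfFamily_div_regulator u
  have hR := regulator_pos K
  set G := ‖((X ^ (rank K + 1) + 1 : ℂ[X]).roots.map (GG p g)).prod‖
  set S := ∏ l : Fin (rank K), ‖SS p g (rank K + 1) (ω ^ (l.val + 1))‖
  set R := regulator K
  rw [← hidx, hreg]
  have hne : ¬ Even p := by rw [Nat.not_even_iff_odd]; exact ⟨_, hm⟩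
  have hs : 0 < Real.sqrt p := Real.sqrt_pos.2 (by exact_mod_cast hp.out.pos)
  have hss : Real.sqrt p ^ 2 = p := Real.sq_sqrt (by positivity)
  have hd : Real.sqrt |(((-1) ^ ((p - 1) / 2) * p ^ (p - 2) : ℤ) : ℝ)| =
      (Real.sqrt p) ^ (2 * rank K + 1) := by
    push_cast
    rw [abs_mul, abs_pow, abs_neg, abs_one, one_pow, one_mul, abs_pow, Nat.abs_cast]
    rw [show p - 2 = 2 * rank K + 1 by omega]
    rw [Real.sqrt_eq_iff_mul_self_eq (by positivity) (by positivity), ← mul_pow, ← pow_two, hss]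
  rw [if_neg hne, hd, show (p - 1) / 2 = rank K + 1 by omega] at hres
  simp only [prod_const, card_univ, Fintype.card_fin] at hres ⊢
  have hpi := Real.pi_pos
  generalize Real.sqrt p = s at *
  have hpp : (p : ℝ) = s ^ 2 := hss.symm
  push_cast at hres
  rw [hpp] at hres ⊢
  exact final_alg hs hR hpi hres

end Kummer

/-- **Kummer's criterion for regularity.** For an odd prime `p`, `p` does not divide
the class number of the `p`-th cyclotomic field `ℚ(ζ_p)` if and only if `p` does not
divide the numerator of the Bernoulli number `B_k` for every even `k` with
`2 ≤ k ≤ p - 3`. -/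
theorem kummer_criterion (p : ℕ) (hp : p.Prime) (hodd : Odd p) :
    ¬ p ∣ NumberField.classNumber (CyclotomicField (⟨p, hp.pos⟩ : ℕ+) ℚ) ↔
      ∀ k : ℕ, 2 ≤ k → k ≤ p - 3 → Even k → ¬ (p : ℤ) ∣ (bernoulli k).num := by
  haveI : Fact p.Prime := ⟨hp⟩
  set K := CyclotomicField (⟨p, hp.pos⟩ : ℕ+) ℚ with hK
  haveI : IsCyclotomicExtension {p} ℚ K :=
    @CyclotomicField.isCyclotomicExtension p ⟨hp.ne_zero⟩ ℚ _ ⟨by exact_mod_cast hp.ne_zero⟩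
  have hζ := IsCyclotomicExtension.zeta_spec p ℚ K
  have h2p : 2 < p := by
    obtain ⟨k, hk⟩ := hodd
    have := hp.two_le
    omega
  have hm : p = 2 * (NumberField.Units.rank K + 1) + 1 := by
    have h1 := Kummer.card_places p K h2p
    have h2 : NumberField.Units.rank K = Fintype.card (NumberField.InfinitePlace K) - 1 := rfl
    obtain ⟨k, hk⟩ := hodd
    omega
  obtain ⟨g, hg, hq⟩ := Kummer.exists_g hm (by omega)
  have hpg : ¬ p ∣ g := by
    intro h
    have h1 := Kummer.g_pow_ne_zero hg 1
    rw [pow_one] at h1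
    exact h1 ((ZMod.natCast_eq_zero_iff g p).2 h)
  obtain ⟨u, hu⟩ := Kummer.exists_units hζ hpg (NumberField.Units.rank K)
  have hind := Kummer.index_formula p hζ hm hg u hu
  obtain ⟨N, t, ht, hNt, hN⟩ := Kummer.P2_main hm (by omega) hg hq
  have hP3 := fun hB => Kummer.P3_main hζ hm hg hB hpg u hu
  generalize (Subgroup.closure (Set.range u) ⊔ NumberField.Units.torsion K).index = I at *
  generalize NumberField.Units.rank K = n at *
  have hp0 : (0 : ℝ) < p := by exact_mod_cast hp.pos
  have hfin : NumberField.classNumber K * 2 ^ n * t.natAbs = I * N.natAbs := by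
    have h1 := congrArg norm hNt
    rw [norm_mul, norm_mul, norm_pow, Complex.norm_natCast, Complex.norm_intCast,
      Complex.norm_intCast, Nat.add_sub_cancel] at h1
    have h2 : ((NumberField.classNumber K : ℝ) * 2 ^ n * |(t : ℝ)|) = I * |(N : ℝ)| := by
      have h3 : (p : ℝ) ^ n ≠ 0 := by positivity
      apply mul_left_cancel₀ h3
      rw [mul_pow] at hind
      linear_combination |(t : ℝ)| * hind + I * h1
    rw [← @Nat.cast_inj ℝ]
    push_cast [Nat.cast_natAbs]
    exact h2
  have hI : I ≠ 0 := by
    rintro rfl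
    rw [Nat.cast_zero, zero_mul] at hind
    have h1 : (0 : ℝ) < NumberField.classNumber K := by
      exact_mod_cast NumberField.classNumber_pos K
    have : (0 : ℝ) < NumberField.classNumber K * (2 * p) ^ n := by positivity
    exact this.ne' hind
  have ht' : ¬ p ∣ t.natAbs := fun h => ht (Int.natCast_dvd.2 h)
  have hp2 : ¬ p ∣ 2 ^ n := by
    intro h
    have := Nat.le_of_dvd (by norm_num) (hp.dvd_of_dvd_pow h)
    omega
  constructor
  · intro hh k hk1 hk2 hk3 hk4
    have h1 : (p : ℤ) ∣ N := hN.2 ⟨k, hk1, hk2, hk3, hk4⟩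
    have h2 : p ∣ NumberField.classNumber K * 2 ^ n * t.natAbs := by
      rw [hfin]; exact (Int.natCast_dvd.1 h1).mul_left _
    rcases hp.dvd_mul.1 h2 with h2 | h2
    · rcases hp.dvd_mul.1 h2 with h2 | h2
      · exact hh h2
      · exact hp2 h2
    · exact ht' h2
  · intro hB hh
    have h2 : p ∣ I * N.natAbs := by
      rw [← hfin, mul_assoc]; exact hh.mul_right _
    rcases hp.dvd_mul.1 h2 with h2 | h2
    · exact hP3 hB hI h2
    · obtain ⟨k, h1, h2, h3, h4⟩ := hN.1 (Int.natCast_dvd.2 h2)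
      exact hB k h1 h2 h3 h4
end

section
/- Let p be an odd prime and let k be a positive even integer not divisible by p−1. Then the rational number ζ(1−k) = −B_k/k is p-integral: the p-adic valuation padicValRat p (bernoulli k / k) is nonnegative (equivalently, p does not divide the denominator of B_k/k). -/
theorem zvp_series (a : ℕ) : ∃ F : PowerSeries ℚ,
    (∀ n, PowerSeries.coeff n F = ((a:ℚ)^(n+1) - 1) * (bernoulli (n+1) / (n+1).factorial)) ∧
    F * (∑ i ∈ Finset.range a, (PowerSeries.exp ℚ)^i)
      = - ∑ i ∈ Finset.range a, ∑ j ∈ Finset.range i, (PowerSeries.exp ℚ)^j := by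
  refine ⟨PowerSeries.mk fun n => ((a:ℚ)^(n+1) - 1) * (bernoulli (n+1) / (n+1).factorial),
    fun n => by simp, ?_⟩
  set F : PowerSeries ℚ :=
    PowerSeries.mk fun n => ((a:ℚ)^(n+1) - 1) * (bernoulli (n+1) / (n+1).factorial) with hF
  set e := PowerSeries.exp ℚ with he
  set P := ∑ i ∈ Finset.range a, e^i with hP
  set R := ∑ i ∈ Finset.range a, ∑ j ∈ Finset.range i, e^j with hR
  have hB := bernoulliPowerSeries_mul_exp_sub_one ℚ
  set B := bernoulliPowerSeries ℚ with hBd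
  have hG : PowerSeries.rescale (a:ℚ) B - B = PowerSeries.X * F := by
    ext n
    cases n with
    | zero =>
      rw [map_sub, PowerSeries.coeff_rescale, PowerSeries.coeff_zero_X_mul]
      simp
    | succ n =>
      rw [PowerSeries.coeff_succ_X_mul]
      simp [hF, hBd, bernoulliPowerSeries, PowerSeries.coeff_rescale]
      ring
  have hBa : PowerSeries.rescale (a:ℚ) B * (e^a - 1) = (a:PowerSeries ℚ) * PowerSeries.X := by
    have := congrArg (PowerSeries.rescale (a:ℚ)) hB
    rw [map_mul, map_sub, map_one, ← PowerSeries.exp_pow_eq_rescale_exp,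
      PowerSeries.rescale_X] at this
    simpa using this
  have hPe : P * (e - 1) = e^a - 1 := geom_sum_mul e a
  have hRe : R * (e - 1) = P - a := by
    rw [hR, Finset.sum_mul]
    simp [geom_sum_mul, hP]
  have he1 : e - 1 ≠ 0 := by
    intro h
    rw [h, mul_zero] at hB
    exact PowerSeries.X_ne_zero hB.symm
  have hX : (PowerSeries.X : PowerSeries ℚ) ≠ 0 := PowerSeries.X_ne_zero
  apply mul_left_cancel₀ hX
  apply mul_right_cancel₀ he1
  linear_combination (-P * (e-1)) * hG + hBa + (PowerSeries.rescale (a:ℚ) B) * hPe - P * hB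
    + PowerSeries.X * hRe

theorem zvp_coeff_exp_pow (i m : ℕ) :
    PowerSeries.coeff m ((PowerSeries.exp ℚ)^i) = (i:ℚ)^m / m.factorial := by
  rw [PowerSeries.exp_pow_eq_rescale_exp, PowerSeries.coeff_rescale, PowerSeries.coeff_exp]
  simp [div_eq_mul_inv]

theorem zvp_integral (a : ℕ) (n : ℕ) : ∃ z : ℤ,
    (z:ℚ) = (a:ℚ)^(n+1) * (((a:ℚ)^(n+1) - 1) * (bernoulli (n+1) / (n+1 : ℕ))) := by
  obtain ⟨F, hF, hFP⟩ := zvp_series a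
  have key : ∀ n, ∃ z : ℤ, (z:ℚ) = (a:ℚ)^(n+1) * (n.factorial * PowerSeries.coeff n F) := by
    intro n
    induction n using Nat.strong_induction_on with
    | _ n ih =>
    have h := congrArg (fun f => (a:ℚ)^n * (n.factorial * PowerSeries.coeff n f)) hFP
    simp only [PowerSeries.coeff_mul, map_neg, map_sum, zvp_coeff_exp_pow] at h
    rw [Finset.Nat.sum_antidiagonal_eq_sum_range_succ
      (fun x y => PowerSeries.coeff x F * ∑ i ∈ Finset.range a, (i:ℚ)^y / y.factorial),
      Finset.sum_range_succ] at h
    have hn0 : (n.factorial : ℚ) ≠ 0 := by exact_mod_cast n.factorial_ne_zero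
    choose! z hz using ih
    refine ⟨-(a:ℤ)^n * (∑ i ∈ Finset.range a, ∑ j ∈ Finset.range i, (j:ℤ)^n) -
      ∑ m ∈ Finset.range n, (n.choose m : ℤ) * z m * (a:ℤ)^(n-m-1) *
        ∑ i ∈ Finset.range a, (i:ℤ)^(n-m), ?_⟩
    push_cast
    have h1 : ∑ m ∈ Finset.range n, (n.choose m : ℚ) * z m * (a:ℚ)^(n-m-1) *
        ∑ i ∈ Finset.range a, (i:ℚ)^(n-m) = (a:ℚ)^n * (n.factorial *
        ∑ m ∈ Finset.range n, PowerSeries.coeff m F *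
          ∑ i ∈ Finset.range a, (i:ℚ)^(n-m) / (n-m).factorial) := by
      rw [Finset.mul_sum, Finset.mul_sum]
      refine Finset.sum_congr rfl fun m hm => ?_
      have hm := Finset.mem_range.mp hm
      rw [hz m hm, ← Finset.sum_div, ← Nat.choose_mul_factorial_mul_factorial hm.le]
      have h2 : (a:ℚ)^n = a^(m+1) * a^(n-m-1) := by
        rw [← pow_add]; congr 1; omega
      have h3 : ((n-m).factorial : ℚ) ≠ 0 := by exact_mod_cast (n-m).factorial_ne_zero
      rw [h2]
      push_cast
      field_simp
    rw [h1]
    have h4 : (n.factorial : ℚ) * ∑ i ∈ Finset.range a, ∑ j ∈ Finset.range i,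
        (j:ℚ)^n / n.factorial = ∑ i ∈ Finset.range a, ∑ j ∈ Finset.range i, (j:ℚ)^n := by
      simp only [← Finset.sum_div]
      field_simp
    have h5 : ∑ i ∈ Finset.range a, (i:ℚ)^(n-n) / (n-n).factorial = a := by simp
    rw [h5] at h
    linear_combination (-(a:ℚ)^n) * (-h4) - h
  obtain ⟨z, hz⟩ := key n
  refine ⟨z, ?_⟩
  rw [hz, hF, Nat.factorial_succ]
  have hn0 : (n.factorial : ℚ) ≠ 0 := by exact_mod_cast n.factorial_ne_zero
  have : ((n:ℚ)+1) ≠ 0 := by positivity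
  push_cast
  field_simp

/-- For an odd prime `p` and a positive even integer `k` not divisible by `p - 1`,
the rational number `ζ(1-k) = -B_k/k` is `p`-integral: the `p`-adic valuation of
`B_k / k` is nonnegative. -/
theorem zeta_value_p_integral (p : ℕ) (hp : p.Prime) (hodd : Odd p)
    (k : ℕ) (hk : 0 < k) (hke : Even k) (hknd : ¬ (p - 1) ∣ k) :
    0 ≤ padicValRat p ((bernoulli k : ℚ) / k) := by
  haveI : Fact p.Prime := ⟨hp⟩
  by_cases hb : (bernoulli k : ℚ) / k = 0
  · simp [hb]
  have hx : ∃ x : (ZMod p)ˣ, x^k ≠ 1 := by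
    by_contra! h
    have := (FiniteField.forall_pow_eq_one_iff (ZMod p) k).mp h
    rw [ZMod.card] at this
    exact hknd this
  obtain ⟨x, hx⟩ := hx
  set a := (x : ZMod p).val with ha
  have hax : ((a:ℕ) : ZMod p) = x := by simp [ha]
  obtain ⟨n, rfl⟩ : ∃ n, k = n + 1 := ⟨k-1, by omega⟩
  obtain ⟨z, hz⟩ := zvp_integral a n
  set c : ℤ := (a:ℤ)^(n+1) * ((a:ℤ)^(n+1) - 1) with hc
  have hcp : ¬ (p:ℤ) ∣ c := by
    rw [← ZMod.intCast_zmod_eq_zero_iff_dvd]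
    simp only [hc]
    push_cast
    rw [hax]
    refine mul_ne_zero (pow_ne_zero _ x.ne_zero) ?_
    intro h
    exact hx (Units.ext (by simpa using sub_eq_zero.mp h))
  have hc0 : (c:ℚ) ≠ 0 := by
    intro h
    apply hcp
    have : c = 0 := by exact_mod_cast h
    simp [this]
  have hz' : (z:ℚ) = c * ((bernoulli (n+1) : ℚ) / (n+1 : ℕ)) := by
    rw [hz, hc]; push_cast; ring
  have h1 := congrArg (padicValRat p) hz'
  rw [padicValRat.mul hc0 hb, padicValRat.of_int, padicValRat.of_int,
    padicValInt.eq_zero_of_not_dvd hcp] at h1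
  simp only [Nat.cast_zero, zero_add] at h1
  rw [← h1]
  positivity
end

section
/- (Kubota–Leopoldt) Let p be an odd prime, let K be a field complete with respect to a nontrivial nonarchimedean absolute value ‖·‖, equipped with a ℚ_p-algebra structure such that ‖·‖ restricts to the p-adic absolute value on ℚ_p (normalized by ‖p‖ = p^{-1}). Let χ be a nontrivial Dirichlet character of modulus N ≥ 1 with values in K, and let ω be a Dirichlet character of modulus p with values in K satisfying ‖ω(a) − a‖ < 1 for every a ∈ (ℤ/pℤ)^× (the Teichmüller character). For each n ≥ 1 let θ_n be the Dirichlet character of modulus N·p obtained as the product of χ and the n-th power of the inverse of ω (both lifted to modulus N·p). Then there exists a sequence (c_j)_{j≥0} of elements of K such that ‖c_j‖·r^j → 0 as j → ∞ for every real r with 0 < r < p^{(p−2)/(p−1)}, and such that for every integer n ≥ 1 the series Σ_{j≥0} c_j·(1−n)^j converges in K with sum (1 − θ_n(p)·p^{n−1})·(−B_{n,θ_n}/n). In other words, there is a p-adic analytic function L_p(s, χ) on the disc |s|_p < p^{(p−2)/(p−1)} with L_p(1−n, χ) = (1 − χω^{−n}(p)p^{n−1})·L(1−n, χω^{−n}) for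 all n ≥ 1. -/
/-- The generalized Bernoulli number `B_{n,χ} = N^(n-1)·Σ_{a=1}^{N} χ(a)·B_n(a/N)` of a
Dirichlet character `χ` of modulus `N`, with values in a commutative `ℚ`-algebra. -/
noncomputable def generalizedBernoulli {R : Type*} [CommRing R] [Algebra ℚ R] {N : ℕ}
    (χ : DirichletCharacter R N) (n : ℕ) : R :=
  (N : R) ^ (n - 1) *
    ∑ a ∈ Finset.range N,
      χ (((a + 1 : ℕ) : ZMod N)) *
        algebraMap ℚ R ((Polynomial.bernoulli n).eval (((a : ℚ) + 1) / N))

theorem kl_norm_sub {K : Type*} [NormedField K] [IsUltrametricDist K] (x y : K) :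
    ‖x - y‖ ≤ max ‖x‖ ‖y‖ := by
  rw [sub_eq_add_neg, ← norm_neg y]
  exact IsUltrametricDist.norm_add_le_max _ _

open Filter in
theorem kl_analytic {K : Type*} [NontriviallyNormedField K] [CompleteSpace K]
    [IsUltrametricDist K] (R : ℝ) (hR : 1 < R) (d : ℕ → K)
    (hd : ∀ r : ℝ, 0 < r → r < R → Tendsto (fun m : ℕ => ‖d m‖ * r ^ m) atTop (nhds 0))
    (P : ℕ → Polynomial ℤ) (hP : ∀ m, (P m).natDegree ≤ m) :
    ∃ c : ℕ → K, (∀ r : ℝ, 0 < r → r < R →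
        Tendsto (fun j : ℕ => ‖c j‖ * r ^ j) atTop (nhds 0)) ∧
      ∀ s T : K, ‖s‖ ≤ 1 → HasSum (fun m => d m * (P m).aeval s) T →
        HasSum (fun j : ℕ => c j * s ^ j) T := by
  have hS : ∀ m j, ‖((P m).coeff j : K)‖ ≤ 1 := fun m j =>
    IsUltrametricDist.norm_intCast_le_one K _
  have hS0 : ∀ m j, m < j → ((P m).coeff j : K) = 0 := fun m j h => by
    rw [Polynomial.coeff_eq_zero_of_natDegree_lt (lt_of_le_of_lt (hP m) h)]; simp
  have hd1 : Tendsto (fun m => ‖d m‖) atTop (nhds 0) := by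
    simpa using hd 1 one_pos hR
  have hsum : ∀ j, Summable (fun m => d m * ((P m).coeff j : K)) := by
    intro j
    apply NonarchimedeanAddGroup.summable_of_tendsto_cofinite_zero
    rw [Nat.cofinite_eq_atTop]
    refine squeeze_zero_norm (fun m => ?_) hd1
    rw [norm_mul]
    exact mul_le_of_le_one_right (norm_nonneg _) (hS m j)
  refine ⟨fun j => ∑' m, d m * ((P m).coeff j : K), ?_, ?_⟩
  · intro r hr0 hrR
    set r' := max r 1 with hr'
    have hr'1 : 1 ≤ r' := le_max_right _ _
    have hr'0 : 0 < r' := lt_of_lt_of_le one_pos hr'1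
    have h := hd r' hr'0 (max_lt hrR hR)
    rw [Metric.tendsto_atTop] at h ⊢
    intro ε hε
    obtain ⟨M, hM⟩ := h (ε / 2) (by positivity)
    refine ⟨M, fun j hj => ?_⟩
    have hc : ‖∑' m, d m * ((P m).coeff j : K)‖ ≤ (ε / 2) / r' ^ j := by
      apply IsUltrametricDist.norm_tsum_le_of_forall_le_of_nonneg (by positivity)
      intro m
      by_cases hmj : m < j
      · rw [hS0 m j hmj]; simp; positivity
      · push Not at hmj
        have h1 := hM m (hj.trans hmj)
        rw [Real.dist_eq, sub_zero, abs_of_nonneg (by positivity)] at h1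
        rw [norm_mul, le_div_iff₀ (by positivity)]
        calc ‖d m‖ * ‖((P m).coeff j : K)‖ * r' ^ j ≤ ‖d m‖ * 1 * r' ^ m := by
              gcongr
              · exact hS m j
          _ ≤ ε / 2 := by rw [mul_one]; exact h1.le
    rw [Real.dist_eq, sub_zero, abs_of_nonneg (by positivity)]
    rw [le_div_iff₀ (by positivity)] at hc
    calc _ ≤ ‖∑' m, d m * ((P m).coeff j : K)‖ * r' ^ j := by
          gcongr
          exact le_max_left _ _
      _ ≤ ε / 2 := hc
      _ < ε := by linarith
  · intro s T hs hT
    let f : ℕ × ℕ → K := fun q => d q.1 * ((P q.1).coeff q.2 : K) * s ^ q.2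
    have hf : Summable f := by
      apply NonarchimedeanAddGroup.summable_of_tendsto_cofinite_zero
      rw [Metric.tendsto_nhds]
      intro ε hε
      rw [Metric.tendsto_atTop] at hd1
      obtain ⟨M, hM⟩ := hd1 ε hε
      rw [eventually_cofinite]
      refine Set.Finite.subset (Set.Finite.prod (Set.finite_Iio M) (Set.finite_Iio M)) ?_
      rintro ⟨m, j⟩ hmj
      simp only [Set.mem_ofPred_eq, dist_zero_right, not_lt, f, norm_mul, norm_pow] at hmj
      have hjm : j ≤ m := by
        by_contra hlt
        push Not at hlt
        rw [hS0 m j hlt] at hmj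
        simp at hmj
        linarith
      have hmM : m < M := by
        by_contra hlt
        push Not at hlt
        have h1 := hM m hlt
        rw [Real.dist_eq, sub_zero, abs_of_nonneg (by positivity)] at h1
        have : ‖d m‖ * ‖((P m).coeff j : K)‖ * ‖s‖ ^ j ≤ ‖d m‖ * 1 * 1 := by
          gcongr
          · exact hS m j
          · exact pow_le_one₀ (norm_nonneg _) hs
        linarith
      exact ⟨hmM, lt_of_le_of_lt hjm hmM⟩
    have h1 : ∀ m, HasSum (fun j => f (m, j)) (d m * (P m).aeval s) := by
      intro m
      have : d m * (P m).aeval s = ∑ j ∈ Finset.range (m + 1), f (m, j) := by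
        rw [Polynomial.aeval_eq_sum_range' (Nat.lt_succ_of_le (hP m)), Finset.mul_sum]
        refine Finset.sum_congr rfl fun j _ => ?_
        simp [f, mul_assoc]
      rw [this]
      apply hasSum_sum_of_ne_finset_zero
      intro j hj
      have : m < j := by simpa using hj
      simp only [f, hS0 m j this]; simp
    have h2 := hf.hasSum.prod_fiberwise h1
    have h3 : T = ∑' q, f q := hT.unique h2
    rw [h3]
    have h4 := (Equiv.prodComm ℕ ℕ).hasSum_iff.mpr hf.hasSum
    refine h4.prod_fiberwise fun j => ?_
    exact (hsum j).hasSum.mul_right _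

theorem kl_bern (p : ℕ) [hp : Fact p.Prime] (n : ℕ) : ‖((bernoulli n : ℚ) : ℚ_[p])‖ ≤ p := by
  have hp0 : (p : ℚ_[p]) ≠ 0 := by exact_mod_cast hp.out.ne_zero
  have hpp : (0:ℝ) < p := by exact_mod_cast hp.out.pos
  suffices h : ‖(p : ℚ_[p]) * (bernoulli n : ℚ)‖ ≤ 1 by
    rw [norm_mul, Padic.norm_p, inv_mul_le_iff₀ hpp, mul_one] at h
    exact h
  induction n using Nat.strong_induction_on with
  | _ n ih =>
  have h := congrArg (fun q : ℚ => (q : ℚ_[p])) (sum_range_pow p n)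
  simp only [Finset.sum_range_succ _ n] at h
  have hn1 : ((n : ℚ) + 1) ≠ 0 := by positivity
  have e : bernoulli n * ((n + 1).choose n) * (p : ℚ) ^ (n + 1 - n) / (n + 1) =
      p * bernoulli n := by
    rw [Nat.choose_succ_self_right, Nat.add_sub_cancel_left]; push_cast; field_simp
  rw [e] at h
  push_cast at h
  rw [← sub_eq_iff_eq_add'] at h
  rw [← h]
  refine (kl_norm_sub _ _).trans (max_le ?_ ?_)
  · have := IsUltrametricDist.norm_natCast_le_one ℚ_[p] (∑ x ∈ Finset.range p, x ^ n)
    push_cast at this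
    exact this
  · apply IsUltrametricDist.norm_sum_le_of_forall_le_of_nonneg zero_le_one
    intro i hi
    have hin : i < n := by simpa using hi
    obtain ⟨k, rfl⟩ : ∃ k, n = i + k := ⟨n - i, by omega⟩
    have hk : (k : ℚ_[p]) + 1 ≠ 0 := by exact_mod_cast (Nat.succ_ne_zero k)
    have hnk : ((i + k : ℕ) : ℚ_[p]) + 1 ≠ 0 := by exact_mod_cast (Nat.succ_ne_zero (i + k))
    have hch : (((i + k + 1).choose i : ℕ) : ℚ_[p]) * (k + 1) =
        ((i + k).choose i : ℕ) * ((i + k : ℕ) + 1) := by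
      have := Nat.choose_mul_succ_eq (i + k) i
      have h2 : i + k + 1 - i = k + 1 := by omega
      rw [h2] at this
      exact_mod_cast this.symm
    have e2 : ((bernoulli i : ℚ) : ℚ_[p]) * ((i + k + 1).choose i : ℕ) * (p : ℚ_[p]) ^ (i + k + 1 - i)
        / ((i + k : ℕ) + 1) = ((i + k).choose i : ℕ) * (p * (bernoulli i : ℚ)) * (p ^ k / (k + 1)) := by
      have h2 : i + k + 1 - i = k + 1 := by omega
      rw [h2, div_eq_iff hnk]
      field_simp
      linear_combination (bernoulli i : ℚ_[p]) * p ^ (k + 1) * hch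
    push_cast at e2 ⊢
    rw [e2, norm_mul, norm_mul]
    have h3 : ‖(p : ℚ_[p]) ^ k / (k + 1)‖ ≤ 1 := by
      have hk' : ((k + 1 : ℕ) : ℚ_[p]) ≠ 0 := by exact_mod_cast (Nat.succ_ne_zero k)
      have : (k : ℚ_[p]) + 1 = ((k + 1 : ℕ) : ℚ_[p]) := by push_cast; rfl
      rw [this, norm_div, norm_pow, Padic.norm_p, div_le_one (norm_pos_iff.mpr hk')]
      rw [Padic.norm_eq_zpow_neg_valuation hk', Padic.valuation_natCast, inv_pow, zpow_neg]
      rw [inv_le_inv₀ (by positivity) (by positivity), zpow_natCast]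
      apply pow_le_pow_right₀ (by exact_mod_cast hp.out.one_le)
      have h5 : padicValNat p (k + 1) ≤ Nat.log p (k + 1) := padicValNat_le_nat_log _
      refine h5.trans ?_
      apply Nat.le_of_lt_succ
      apply Nat.log_lt_of_lt_pow (by omega)
      exact Nat.lt_pow_self hp.out.one_lt
    have h4 := IsUltrametricDist.norm_natCast_le_one ℚ_[p] ((i + k).choose i)
    calc _ ≤ (1:ℝ) * 1 * 1 := by
          gcongr
          exact ih i hin
      _ = 1 := by norm_num

theorem kl_fact (p : ℕ) [hp : Fact p.Prime] (n : ℕ) :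
    ‖((n.factorial : ℕ) : ℚ_[p])‖⁻¹ ≤ ((p : ℝ) ^ (1 / ((p : ℝ) - 1))) ^ n := by
  have hp1 : (1:ℝ) < p := by exact_mod_cast hp.out.one_lt
  have hk' : ((n.factorial : ℕ) : ℚ_[p]) ≠ 0 := by exact_mod_cast (Nat.factorial_ne_zero n)
  rw [Padic.norm_eq_zpow_neg_valuation hk', Padic.valuation_natCast, zpow_neg, inv_inv,
    zpow_natCast, ← Real.rpow_natCast, ← Real.rpow_natCast, ← Real.rpow_mul (by positivity)]
  apply Real.rpow_le_rpow_of_exponent_le hp1.le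
  have h := sub_one_mul_padicValNat_factorial (p := p) n
  have h2 : (p - 1) * padicValNat p n.factorial ≤ n := by omega
  have h3 : ((p:ℝ) - 1) * padicValNat p n.factorial ≤ n := by
    have : ((p - 1 : ℕ) : ℝ) = p - 1 := by rw [Nat.cast_sub hp.out.one_le]; simp
    rw [← this]; exact_mod_cast h2
  rw [one_div, inv_mul_eq_div, le_div_iff₀ (by linarith)]
  linarith

noncomputable def klP {K : Type*} [Field K] (n : ℕ) (u v : K) : K :=
  ∑ l ∈ Finset.range (n + 1), (n.choose l : K) * ((bernoulli l : ℚ) : K) * v ^ l * u ^ (n - l)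

theorem klP_trans {K : Type*} [Field K] (n : ℕ) (w v : K) :
    klP n (w + 1) v = ∑ i ∈ Finset.range (n + 1), (n.choose i : K) * klP i w v := by
  unfold klP
  simp_rw [Finset.mul_sum]
  have key : ∀ l ∈ Finset.range (n + 1),
      (n.choose l : K) * ((bernoulli l : ℚ) : K) * v ^ l * (w + 1) ^ (n - l) =
      ∑ i ∈ Finset.Ico l (n + 1), (n.choose i : K) * ((i.choose l : K) * ((bernoulli l : ℚ) : K)
        * v ^ l * w ^ (i - l)) := by
    intro l hl
    have hl' : l ≤ n := by simp at hl; omega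
    rw [add_pow, Finset.mul_sum, Finset.sum_Ico_eq_sum_range]
    have : n + 1 - l = n - l + 1 := by omega
    rw [this]
    refine Finset.sum_congr rfl fun k hk => ?_
    have hc := Nat.choose_mul (n := n) (k := l + k) (s := l) (by omega)
    have hc' : (n.choose (l + k) : K) * ((l + k).choose l : K) =
        n.choose l * ((n - l).choose k : K) := by
      rw [Nat.add_sub_cancel_left] at hc; rw [← Nat.cast_mul, hc, Nat.cast_mul]
    rw [Nat.add_sub_cancel_left, one_pow]
    linear_combination -(((bernoulli l : ℚ) : K) * v ^ l * w ^ k) * hc'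
  rw [Finset.sum_congr rfl key]
  refine Finset.sum_comm' ?_
  intro x y
  simp
  omega

theorem klP_eval {K : Type*} [Field K] [CharZero K] (n F a : ℕ) (hF : F ≠ 0) (t : K) :
    (F : K) ^ n * algebraMap ℚ K ((Polynomial.bernoulli n).eval (((a : ℚ) + 1) / F)) * t ^ n =
      klP n (((a + 1 : ℕ) : K) * t) (F * t) := by
  have hF' : (F : K) ≠ 0 := by exact_mod_cast hF
  unfold klP Polynomial.bernoulli
  rw [Polynomial.eval_finsetSum, map_sum, Finset.mul_sum, Finset.sum_mul]
  refine Finset.sum_congr rfl fun l hl => ?_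
  have hl' : l ≤ n := by simp at hl; omega
  obtain ⟨k, rfl⟩ : ∃ k, n = l + k := ⟨n - l, by omega⟩
  rw [Polynomial.eval_monomial, Nat.add_sub_cancel_left]
  simp only [map_mul, map_pow, map_div₀, map_add, map_natCast, map_one, eq_ratCast]
  push_cast
  rw [div_pow, pow_add, pow_add, mul_pow, mul_pow]
  field_simp

theorem klP_bound (p : ℕ) [hp : Fact p.Prime]
    {K : Type*} [NontriviallyNormedField K] [IsUltrametricDist K]
    [CharZero K] [Algebra ℚ_[p] K] (hK : ∀ x : ℚ_[p], ‖algebraMap ℚ_[p] K x‖ = ‖x‖)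
    (n : ℕ) (u v : K) (hu : ‖u‖ ≤ (p : ℝ)⁻¹) (hv : ‖v‖ ≤ (p : ℝ)⁻¹) :
    ‖klP n u v‖ ≤ p * (p : ℝ)⁻¹ ^ n := by
  unfold klP
  apply IsUltrametricDist.norm_sum_le_of_forall_le_of_nonneg (by positivity)
  intro l hl
  have hl' : l ≤ n := by simp at hl; omega
  have hb : ‖((bernoulli l : ℚ) : K)‖ ≤ p := by
    have := kl_bern p l
    rw [← hK, map_ratCast] at this
    exact this
  rw [norm_mul, norm_mul, norm_mul, norm_pow, norm_pow]
  have h1 := IsUltrametricDist.norm_natCast_le_one K (n.choose l)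
  calc _ ≤ 1 * (p : ℝ) * (p : ℝ)⁻¹ ^ l * (p : ℝ)⁻¹ ^ (n - l) := by gcongr
    _ = _ := by rw [mul_assoc, ← pow_add, one_mul]; congr 2; omega

theorem kl_norm_mulChar {K : Type*} [NontriviallyNormedField K] {M : ℕ} [NeZero M]
    (χ : DirichletCharacter K M) (a : (ZMod M)ˣ) : ‖χ a‖ = 1 := by
  have h : (χ a) ^ (Fintype.card (ZMod M)ˣ) = 1 := by
    rw [← map_pow, ← Units.val_pow_eq_pow_val, pow_card_eq_one]; simp
  have h2 := congrArg norm h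
  rw [norm_pow, norm_one] at h2
  exact (pow_eq_one_iff_of_nonneg (norm_nonneg _) Fintype.card_ne_zero).mp h2

/-- `‖⟨a⟩ - 1‖ ≤ 1/p`. -/
theorem kl_angle (p : ℕ) [hp : Fact p.Prime]
    {K : Type*} [NontriviallyNormedField K] [IsUltrametricDist K]
    [CharZero K] [Algebra ℚ_[p] K] (hK : ∀ x : ℚ_[p], ‖algebraMap ℚ_[p] K x‖ = ‖x‖)
    (ω : DirichletCharacter K p)
    (hω : ∀ a : (ZMod p)ˣ, ‖ω a - (((a : ZMod p).val : K))‖ < 1) (x : ℕ) (hx : x.Coprime p) :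
    ‖(x : K) * ω⁻¹ (x : ZMod p) - 1‖ ≤ (p : ℝ)⁻¹ := by
  have hnat : ∀ m : ℤ, (p : ℤ) ∣ m → ‖(m : K)‖ ≤ (p : ℝ)⁻¹ := by
    rintro m ⟨k, rfl⟩
    have h1 := IsUltrametricDist.norm_intCast_le_one K k
    have h2 : ‖(p : K)‖ = (p : ℝ)⁻¹ := by
      rw [← Padic.norm_p (p := p), ← hK, map_natCast]
    push_cast
    rw [norm_mul, h2]
    exact mul_le_of_le_one_right (by positivity) h1
  have hp1 : (p : ℝ)⁻¹ < 1 := inv_lt_one_of_one_lt₀ (by exact_mod_cast hp.out.one_lt)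
  let a : (ZMod p)ˣ := ZMod.unitOfCoprime x hx
  have ha : ((a : ZMod p)) = (x : ZMod p) := ZMod.coe_unitOfCoprime x hx
  have hinv : ω (x : ZMod p) * ω⁻¹ (x : ZMod p) = 1 := by
    rw [← ha, ← MulChar.mul_apply, mul_inv_cancel, MulChar.one_apply_coe]
  have hnω : ‖ω (x : ZMod p)‖ = 1 := by rw [← ha]; exact kl_norm_mulChar ω a
  have hnt : ‖ω⁻¹ (x : ZMod p)‖ = 1 := by rw [← ha]; exact kl_norm_mulChar ω⁻¹ a
  set t := ω⁻¹ (x : ZMod p) with ht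
  set u := (x : K) * t with hu
  have hlt : ‖ω (x : ZMod p) - (x : K)‖ < 1 := by
    have h1 := hω a
    rw [ha] at h1
    have h2 : ‖((x : K) - ((x : ZMod p).val : K))‖ ≤ (p : ℝ)⁻¹ := by
      have := hnat ((x : ℤ) - ((x : ZMod p).val : ℤ)) (by
        rw [← ZMod.intCast_zmod_eq_zero_iff_dvd]
        simp)
      push_cast at this
      simpa using this
    have : ω (x : ZMod p) - (x : K) = (ω (x : ZMod p) - ((x : ZMod p).val : K)) -
      ((x : K) - ((x : ZMod p).val : K)) := by ring
    rw [this]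
    exact lt_of_le_of_lt (kl_norm_sub _ _) (max_lt h1 (lt_of_le_of_lt h2 hp1))
  have hu1 : ‖u - 1‖ < 1 := by
    have : u - 1 = -((ω (x : ZMod p) - (x : K)) * t) := by
      rw [hu]; linear_combination hinv
    rw [this, norm_neg, norm_mul, hnt, mul_one]
    exact hlt
  have hpow : ‖u ^ (p - 1) - 1‖ ≤ (p : ℝ)⁻¹ := by
    have h1 : t ^ (p - 1) = 1 := by
      rw [ht, ← ha, ← map_pow, ← Units.val_pow_eq_pow_val, ZMod.units_pow_card_sub_one_eq_one]
      simp
    rw [hu, mul_pow, h1, mul_one]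
    have := hnat ((x : ℤ) ^ (p - 1) - 1) (by
      rw [← ZMod.intCast_zmod_eq_zero_iff_dvd]
      have h2 := ZMod.units_pow_card_sub_one_eq_one p a
      have h3 := congrArg (fun z : (ZMod p)ˣ => (z : ZMod p)) h2
      simp only [Units.val_pow_eq_pow_val, ha, Units.val_one] at h3
      push_cast
      rw [h3, sub_self])
    push_cast at this
    exact this
  have hgeom : ‖∑ i ∈ Finset.range (p - 1), u ^ i‖ = 1 := by
    have hul : ‖u‖ ≤ 1 := by
      rw [hu, norm_mul, hnt, mul_one]; exact IsUltrametricDist.norm_natCast_le_one K x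
    have hpi : ∀ i : ℕ, ‖u ^ i - 1‖ ≤ ‖u - 1‖ := by
      intro i
      rw [← mul_geom_sum, norm_mul]
      apply mul_le_of_le_one_right (norm_nonneg _)
      apply IsUltrametricDist.norm_sum_le_of_forall_le_of_nonneg zero_le_one
      intro j _
      rw [norm_pow]
      exact pow_le_one₀ (norm_nonneg _) hul
    have h1 : ‖(∑ i ∈ Finset.range (p - 1), u ^ i) + 1‖ < 1 := by
      have : (∑ i ∈ Finset.range (p - 1), u ^ i) + 1 =
          (∑ i ∈ Finset.range (p - 1), (u ^ i - 1)) - (-(p : K)) := by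
        rw [Finset.sum_sub_distrib]
        simp [Nat.cast_sub hp.out.one_le]
        ring
      rw [this]
      refine lt_of_le_of_lt (kl_norm_sub _ _) (max_lt ?_ ?_)
      · exact lt_of_le_of_lt (IsUltrametricDist.norm_sum_le_of_forall_le_of_nonneg
          (norm_nonneg (u - 1)) fun i _ => hpi i) hu1
      · rw [norm_neg]
        have := hnat p dvd_rfl
        push_cast at this
        exact lt_of_le_of_lt this hp1
    have h2 : (∑ i ∈ Finset.range (p - 1), u ^ i) =
      ((∑ i ∈ Finset.range (p - 1), u ^ i) + 1) + (-1) := by ring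
    rw [h2, IsUltrametricDist.norm_add_eq_max_of_norm_ne_norm (by
      rw [norm_neg, norm_one]; exact h1.ne), norm_neg, norm_one, max_eq_right h1.le]
  rw [← mul_geom_sum, norm_mul, hgeom, mul_one] at hpow
  exact hpow

open Filter in
/-- **(Kubota–Leopoldt.)** Let `K` be a complete nonarchimedean valued `ℚ_p`-algebra
field whose norm extends the `p`-adic one, `χ` a nontrivial Dirichlet character of
modulus `N ≥ 1` with values in `K`, and `ω` the Teichmüller character modulo `p`.
Writing `θ_n = χ·ω^(-n)` (at modulus `N·p`), there is a power series `Σ c_j·s^j`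
converging on the disc `|s|_p < p^((p-2)/(p-1))` whose value at `s = 1 - n` is
`(1 - θ_n(p)·p^(n-1))·(-B_{n,θ_n}/n) = (1 - χω^{-n}(p)p^{n-1})·L(1-n, χω^{-n})` for
every `n ≥ 1`: the `p`-adic Dirichlet `L`-function `L_p(s, χ)`. -/
theorem kubota_leopoldt
    (p : ℕ) [Fact p.Prime] (hodd : Odd p)
    (K : Type*) [NontriviallyNormedField K] [CompleteSpace K] [IsUltrametricDist K]
    [CharZero K] [Algebra ℚ_[p] K] (hK : ∀ x : ℚ_[p], ‖algebraMap ℚ_[p] K x‖ = ‖x‖)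
    (N : ℕ) (hN : 1 ≤ N) (χ : DirichletCharacter K N) (hχ : χ ≠ 1)
    (ω : DirichletCharacter K p)
    (hω : ∀ a : (ZMod p)ˣ, ‖ω a - (((a : ZMod p).val : K))‖ < 1) :
    ∃ c : ℕ → K,
      (∀ r : ℝ, 0 < r → r < (p : ℝ) ^ (((p : ℝ) - 2) / ((p : ℝ) - 1)) →
        Tendsto (fun j : ℕ => ‖c j‖ * r ^ j) atTop (nhds 0)) ∧
      ∀ n : ℕ, 1 ≤ n →
        HasSum (fun j : ℕ => c j * ((1 : K) - (n : K)) ^ j)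
          ((1 -
              (DirichletCharacter.changeLevel (Dvd.intro p rfl) χ *
                DirichletCharacter.changeLevel (Dvd.intro_left N rfl) (ω⁻¹ ^ n))
                ((p : ZMod (N * p))) * (p : K) ^ (n - 1)) *
            (-(generalizedBernoulli
                (DirichletCharacter.changeLevel (Dvd.intro p rfl) χ *
                  DirichletCharacter.changeLevel (Dvd.intro_left N rfl) (ω⁻¹ ^ n)) n) /
              (n : K))) := by
  have hp : p.Prime := Fact.out
  have hp1 : (1 : ℝ) < p := by exact_mod_cast hp.one_lt
  have hp0 : (0 : ℝ) < p := by linarith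
  have hp3 : (3 : ℝ) ≤ p := by
    have : 3 ≤ p := by
      rcases hp.eq_two_or_odd' with h | h
      · subst h; exact absurd hodd (by decide)
      · have := hp.two_le
        rcases h with ⟨k, hk⟩
        omega
    exact_mod_cast this
  set F := N * p with hFdef
  have hF0 : F ≠ 0 := Nat.mul_ne_zero (by omega) hp.ne_zero
  have : NeZero F := ⟨hF0⟩
  have : NeZero N := ⟨by omega⟩
  have hFK : (F : K) ≠ 0 := by exact_mod_cast hF0
  have hNF : N ∣ F := Dvd.intro p rfl
  have hpF : p ∣ F := Dvd.intro_left N rfl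
  have hnp : ‖(p : K)‖ = (p : ℝ)⁻¹ := by
    rw [← Padic.norm_p (p := p), ← hK, map_natCast]
  set R : ℝ := (p : ℝ) ^ (((p : ℝ) - 2) / ((p : ℝ) - 1)) with hRdef
  have hR : 1 < R := Real.one_lt_rpow hp1 (div_pos (by linarith) (by linarith))
  have hR0 : 0 < R := by linarith
  set χ' := DirichletCharacter.changeLevel hNF χ with hχ'
  let t : ℕ → K := fun x => ω⁻¹ (x : ZMod p)
  let A : ℕ → K := fun i => ∑ a ∈ Finset.range F, χ' (((a + 1 : ℕ) : ZMod F)) *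
    klP i (((a + 1 : ℕ) : K) * t (a + 1) - 1) (F * t (a + 1))
  have hsumF : ∀ g : ZMod F → K, ∑ a ∈ Finset.range F, g ((a + 1 : ℕ) : ZMod F) = ∑ z, g z := by
    intro g
    have h1 : ∑ z, g z = ∑ z, g (z + 1) := (Equiv.sum_comp (Equiv.addRight (1 : ZMod F)) g).symm
    rw [h1]
    refine Finset.sum_bij (fun a _ => (a : ZMod F)) (by simp) ?_ ?_ ?_
    · intro a ha b hb h
      rw [ZMod.natCast_eq_natCast_iff'] at h
      rw [Finset.mem_range] at ha hb
      rwa [Nat.mod_eq_of_lt ha, Nat.mod_eq_of_lt hb] at h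
    · intro z _
      exact ⟨z.val, Finset.mem_range.mpr (ZMod.val_lt z), ZMod.natCast_zmod_val z⟩
    · intro a _
      push_cast
      rfl
  have hA0 : A 0 = 0 := by
    have h1 : χ' ≠ 1 := by
      rw [hχ', Ne, DirichletCharacter.changeLevel_eq_one_iff]
      exact hχ
    have h2 := MulChar.sum_eq_zero_of_ne_one h1
    rw [← hsumF] at h2
    simpa [A, klP] using h2
  have hAb : ∀ i, ‖A i‖ ≤ p * (p : ℝ)⁻¹ ^ i := by
    intro i
    apply IsUltrametricDist.norm_sum_le_of_forall_le_of_nonneg (by positivity)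
    intro a _
    by_cases hc : (a + 1).Coprime F
    · have hcp : (a + 1).Coprime p := Nat.Coprime.coprime_dvd_right hpF hc
      have h1 : ‖χ' (((a + 1 : ℕ) : ZMod F))‖ = 1 := by
        rw [← ZMod.coe_unitOfCoprime _ hc]; exact kl_norm_mulChar _ _
      have h2 : ‖t (a + 1)‖ = 1 := by
        simp only [t]
        rw [← ZMod.coe_unitOfCoprime _ hcp]; exact kl_norm_mulChar _ _
      rw [norm_mul, h1, one_mul]
      apply klP_bound p hK
      · exact kl_angle p hK ω hω (a + 1) hcp
      · rw [norm_mul, h2, mul_one, hFdef]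
        push_cast
        rw [norm_mul, hnp]
        exact mul_le_of_le_one_left (by positivity) (IsUltrametricDist.norm_natCast_le_one K N)
    · have h1 : χ' (((a + 1 : ℕ) : ZMod F)) = 0 := by
        apply MulChar.map_nonunit
        rwa [ZMod.isUnit_iff_coprime]
      rw [h1, zero_mul, norm_zero]
      positivity
  have hθ : ∀ n x : ℕ, (χ' * DirichletCharacter.changeLevel hpF (ω⁻¹ ^ n)) (x : ZMod F) =
      χ' (x : ZMod F) * t x ^ n := by
    intro n x
    rw [MulChar.mul_apply]
    by_cases hc : x.Coprime F
    · congr 1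
      have hcp : x.Coprime p := Nat.Coprime.coprime_dvd_right hpF hc
      rw [← ZMod.coe_unitOfCoprime _ hc, DirichletCharacter.changeLevel_eq_cast_of_dvd]
      rw [ZMod.coe_unitOfCoprime, ZMod.cast_natCast hpF]
      simp only [t]
      rw [← ZMod.coe_unitOfCoprime _ hcp, MulChar.pow_apply_coe]
    · have h1 : χ' (x : ZMod F) = 0 := by
        apply MulChar.map_nonunit
        rwa [ZMod.isUnit_iff_coprime]
      rw [h1, zero_mul, zero_mul]
  have hgB : ∀ n : ℕ, 1 ≤ n → (F : K) * generalizedBernoulli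
      (χ' * DirichletCharacter.changeLevel hpF (ω⁻¹ ^ n)) n =
      ∑ i ∈ Finset.range (n + 1), (n.choose i : K) * A i := by
    intro n hn
    unfold generalizedBernoulli
    rw [← mul_assoc, ← pow_succ', Nat.sub_add_cancel hn, Finset.mul_sum]
    simp only [A, Finset.mul_sum]
    rw [Finset.sum_comm]
    refine Finset.sum_congr rfl fun a _ => ?_
    rw [hθ]
    have h1 := klP_trans n (((a + 1 : ℕ) : K) * t (a + 1) - 1) (F * t (a + 1))
    rw [sub_add_cancel, ← klP_eval n F a hF0] at h1
    have h2 : ∀ i, (n.choose i : K) * (χ' (((a + 1 : ℕ) : ZMod F)) *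
      klP i (((a + 1 : ℕ) : K) * t (a + 1) - 1) (F * t (a + 1))) = χ' (((a + 1 : ℕ) : ZMod F)) *
       ((n.choose i : K) * klP i (((a + 1 : ℕ) : K) * t (a + 1) - 1) (F * t (a + 1))) := by
      intro i; ring
    simp only [h2]
    rw [← Finset.mul_sum, ← h1]
    ring
  let d : ℕ → K := fun m => -(-1) ^ m * A (m + 1) / (F * ((m + 1).factorial : K))
  have hdb : ∀ m, ‖d m‖ ≤ (p * ‖(F : K)‖⁻¹) * R⁻¹ ^ (m + 1) := by
    intro m
    have h1 := kl_fact p (m + 1)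
    rw [← hK, map_natCast] at h1
    have h2 : R⁻¹ = (p : ℝ)⁻¹ * (p : ℝ) ^ (1 / ((p : ℝ) - 1)) := by
      rw [hRdef, ← Real.rpow_neg hp0.le, ← Real.rpow_neg_one, ← Real.rpow_add hp0]
      congr 1
      have : (p : ℝ) - 1 ≠ 0 := by linarith
      field_simp
      ring
    simp only [d]
    rw [norm_div, norm_mul, norm_mul, norm_neg, norm_pow, norm_neg, norm_one, one_pow, one_mul,
      h2, mul_pow, div_eq_mul_inv, mul_inv]
    calc _ ≤ (p * (p : ℝ)⁻¹ ^ (m + 1)) * (‖(F : K)‖⁻¹ *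
          ((p : ℝ) ^ (1 / ((p : ℝ) - 1))) ^ (m + 1)) := by
          gcongr
          exact hAb _
      _ = _ := by ring
  have hd : ∀ r : ℝ, 0 < r → r < R →
      Tendsto (fun m : ℕ => ‖d m‖ * r ^ m) atTop (nhds 0) := by
    intro r hr hrR
    have h1 : Tendsto (fun m : ℕ => (p * ‖(F : K)‖⁻¹ * R⁻¹) * (r / R) ^ m) atTop (nhds 0) := by
      have := (tendsto_pow_atTop_nhds_zero_of_lt_one (r := r / R) (by positivity)
        ((div_lt_one hR0).mpr hrR)).const_mul (p * ‖(F : K)‖⁻¹ * R⁻¹)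
      simpa using this
    refine squeeze_zero (fun m => by positivity) (fun m => ?_) h1
    calc ‖d m‖ * r ^ m ≤ ((p * ‖(F : K)‖⁻¹) * R⁻¹ ^ (m + 1)) * r ^ m := by
          gcongr
          exact hdb m
      _ = _ := by rw [div_eq_mul_inv, mul_pow]; ring
  obtain ⟨c, hc1, hc2⟩ := kl_analytic R hR d hd (fun m => ascPochhammer ℤ m)
    (fun m => (ascPochhammer_natDegree ℤ m).le)
  refine ⟨c, hc1, fun n hn => ?_⟩
  have hnK : (n : K) ≠ 0 := by exact_mod_cast (by omega : n ≠ 0)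
  have hpz : (χ' * DirichletCharacter.changeLevel hpF (ω⁻¹ ^ n)) (p : ZMod F) = 0 := by
    apply MulChar.map_nonunit
    rw [ZMod.isUnit_iff_coprime]
    intro h
    have := Nat.Coprime.eq_one_of_dvd h hpF
    exact hp.one_lt.ne' this
  have hgoal : (1 - (χ' * DirichletCharacter.changeLevel hpF (ω⁻¹ ^ n)) (p : ZMod F) *
      (p : K) ^ (n - 1)) * (-(generalizedBernoulli
      (χ' * DirichletCharacter.changeLevel hpF (ω⁻¹ ^ n)) n) / (n : K)) =
      ∑ m ∈ Finset.range n, d m * (ascPochhammer ℤ m).aeval ((1 : K) - n) := by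
    rw [hpz, zero_mul, sub_zero, one_mul, div_eq_iff hnK, ← mul_right_inj' hFK, mul_neg, hgB n hn,
      Finset.sum_range_succ', hA0, mul_zero, add_zero, Finset.sum_mul, Finset.mul_sum,
      ← Finset.sum_neg_distrib]
    refine Finset.sum_congr rfl fun m _ => ?_
    obtain ⟨k, rfl⟩ : ∃ k, n = k + 1 := ⟨n - 1, by omega⟩
    have h1 : (ascPochhammer ℤ m).aeval ((1 : K) - ((k + 1 : ℕ) : K)) =
        (-1) ^ m * (k.descFactorial m : K) := by
      have : (1 : K) - ((k + 1 : ℕ) : K) = -(k : K) := by push_cast; ring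
      rw [this, Polynomial.aeval_def, Polynomial.eval₂_eq_eval_map, ascPochhammer_map,
        ascPochhammer_eval_neg_eq_descPochhammer, descPochhammer_eval_eq_descFactorial]
    have h2 : ((k + 1).choose (m + 1) : K) * ((m + 1).factorial : K) =
        ((k + 1 : ℕ) : K) * (k.descFactorial m : K) := by
      have := Nat.descFactorial_eq_factorial_mul_choose (k + 1) (m + 1)
      rw [Nat.succ_descFactorial_succ] at this
      rw [mul_comm]
      exact_mod_cast this.symm
    have hf : ((m + 1).factorial : K) ≠ 0 := by exact_mod_cast Nat.factorial_ne_zero _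
    have h3 : ((-1 : K) ^ m) * (-1) ^ m = 1 := by rw [← mul_pow]; simp
    rw [h1]
    simp only [d]
    have h4 : ((k + 1).choose (m + 1) : K) =
        ((k + 1 : ℕ) : K) * (k.descFactorial m : K) / ((m + 1).factorial : K) := by
      rw [← h2]; field_simp
    rw [h4]
    generalize ((m + 1).factorial : K) = f at hf ⊢
    generalize (((k + 1 : ℕ) : K)) = k1
    field_simp
    linear_combination (A (m + 1) * k1 * (k.descFactorial m : K)) * h3
  refine hc2 _ _ ?_ ?_
  · have := IsUltrametricDist.norm_intCast_le_one K (1 - (n : ℤ))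
    push_cast at this
    exact this
  · have key := hasSum_sum_of_ne_finset_zero (L := .unconditional ℕ) (s := Finset.range n)
      (f := fun m => d m * (ascPochhammer ℤ m).aeval ((1 : K) - n)) (by
        intro m hm
        have hm' : n ≤ m := by simpa using hm
        obtain ⟨k, rfl⟩ : ∃ k, n = k + 1 := ⟨n - 1, by omega⟩
        have : (1 : K) - ((k + 1 : ℕ) : K) = -(k : K) := by push_cast; ring
        rw [this, Polynomial.aeval_def, Polynomial.eval₂_eq_eval_map, ascPochhammer_map,
          ascPochhammer_eval_neg_eq_descPochhammer, descPochhammer_eval_eq_descFactorial,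
          Nat.descFactorial_of_lt (by omega)]
        simp)
    rw [← hgoal] at key
    exact key
end
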